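/- Fix exponents 1<p,q≤∞ and 0<γ<1 with 3/p+2/q=2−γ. There exists a constant N₀=N₀(p,q,γ) such that the following holds. Let (u,Π) be a classical axisymmetric solution of the 3D Navier–Stokes equations on Q(1), let z₀=(0,x_{0,3},t₀)∈Q(1/8) be an axis point, let 0<β<1/8 and α=γβ/(6+2γ), and suppose G(z₀,R)·ω(R)^α ≤ G for all 0<R≤1/4. Then for all 0<R≤1/4, 𝓔(z₀,R)·ω(R)^β ≤ N₀^{12/γ}·(1 + 𝓔((0,0),1)^{18} + G^{(6+2γ)/γ}). -/

import Mathlib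

open Real MeasureTheory Set
open scoped ENNReal
noncomputable section

abbrev E3 := EuclideanSpace ℝ (Fin 3)

/-- `i`-th standard basis vector of `ℝ³`. -/
def ee (i : Fin 3) : E3 := EuclideanSpace.single i 1

/-- partial derivative of a scalar function in the direction `eᵢ`. -/
def pd (f : E3 → ℝ) (i : Fin 3) (x : E3) : ℝ := fderiv ℝ f x (ee i)

/-- Laplacian of a scalar function. -/
def lap (f : E3 → ℝ) (x : E3) : ℝ := ∑ i, pd (fun y => pd f i y) i x

/-- parabolic cylinder `Q(z₀,R) = B(x₀,R) × (t₀ - R², t₀)`. -/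
def Qyl (z₀ : E3 × ℝ) (R : ℝ) : Set (E3 × ℝ) :=
  (Metric.ball z₀.1 R) ×ˢ (Ioo (z₀.2 - R ^ 2) z₀.2)

/-- `(u, P)` is a classical solution of the 3D Navier–Stokes equations on the open set `U`,
which contains the closure of `Q(1)`. -/
structure IsNSQ1 (u : E3 → ℝ → E3) (P : E3 → ℝ → ℝ) (U : Set (E3 × ℝ)) : Prop where
  open_U : IsOpen U
  subset_U : closure (Qyl (0, 0) 1) ⊆ U
  smooth_u : ContDiffOn ℝ (⊤ : ℕ∞) (fun z : E3 × ℝ => u z.1 z.2) U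
  smooth_P : ContDiffOn ℝ (⊤ : ℕ∞) (fun z : E3 × ℝ => P z.1 z.2) U
  momentum : ∀ x : E3, ∀ t : ℝ, (x, t) ∈ U → ∀ j : Fin 3,
    deriv (fun s => u x s j) t
      + (∑ i, u x t i * pd (fun y => u y t j) i x)
      - lap (fun y => u y t j) x
      + pd (fun y => P y t) j x = 0
  divfree : ∀ x : E3, ∀ t : ℝ, (x, t) ∈ U → ∑ i, pd (fun y => u y t i) i x = 0

/-- `(u, P)` is axially symmetric on `U`: in cylindrical coordinates
`u = uʳ eᵣ + uᶿ e_θ + u³ e₃` and `P = p(r, x₃, t)`. -/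
def IsAxisym (u : E3 → ℝ → E3) (P : E3 → ℝ → ℝ) (U : Set (E3 × ℝ)) : Prop :=
  ∃ ur uθ u3 pp : ℝ → ℝ → ℝ → ℝ,
    ∀ x : E3, ∀ t : ℝ, (x, t) ∈ U → x 0 ^ 2 + x 1 ^ 2 ≠ 0 →
      u x t 0 = ur (Real.sqrt (x 0 ^ 2 + x 1 ^ 2)) (x 2) t
                  * (x 0 / Real.sqrt (x 0 ^ 2 + x 1 ^ 2))
                - uθ (Real.sqrt (x 0 ^ 2 + x 1 ^ 2)) (x 2) t
                  * (x 1 / Real.sqrt (x 0 ^ 2 + x 1 ^ 2)) ∧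
      u x t 1 = ur (Real.sqrt (x 0 ^ 2 + x 1 ^ 2)) (x 2) t
                  * (x 1 / Real.sqrt (x 0 ^ 2 + x 1 ^ 2))
                + uθ (Real.sqrt (x 0 ^ 2 + x 1 ^ 2)) (x 2) t
                  * (x 0 / Real.sqrt (x 0 ^ 2 + x 1 ^ 2)) ∧
      u x t 2 = u3 (Real.sqrt (x 0 ^ 2 + x 1 ^ 2)) (x 2) t ∧
      P x t = pp (Real.sqrt (x 0 ^ 2 + x 1 ^ 2)) (x 2) t

/-- `Γ = r uᶿ = x₁ u₂ - x₂ u₁`. -/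
def Gam (u : E3 → ℝ → E3) (x : E3) (t : ℝ) : ℝ := x 0 * u x t 1 - x 1 * u x t 0

/-- Cartesian components of `b = uʳ eᵣ + u³ e₃ = u - uᶿ e_θ`. -/
def bcomp (u : E3 → ℝ → E3) (x : E3) (t : ℝ) : Fin 3 → ℝ :=
  ![u x t 0 + x 1 * Gam u x t / (x 0 ^ 2 + x 1 ^ 2),
    u x t 1 - x 0 * Gam u x t / (x 0 ^ 2 + x 1 ^ 2),
    u x t 2]

/-- Euclidean norm of `b`. -/
def bnorm (u : E3 → ℝ → E3) (x : E3) (t : ℝ) : ℝ :=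
  Real.sqrt (∑ i, (bcomp u x t i) ^ 2)

/-- `A(z₀,R)`. -/
def AA (u : E3 → ℝ → E3) (z₀ : E3 × ℝ) (R : ℝ) : ℝ :=
  ⨆ t ∈ Ioo (z₀.2 - R ^ 2) z₀.2, R⁻¹ * ∫ x in Metric.ball z₀.1 R, ‖u x t‖ ^ 2

/-- `E(z₀,R)`. -/
def EE (u : E3 → ℝ → E3) (z₀ : E3 × ℝ) (R : ℝ) : ℝ :=
  R⁻¹ * ∫ t in Ioo (z₀.2 - R ^ 2) z₀.2, ∫ x in Metric.ball z₀.1 R,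
    ∑ j, ∑ i, (pd (fun y => u y t j) i x) ^ 2

/-- `C(z₀,R)`. -/
def CC (u : E3 → ℝ → E3) (z₀ : E3 × ℝ) (R : ℝ) : ℝ :=
  (R ^ 2)⁻¹ * ∫ t in Ioo (z₀.2 - R ^ 2) z₀.2, ∫ x in Metric.ball z₀.1 R, ‖u x t‖ ^ 3

/-- `D(z₀,R)`. -/
def DD (P : E3 → ℝ → ℝ) (z₀ : E3 × ℝ) (R : ℝ) : ℝ :=
  (R ^ 2)⁻¹ * ∫ t in Ioo (z₀.2 - R ^ 2) z₀.2, ∫ x in Metric.ball z₀.1 R, |P x t| ^ (3/2 : ℝ)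

/-- `𝓔(z₀,R) = A + E + D`. -/
def EEE (u : E3 → ℝ → E3) (P : E3 → ℝ → ℝ) (z₀ : E3 × ℝ) (R : ℝ) : ℝ :=
  AA u z₀ R + EE u z₀ R + DD P z₀ R

/-- the weight `ω(R) = (ln ln (100/R))⁻¹`. -/
def omg (R : ℝ) : ℝ := (Real.log (Real.log (100 / R)))⁻¹

/-- `G(z₀,R) = R^{1-3/p-2/q} ‖b‖_{L^{p,q}(Q(z₀,R))}` (space norm `Lᵖ`, time norm `L^q`). -/
def Gfun (u : E3 → ℝ → E3) (p q : ℝ≥0∞) (z₀ : E3 × ℝ) (R : ℝ) : ℝ :=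
  R ^ (1 - 3 / p.toReal - 2 / q.toReal) *
    (eLpNorm (fun t =>
        (eLpNorm (fun x => bnorm u x t) p (volume.restrict (Metric.ball z₀.1 R))).toReal)
      q (volume.restrict (Ioo (z₀.2 - R ^ 2) z₀.2))).toReal

/-- `m_R = inf_{Q(R)} Γ`. -/
def mR (u : E3 → ℝ → E3) (R : ℝ) : ℝ :=
  sInf ((fun z : E3 × ℝ => Gam u z.1 z.2) '' Qyl (0, 0) R)

/-- `M_R = sup_{Q(R)} Γ`. -/
def MMR (u : E3 → ℝ → E3) (R : ℝ) : ℝ :=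
  sSup ((fun z : E3 × ℝ => Gam u z.1 z.2) '' Qyl (0, 0) R)

/-- `J_R = M_R - m_R`. -/
def JR (u : E3 → ℝ → E3) (R : ℝ) : ℝ := MMR u R - mR u R

/-- the normalized function `h`. -/
def hfun (u : E3 → ℝ → E3) (R : ℝ) (x : E3) (t : ℝ) : ℝ :=
  if -(mR u R) < MMR u R then 2 * (MMR u R - Gam u x t) / JR u R
  else 2 * (Gam u x t - mR u R) / JR u R

/-- oscillation of `Γ` over `Q(z₀,R)`. -/
def oscΓ (u : E3 → ℝ → E3) (z₀ : E3 × ℝ) (R : ℝ) : ℝ :=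
  sSup ((fun z : E3 × ℝ => Gam u z.1 z.2) '' Qyl z₀ R) -
    sInf ((fun z : E3 × ℝ => Gam u z.1 z.2) '' Qyl z₀ R)

/-- Spatial partial derivative of a function on space-time. -/
def dX (i : Fin 3) (f : E3 × ℝ → ℝ) (z : E3 × ℝ) : ℝ := fderiv ℝ f z (ee i, 0)

/-- Time derivative of a function on space-time. -/
def dT (f : E3 × ℝ → ℝ) (z : E3 × ℝ) : ℝ := fderiv ℝ f z (0, 1)

/-- Smooth functions on space-time. -/
abbrev Sm (f : E3 × ℝ → ℝ) : Prop := ContDiff ℝ (⊤ : ℕ∞) f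

theorem Sm.diff {f : E3 × ℝ → ℝ} (hf : Sm f) (z) : DifferentiableAt ℝ f z :=
  (hf.differentiable (by simp)) z

theorem Sm.dX {f : E3 × ℝ → ℝ} (hf : Sm f) (i : Fin 3) : Sm (dX i f) :=
  (hf.fderiv_right (m := ((⊤ : ℕ∞) : WithTop ℕ∞)) (by simp)).clm_apply contDiff_const

theorem Sm.dT {f : E3 × ℝ → ℝ} (hf : Sm f) : Sm (dT f) :=
  (hf.fderiv_right (m := ((⊤ : ℕ∞) : WithTop ℕ∞)) (by simp)).clm_apply contDiff_const

theorem Sm.cont {f : E3 × ℝ → ℝ} (hf : Sm f) : Continuous f := hf.continuous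

theorem sm_coord (j : Fin 3) : Sm (fun z => z.1 j) := by
  have : (fun z : E3 × ℝ => z.1 j) =
      (EuclideanSpace.proj (𝕜 := ℝ) j).comp (ContinuousLinearMap.fst ℝ E3 ℝ) := rfl
  rw [this]
  exact ContinuousLinearMap.contDiff _

theorem fderiv_coord (j : Fin 3) (z : E3 × ℝ) (v : E3 × ℝ) :
    fderiv ℝ (fun z : E3 × ℝ => z.1 j) z v = v.1 j := by
  have : (fun z : E3 × ℝ => z.1 j) =
      (EuclideanSpace.proj (𝕜 := ℝ) j).comp (ContinuousLinearMap.fst ℝ E3 ℝ) := rfl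
  rw [this, ContinuousLinearMap.fderiv]
  rfl

theorem dX_coord (i j : Fin 3) (z : E3 × ℝ) :
    dX i (fun z => z.1 j) z = if j = i then 1 else 0 := by
  rw [dX, fderiv_coord]; simp [ee]

theorem dT_coord (j : Fin 3) (z : E3 × ℝ) : dT (fun z => z.1 j) z = 0 := by
  rw [dT, fderiv_coord]; simp

section rules
variable {f g : E3 × ℝ → ℝ} (hf : Sm f) (hg : Sm g) (i : Fin 3) (z : E3 × ℝ)
include hf hg

theorem dX_mul : dX i (fun z => f z * g z) z = dX i f z * g z + f z * dX i g z := by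
  simp only [dX]; rw [fderiv_fun_mul (hf.diff z) (hg.diff z)]; simp; ring
theorem dT_mul : dT (fun z => f z * g z) z = dT f z * g z + f z * dT g z := by
  simp only [dT]; rw [fderiv_fun_mul (hf.diff z) (hg.diff z)]; simp; ring
theorem dX_add : dX i (fun z => f z + g z) z = dX i f z + dX i g z := by
  simp only [dX]; rw [fderiv_fun_add (hf.diff z) (hg.diff z)]; simp
theorem dT_add : dT (fun z => f z + g z) z = dT f z + dT g z := by
  simp only [dT]; rw [fderiv_fun_add (hf.diff z) (hg.diff z)]; simp
theorem dX_sub : dX i (fun z => f z - g z) z = dX i f z - dX i g z := by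
  simp only [dX]; rw [fderiv_fun_sub (hf.diff z) (hg.diff z)]; simp
theorem dT_sub : dT (fun z => f z - g z) z = dT f z - dT g z := by
  simp only [dT]; rw [fderiv_fun_sub (hf.diff z) (hg.diff z)]; simp
end rules

theorem dX_const (i : Fin 3) (c : ℝ) (z) : dX i (fun _ => c) z = 0 := by simp [dX]
theorem dT_const (c : ℝ) (z) : dT (fun _ => c) z = 0 := by simp [dT]

theorem dX_sum {f : Fin 3 → E3 × ℝ → ℝ} (hf : ∀ j, Sm (f j)) (i : Fin 3) (z) :
    dX i (fun z => ∑ j, f j z) z = ∑ j, dX i (f j) z := by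
  simp only [dX]; rw [fderiv_fun_sum (fun j _ => (hf j).diff z)]; simp
theorem dT_sum {f : Fin 3 → E3 × ℝ → ℝ} (hf : ∀ j, Sm (f j)) (z) :
    dT (fun z => ∑ j, f j z) z = ∑ j, dT (f j) z := by
  simp only [dT]; rw [fderiv_fun_sum (fun j _ => (hf j).diff z)]; simp

theorem dX_comp {f : E3 × ℝ → ℝ} (hf : Sm f) {F : ℝ → ℝ} {F' : ℝ} (i : Fin 3) (z)
    (hF : HasDerivAt F F' (f z)) : dX i (fun z => F (f z)) z = F' * dX i f z := by
  change fderiv ℝ (F ∘ f) z _ = F' * fderiv ℝ f z _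
  rw [(hF.comp_hasFDerivAt z (hf.diff z).hasFDerivAt).fderiv]; simp
theorem dT_comp {f : E3 × ℝ → ℝ} (hf : Sm f) {F : ℝ → ℝ} {F' : ℝ} (z)
    (hF : HasDerivAt F F' (f z)) : dT (fun z => F (f z)) z = F' * dT f z := by
  change fderiv ℝ (F ∘ f) z _ = F' * fderiv ℝ f z _
  rw [(hF.comp_hasFDerivAt z (hf.diff z).hasFDerivAt).fderiv]; simp

theorem fderiv_comm_dir {f : E3 × ℝ → ℝ} (hf : Sm f) (v w : E3 × ℝ) (z) :
    fderiv ℝ (fun z => fderiv ℝ f z v) z w = fderiv ℝ (fun z => fderiv ℝ f z w) z v := by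
  have h1 : ∀ v : E3 × ℝ, fderiv ℝ (fun z => fderiv ℝ f z v) z =
      (fderiv ℝ (fderiv ℝ f) z).flip v := by
    intro v
    have hd : DifferentiableAt ℝ (fderiv ℝ f) z :=
      ((hf.fderiv_right (m := ((⊤ : ℕ∞) : WithTop ℕ∞)) (by simp)).differentiable (by simp)) z
    rw [fderiv_clm_apply hd (by fun_prop)]
    simp
  rw [h1, h1]
  have := (hf.contDiffAt (x := z)).isSymmSndFDerivAt
    (by simp only [minSmoothness_of_isRCLikeNormedField]; exact WithTop.coe_le_coe.mpr le_top)
  exact this w v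

theorem dX_comm {f : E3 × ℝ → ℝ} (hf : Sm f) (i j : Fin 3) (z) :
    dX i (dX j f) z = dX j (dX i f) z := fderiv_comm_dir hf _ _ z
theorem dX_dT_comm {f : E3 × ℝ → ℝ} (hf : Sm f) (i : Fin 3) (z) :
    dX i (dT f) z = dT (dX i f) z := fderiv_comm_dir hf _ _ z

theorem hasFDerivAt_slice {f : E3 × ℝ → ℝ} (hf : Sm f) (x : E3) (t : ℝ) :
    HasFDerivAt (fun y => f (y, t))
      ((fderiv ℝ f (x, t)).comp (ContinuousLinearMap.inl ℝ E3 ℝ)) x :=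
  (hf.diff (x, t)).hasFDerivAt.comp x (hasFDerivAt_prodMk_left x t)

theorem pd_eq {f : E3 × ℝ → ℝ} (hf : Sm f) (i : Fin 3) (x : E3) (t : ℝ) :
    pd (fun y => f (y, t)) i x = dX i f (x, t) := by
  rw [pd, (hasFDerivAt_slice hf x t).fderiv]; simp [dX]

theorem hasDerivAt_time {f : E3 × ℝ → ℝ} (hf : Sm f) (x : E3) (t : ℝ) :
    HasDerivAt (fun s => f (x, s)) (dT f (x, t)) t := by
  have h := (hf.diff (x, t)).hasFDerivAt.comp_hasDerivAt t
    ((hasDerivAt_const t x).prodMk (hasDerivAt_id t))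
  exact h

theorem dX_congr {f g : E3 × ℝ → ℝ} {z} (h : f =ᶠ[nhds z] g) (i : Fin 3) : dX i f z = dX i g z := by
  rw [dX, dX, h.fderiv_eq]
theorem dT_congr {f g : E3 × ℝ → ℝ} {z} (h : f =ᶠ[nhds z] g) : dT f z = dT g z := by
  rw [dT, dT, h.fderiv_eq]

theorem ion {X : Type*} [MetricSpace X] [ProperSpace X] [MeasurableSpace X] [BorelSpace X]
    {μ : Measure X} [IsFiniteMeasureOnCompacts μ] {f : X → ℝ} (hf : Continuous f) {S : Set X}
    (hS : Bornology.IsBounded S) : IntegrableOn f S μ :=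
  (hf.continuousOn.integrableOn_compact hS.isCompact_closure).mono_set subset_closure

theorem bdd_cyl (x : E3) (ρ a b : ℝ) :
    Bornology.IsBounded ((Metric.ball x ρ) ×ˢ (Ioo a b) : Set (E3 × ℝ)) :=
  Metric.isBounded_ball.prod (Metric.isBounded_Ioo a b)

theorem int_dX_zero {W : E3 × ℝ → ℝ} (hW : Sm W) (t : ℝ) {ρ : ℝ}
    (h0 : ∀ x, ρ ≤ ‖x‖ → W (x, t) = 0) (i : Fin 3) : ∫ x, dX i W (x, t) = 0 := by
  have hc : HasCompactSupport (fun x => W (x, t)) := by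
    refine HasCompactSupport.intro (isCompact_closedBall (0 : E3) ρ) ?_
    intro x hx
    apply h0
    simp at hx
    exact hx.le
  have hcd : Continuous (fun x => W (x, t)) := hW.cont.comp (by fun_prop)
  have hcd' : Continuous (fun x => dX i W (x, t)) := (hW.dX i).cont.comp (by fun_prop)
  have e : (fun x => dX i W (x, t)) = fun x => fderiv ℝ (fun y => W (y, t)) x (ee i) := by
    funext x
    rw [(hasFDerivAt_slice hW x t).fderiv]; simp [dX]
  have hc' : HasCompactSupport (fun x => dX i W (x, t)) := by
    rw [e]
    exact hc.fderiv_apply ℝ (ee i)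
  rw [e] at hc' hcd' ⊢
  have := integral_bilinear_hasFDerivAt_right_eq_neg_left_of_integrable (μ := volume)
    (f := fun _ : E3 => (1 : ℝ)) (f' := fun _ => 0) (g := fun y => W (y, t))
    (g' := fun x => fderiv ℝ (fun y => W (y, t)) x) (v := ee i)
    (B := ContinuousLinearMap.mul ℝ ℝ) (by simp)
    (by simpa using hcd'.integrable_of_hasCompactSupport hc')
    (by simpa using hcd.integrable_of_hasCompactSupport hc)
    (fun x _ => hasFDerivAt_const _ _)
    (fun x _ => (hasFDerivAt_slice hW x t).differentiableAt.hasFDerivAt)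
  simpa using this

theorem setInt_prod {f : E3 × ℝ → ℝ} (hf : Continuous f) (x : E3) (ρ a b : ℝ) :
    ∫ z in (Metric.ball x ρ) ×ˢ (Ioo a b), f z =
      ∫ y in Metric.ball x ρ, ∫ t in Ioo a b, f (y, t) := by
  rw [Measure.volume_eq_prod]
  exact setIntegral_prod _ (ion hf (bdd_cyl x ρ a b))

theorem setInt_prod_symm {f : E3 × ℝ → ℝ} (hf : Continuous f) (x : E3) (ρ a b : ℝ) :
    ∫ z in (Metric.ball x ρ) ×ˢ (Ioo a b), f z =
      ∫ t in Ioo a b, ∫ y in Metric.ball x ρ, f (y, t) := by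
  rw [Measure.volume_eq_prod, ← Measure.prod_restrict, integral_prod_symm]
  rw [Measure.prod_restrict]
  exact ion hf (bdd_cyl x ρ a b)

/-- Space-time divergence theorem on the unit cylinder. -/
theorem flux {WT Z : E3 × ℝ → ℝ} {W : Fin 3 → E3 × ℝ → ℝ} (hWT : Sm WT) (hW : ∀ i, Sm (W i))
    {T : ℝ} (hT : -1 ≤ T) {ρ : ℝ} (hρ : ρ < 1)
    (hsW : ∀ i x t, ρ ≤ ‖x‖ → W i (x, t) = 0) (h0 : ∀ x, WT (x, -1) = 0)
    (hid : ∀ x t, ‖x‖ < 1 → -1 < t → t < T → dT WT (x, t) = Z (x, t) + ∑ i, dX i (W i) (x, t)) :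
    ∫ x in Metric.ball (0 : E3) 1, WT (x, T) =
      ∫ z in (Metric.ball (0 : E3) 1) ×ˢ (Ioo (-1) T), Z z := by
  set S := (Metric.ball (0 : E3) 1) ×ˢ (Ioo (-1) T)
  have hS : MeasurableSet S := Metric.isOpen_ball.measurableSet.prod measurableSet_Ioo
  have hb : Bornology.IsBounded S := bdd_cyl _ _ _ _
  have e1 : ∫ z in S, Z z = ∫ z in S, (dT WT z - ∑ i, dX i (W i) z) := by
    apply setIntegral_congr_fun hS
    rintro ⟨x, t⟩ ⟨hx, ht⟩
    simp at hx ht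
    have := hid x t hx ht.1 ht.2
    simp only
    linarith
  rw [e1, integral_sub (ion hWT.dT.cont hb)
    (integrable_finsetSum _ fun i _ => ion ((hW i).dX i).cont hb),
    integral_finsetSum _ fun i _ => ion ((hW i).dX i).cont hb]
  have e2 : ∀ i, ∫ z in S, dX i (W i) z = 0 := by
    intro i
    rw [setInt_prod_symm ((hW i).dX i).cont]
    apply integral_eq_zero_of_ae
    refine Filter.Eventually.of_forall fun t => ?_
    simp only [Pi.zero_apply]
    rw [setIntegral_eq_integral_of_forall_compl_eq_zero, int_dX_zero (hW i) t (fun x => hsW i x t)]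
    intro x hx
    simp at hx
    rw [dX_congr (g := fun _ => 0)]
    · simp [dX]
    have : ∀ᶠ z : E3 × ℝ in nhds (x, t), ρ < ‖z.1‖ := by
      apply (continuous_norm.comp continuous_fst).continuousAt.eventually_mem
      exact Ioi_mem_nhds (by simp; linarith)
    filter_upwards [this] with z hz
    exact hsW i z.1 z.2 hz.le
  simp only [e2, Finset.sum_const_zero, sub_zero]
  rw [setInt_prod hWT.dT.cont]
  apply integral_congr_ae
  refine Filter.Eventually.of_forall fun x => ?_
  simp only
  rw [← integral_Ioc_eq_integral_Ioo, ← intervalIntegral.integral_of_le hT,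
    intervalIntegral.integral_eq_sub_of_hasDerivAt (fun t _ => hasDerivAt_time hWT x t), h0, sub_zero]
  exact (hWT.dT.cont.comp (by fun_prop)).intervalIntegrable _ _

theorem holder3 {X : Type*} [MeasurableSpace X] {μ : Measure X} {f g h : X → ℝ}
    (hf : Integrable f μ) (hg : Integrable g μ) (hh : Integrable h μ)
    (f0 : ∀ x, 0 ≤ f x) (g0 : ∀ x, 0 ≤ g x) (h0 : ∀ x, 0 ≤ h x)
    {a b c : ℝ} (ha : 0 ≤ a) (hb : 0 ≤ b) (hc : 0 ≤ c) (habc : a + b + c = 1) :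
    ∫ x, f x ^ a * g x ^ b * h x ^ c ∂μ ≤
      (∫ x, f x ∂μ) ^ a * (∫ x, g x ∂μ) ^ b * (∫ x, h x ∂μ) ^ c := by
  have key := ENNReal.lintegral_prod_norm_pow_le (μ := μ) (Finset.univ : Finset (Fin 3))
    (f := ![fun x => ENNReal.ofReal (f x), fun x => ENNReal.ofReal (g x),
      fun x => ENNReal.ofReal (h x)]) (p := ![a, b, c])
    (by
      intro i _
      fin_cases i
      · exact hf.aemeasurable.ennreal_ofReal
      · exact hg.aemeasurable.ennreal_ofReal
      · exact hh.aemeasurable.ennreal_ofReal)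
    (by simpa [Fin.sum_univ_three] using habc)
    (by
      intro i _
      fin_cases i
      · exact ha
      · exact hb
      · exact hc)
  simp only [Fin.prod_univ_three, Matrix.cons_val_zero, Matrix.cons_val_one, Matrix.cons_val] at key
  rw [← ofReal_integral_eq_lintegral_ofReal hf (.of_forall f0),
    ← ofReal_integral_eq_lintegral_ofReal hg (.of_forall g0),
    ← ofReal_integral_eq_lintegral_ofReal hh (.of_forall h0),
    ENNReal.ofReal_rpow_of_nonneg (integral_nonneg (f := f) f0) ha,
    ENNReal.ofReal_rpow_of_nonneg (integral_nonneg (f := g) g0) hb,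
    ENNReal.ofReal_rpow_of_nonneg (integral_nonneg (f := h) h0) hc,
    ← ENNReal.ofReal_mul (by have := integral_nonneg (μ := μ) (f := f) f0; positivity),
    ← ENNReal.ofReal_mul (by
      have := integral_nonneg (μ := μ) (f := f) f0; have := integral_nonneg (μ := μ) (f := g) g0; positivity)] at key
  have e : ∀ x, ENNReal.ofReal (f x) ^ a * ENNReal.ofReal (g x) ^ b * ENNReal.ofReal (h x) ^ c =
      ENNReal.ofReal (f x ^ a * g x ^ b * h x ^ c) := by
    intro x
    rw [ENNReal.ofReal_rpow_of_nonneg (f0 x) ha, ENNReal.ofReal_rpow_of_nonneg (g0 x) hb,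
      ENNReal.ofReal_rpow_of_nonneg (h0 x) hc,
      ← ENNReal.ofReal_mul (rpow_nonneg (f0 x) _),
      ← ENNReal.ofReal_mul (mul_nonneg (rpow_nonneg (f0 x) _) (rpow_nonneg (g0 x) _))]
  simp only [e] at key
  have n1 := integral_nonneg (μ := μ) (f := f) f0
  have n2 := integral_nonneg (μ := μ) (f := g) g0
  have n3 := integral_nonneg (μ := μ) (f := h) h0
  rw [integral_eq_lintegral_of_nonneg_ae]
  · exact ENNReal.toReal_le_of_le_ofReal (by positivity) key
  · refine .of_forall fun x => ?_
    have := f0 x; have := g0 x; have := h0 x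
    simp only [Pi.zero_apply]; positivity
  · exact (((hf.aemeasurable.pow_const a).mul (hg.aemeasurable.pow_const b)).mul
      (hh.aemeasurable.pow_const c)).aestronglyMeasurable

theorem holder2 {X : Type*} [MeasurableSpace X] {μ : Measure X} {f g : X → ℝ}
    (hf : Integrable f μ) (hg : Integrable g μ)
    (f0 : ∀ x, 0 ≤ f x) (g0 : ∀ x, 0 ≤ g x)
    {a b : ℝ} (ha : 0 ≤ a) (hb : 0 ≤ b) (hab : a + b = 1) :
    ∫ x, f x ^ a * g x ^ b ∂μ ≤ (∫ x, f x ∂μ) ^ a * (∫ x, g x ∂μ) ^ b := by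
  simpa using holder3 hf hg (integrable_zero X ℝ μ) f0 g0 (fun _ => le_rfl) ha hb le_rfl
    (by linarith : a + b + 0 = 1)

theorem norm_clm_sq_le (l : E3 →L[ℝ] ℝ) : ‖l‖ ^ 2 ≤ ∑ i, (l (ee i)) ^ 2 := by
  have : ‖l‖ ≤ Real.sqrt (∑ i, (l (ee i)) ^ 2) := by
    refine l.opNorm_le_bound (Real.sqrt_nonneg _) fun v => ?_
    have e : l v = ∑ i, v i * l (ee i) := by
      conv_lhs => rw [← (EuclideanSpace.basisFun (Fin 3) ℝ).sum_repr v]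
      simp [ee]
    rw [e, EuclideanSpace.norm_eq, ← Real.sqrt_mul (Finset.sum_nonneg fun i _ => sq_nonneg _),
      Real.norm_eq_abs]
    refine Real.abs_le_sqrt ?_
    have := Finset.sum_mul_sq_le_sq_mul_sq Finset.univ v.ofLp (fun i => l (ee i))
    simpa [mul_comm] using this
  calc ‖l‖ ^ 2 ≤ (Real.sqrt (∑ i, (l (ee i)) ^ 2)) ^ 2 := by gcongr
    _ = _ := Real.sq_sqrt (Finset.sum_nonneg fun i _ => sq_nonneg _)

theorem integral_norm_fderiv_sq_le {f : E3 → ℝ} (hf : ContDiff ℝ 1 f) (hc : HasCompactSupport f) :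
    ∫ x, ‖fderiv ℝ f x‖ ^ 2 ≤ ∫ x, ∑ i, (pd f i x) ^ 2 := by
  have hcf : Continuous (fderiv ℝ f) := hf.continuous_fderiv (by simp)
  have hcd : HasCompactSupport (fderiv ℝ f) := hc.fderiv (𝕜 := ℝ)
  have h1 : HasCompactSupport fun x => ‖fderiv ℝ f x‖ ^ 2 :=
    hcd.comp_left (g := fun y : E3 →L[ℝ] ℝ => ‖y‖ ^ 2) (by simp)
  have h2 : HasCompactSupport fun x => ∑ i, (pd f i x) ^ 2 :=
    hcd.comp_left (g := fun y : E3 →L[ℝ] ℝ => ∑ i, (y (ee i)) ^ 2) (by simp)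
  have hi1 : Integrable (fun x => ‖fderiv ℝ f x‖ ^ 2) :=
    (hcf.norm.pow 2).integrable_of_hasCompactSupport h1
  have c2 : Continuous fun x => ∑ i, (pd f i x) ^ 2 :=
    continuous_finsetSum _ fun i _ => (hcf.clm_apply continuous_const).pow 2
  exact integral_mono hi1 (c2.integrable_of_hasCompactSupport h2)
    fun x => norm_clm_sq_le (fderiv ℝ f x)

/-- The Sobolev inequality `W^{1,2} ⊂ L⁶` in three dimensions. -/
theorem sobolev6 : ∃ C : ℝ, 0 < C ∧ ∀ f : E3 → ℝ, ContDiff ℝ 1 f → HasCompactSupport f →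
    ∫ x, f x ^ 6 ≤ C * (∫ x, ∑ i, (pd f i x) ^ 2) ^ 3 := by
  obtain ⟨C0, hC0⟩ : ∃ C0 : NNReal, ∀ f : E3 → ℝ, ContDiff ℝ 1 f → HasCompactSupport f →
      eLpNorm f ((6 : NNReal) : ℝ≥0∞) volume ≤
        C0 * eLpNorm (fderiv ℝ f) ((2 : NNReal) : ℝ≥0∞) volume :=
    ⟨_, fun f hf hc => eLpNorm_le_eLpNorm_fderiv_of_eq (volume : Measure E3) (F := ℝ) hf hc
      (by norm_num) (by simp) (by
      simp only [finrank_euclideanSpace, Fintype.card_fin]; norm_num)⟩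
  refine ⟨(C0 : ℝ) ^ 6 + 1, by positivity, fun f hf hc => ?_⟩
  have key := hC0 f hf hc
  have hcf : Continuous (fderiv ℝ f) := hf.continuous_fderiv (by simp)
  have m1 : MemLp f ((6 : NNReal) : ℝ≥0∞) volume := hf.continuous.memLp_of_hasCompactSupport hc
  have m2 : MemLp (fderiv ℝ f) ((2 : NNReal) : ℝ≥0∞) volume :=
    hcf.memLp_of_hasCompactSupport (hc.fderiv (𝕜 := ℝ))
  rw [m1.eLpNorm_eq_integral_rpow_norm (by simp) (by simp),
    m2.eLpNorm_eq_integral_rpow_norm (by simp) (by simp), ← ENNReal.ofReal_coe_nnreal (p := C0),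
    ← ENNReal.ofReal_mul (by positivity), ENNReal.ofReal_le_ofReal_iff (by positivity)] at key
  simp only [ENNReal.coe_toReal, NNReal.coe_ofNat] at key
  have r6 : ∀ y : ℝ, ‖y‖ ^ (6 : ℝ) = y ^ 6 := by
    intro y
    rw [show (6 : ℝ) = ((6 : ℕ) : ℝ) by norm_num, rpow_natCast, Real.norm_eq_abs]
    exact Even.pow_abs (by decide) y
  have r2 : ∀ l : E3 →L[ℝ] ℝ, ‖l‖ ^ (2 : ℝ) = ‖l‖ ^ 2 := fun l => by
    rw [show (2 : ℝ) = ((2 : ℕ) : ℝ) by norm_num, rpow_natCast]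
  simp only [r6, r2] at key
  have n1 : 0 ≤ ∫ x, f x ^ 6 := integral_nonneg fun x => by positivity
  have n2 : 0 ≤ ∫ x, ‖fderiv ℝ f x‖ ^ 2 := integral_nonneg fun x => by positivity
  have le1 := integral_norm_fderiv_sq_le hf hc
  calc ∫ x, f x ^ 6 = ((∫ x, f x ^ 6) ^ (6 : ℝ)⁻¹) ^ 6 := by
        rw [← rpow_natCast, ← rpow_mul n1]; norm_num
    _ ≤ (C0 * (∫ x, ‖fderiv ℝ f x‖ ^ 2) ^ (2 : ℝ)⁻¹) ^ 6 := by gcongr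
    _ = C0 ^ 6 * (∫ x, ‖fderiv ℝ f x‖ ^ 2) ^ 3 := by
        rw [mul_pow, ← rpow_natCast (_ ^ (2 : ℝ)⁻¹) 6, ← rpow_mul n2,
          ← rpow_natCast _ 3]; norm_num
    _ ≤ ((C0 : ℝ) ^ 6 + 1) * (∫ x, ∑ i, (pd f i x) ^ 2) ^ 3 := by
        gcongr; linarith

theorem Sm.slice {f : E3 × ℝ → ℝ} (hf : Sm f) (t : ℝ) :
    ContDiff ℝ (⊤ : ℕ∞) (fun x => f (x, t)) := hf.comp (contDiff_id.prodMk contDiff_const)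

theorem slice_cont {f : E3 × ℝ → ℝ} (hf : Continuous f) (t : ℝ) :
    Continuous (fun x => f (x, t)) := hf.comp (by fun_prop)

theorem hcs_of_ball {f : E3 → ℝ} {ρ : ℝ} (h0 : ∀ x, ρ ≤ ‖x‖ → f x = 0) : HasCompactSupport f := by
  refine HasCompactSupport.intro (isCompact_closedBall (0 : E3) ρ) fun x hx => h0 x ?_
  simp at hx
  exact hx.le

theorem sobolev6_slice : ∃ C : ℝ, 0 < C ∧ ∀ (f : E3 × ℝ → ℝ) (t ρ : ℝ), Sm f → ρ < 1 →
    (∀ x, ρ ≤ ‖x‖ → f (x, t) = 0) →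
    ∫ x in Metric.ball 0 1, f (x, t) ^ 6 ≤
      C * (∫ x in Metric.ball 0 1, ∑ i, (dX i f (x, t)) ^ 2) ^ 3 := by
  obtain ⟨C, hC, h⟩ := sobolev6
  refine ⟨C, hC, fun f t ρ hf hρ h0 => ?_⟩
  have := h (fun x => f (x, t)) ((hf.slice t).of_le (by exact_mod_cast le_top)) (hcs_of_ball h0)
  rw [setIntegral_eq_integral_of_forall_compl_eq_zero,
    setIntegral_eq_integral_of_forall_compl_eq_zero]
  · simpa only [pd_eq hf] using this
  · intro x hx
    simp at hx
    refine Finset.sum_eq_zero fun i _ => ?_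
    rw [← pd_eq hf, pd]
    have : (fun y => f (y, t)) =ᶠ[nhds x] fun _ => 0 := by
      have : ∀ᶠ z : E3 in nhds x, ρ < ‖z‖ :=
        continuous_norm.continuousAt.eventually_mem (Ioi_mem_nhds (by linarith))
      filter_upwards [this] with z hz using h0 z hz.le
    rw [this.fderiv_eq]; simp
  · intro x hx
    simp at hx
    simp [h0 x (by linarith)]

/-- Parabolic Sobolev embedding. -/
theorem parabolic_sobolev : ∃ C : ℝ, 0 < C ∧ ∀ (f : E3 × ℝ → ℝ) (ρ M : ℝ), Sm f → ρ < 1 →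
    (∀ x t, ρ ≤ ‖x‖ → f (x, t) = 0) →
    (∀ t, -1 < t → t < 0 → ∫ x in Metric.ball 0 1, f (x, t) ^ 2 ≤ M) →
    ∫ z in (Metric.ball 0 1) ×ˢ (Ioo (-1) 0), |f z| ^ (10 / 3 : ℝ) ≤
      C * M ^ (2 / 3 : ℝ) * ∫ z in (Metric.ball 0 1) ×ˢ (Ioo (-1) 0), ∑ i, (dX i f z) ^ 2 := by
  obtain ⟨C, hC, h⟩ := sobolev6_slice
  refine ⟨C ^ (1 / 3 : ℝ), by positivity, fun f ρ M hf hρ h0 hM => ?_⟩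
  have c1 : Continuous fun z => |f z| ^ (10 / 3 : ℝ) :=
    (hf.cont.abs).rpow_const fun _ => Or.inr (by norm_num)
  have c2 : Continuous fun z => ∑ i, (dX i f z) ^ 2 :=
    continuous_finsetSum _ fun i _ => (hf.dX i).cont.pow 2
  rw [setInt_prod_symm c1, setInt_prod_symm c2, ← integral_const_mul]
  have ic : ∀ {g : E3 × ℝ → ℝ}, Continuous g → IntegrableOn
      (fun t => ∫ y in Metric.ball (0 : E3) 1, g (y, t)) (Ioo (-1) 0) := by
    intro g hg
    have := ion (μ := volume) hg (bdd_cyl 0 1 (-1) 0)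
    rw [IntegrableOn, Measure.volume_eq_prod, ← Measure.prod_restrict] at this
    exact this.integral_prod_right
  refine setIntegral_mono_on (ic c1) ((ic c2).const_mul _) measurableSet_Ioo fun t ht => ?_
  have i2 : IntegrableOn (fun x => f (x, t) ^ 2) (Metric.ball 0 1) :=
    ion ((slice_cont hf.cont t).pow 2) Metric.isBounded_ball
  have i6 : IntegrableOn (fun x => f (x, t) ^ 6) (Metric.ball 0 1) :=
    ion ((slice_cont hf.cont t).pow 6) Metric.isBounded_ball
  have hh := holder2 i2 i6 (fun x => by positivity) (fun x => by positivity)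
    (a := 2 / 3) (b := 1 / 3) (by norm_num) (by norm_num) (by norm_num)
  have n0 : 0 ≤ ∫ x in Metric.ball 0 1, f (x, t) ^ 2 := integral_nonneg fun x => by positivity
  have n6 : 0 ≤ ∫ x in Metric.ball 0 1, f (x, t) ^ 6 := integral_nonneg fun x => by positivity
  have nD : 0 ≤ ∫ x in Metric.ball 0 1, ∑ i, (dX i f (x, t)) ^ 2 :=
    integral_nonneg fun x => Finset.sum_nonneg fun i _ => sq_nonneg _
  have hM' := hM t ht.1 ht.2
  have hM0 : 0 ≤ M := n0.trans hM'
  calc ∫ x in Metric.ball 0 1, |f (x, t)| ^ (10 / 3 : ℝ)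
      = ∫ x in Metric.ball 0 1, (f (x, t) ^ 2) ^ (2 / 3 : ℝ) * (f (x, t) ^ 6) ^ (1 / 3 : ℝ) := by
        refine integral_congr_ae (.of_forall fun x => ?_)
        simp only
        rw [← sq_abs, ← Even.pow_abs (by decide : Even 6) (f (x, t)), ← rpow_natCast,
          ← rpow_natCast, ← rpow_mul (abs_nonneg _), ← rpow_mul (abs_nonneg _),
          ← rpow_add_of_nonneg (abs_nonneg _) (by norm_num) (by norm_num)]
        norm_num
    _ ≤ _ := hh
    _ ≤ M ^ (2 / 3 : ℝ) *
        (C * (∫ x in Metric.ball 0 1, ∑ i, (dX i f (x, t)) ^ 2) ^ 3) ^ (1 / 3 : ℝ) := by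
        gcongr
        exact h f t ρ hf hρ fun x => h0 x t
    _ = C ^ (1 / 3 : ℝ) * M ^ (2 / 3 : ℝ) *
        ∫ x in Metric.ball 0 1, ∑ i, (dX i f (x, t)) ^ 2 := by
        rw [mul_rpow hC.le (by positivity), ← rpow_natCast _ 3, ← rpow_mul nD]
        norm_num; ring

theorem smoothTransition_deriv_bound : ∃ M : ℝ, 0 < M ∧ ∀ y,
    |deriv smoothTransition y| ≤ M ∧ |deriv (deriv smoothTransition) y| ≤ M := by
  have hs : ContDiff ℝ (⊤ : ℕ∞) smoothTransition := smoothTransition.contDiff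
  have h1 : ContDiff ℝ (⊤ : ℕ∞) (deriv smoothTransition) :=
    ((contDiff_succ_iff_deriv (n := ((⊤ : ℕ∞) : WithTop ℕ∞))).1 (by simpa using hs)).2.2
  have c1 : Continuous (deriv smoothTransition) := h1.continuous
  have c2 : Continuous (deriv (deriv smoothTransition)) := h1.continuous_deriv (by simp)
  have z1 : ∀ y, y ∉ Icc (0 : ℝ) 1 → deriv smoothTransition y = 0 := by
    intro y hy
    rw [mem_Icc, not_and_or, not_le, not_le] at hy
    rcases hy with hy | hy
    · have : smoothTransition =ᶠ[nhds y] fun _ => 0 := by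
        filter_upwards [Iio_mem_nhds hy] with w hw
          using smoothTransition.zero_of_nonpos (le_of_lt hw)
      rw [this.deriv_eq]; simp
    · have : smoothTransition =ᶠ[nhds y] fun _ => 1 := by
        filter_upwards [Ioi_mem_nhds hy] with w hw
          using smoothTransition.one_of_one_le (le_of_lt hw)
      rw [this.deriv_eq]; simp
  have s1 : HasCompactSupport (deriv smoothTransition) := HasCompactSupport.intro isCompact_Icc z1
  have s2 : HasCompactSupport (deriv (deriv smoothTransition)) := s1.deriv
  obtain ⟨M1, hM1⟩ := s1.exists_bound_of_continuous c1
  obtain ⟨M2, hM2⟩ := s2.exists_bound_of_continuous c2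
  refine ⟨max (max M1 M2) 1, lt_max_of_lt_right one_pos, fun y => ⟨?_, ?_⟩⟩
  · exact (hM1 y).trans ((le_max_left _ _).trans (le_max_left _ _))
  · exact (hM2 y).trans ((le_max_right _ _).trans (le_max_left _ _))

/-- Squared spatial norm as a function on space-time. -/
def nsq (z : E3 × ℝ) : ℝ := z.1 0 * z.1 0 + z.1 1 * z.1 1 + z.1 2 * z.1 2

theorem nsq_eq (z : E3 × ℝ) : nsq z = ‖z.1‖ ^ 2 := by
  rw [EuclideanSpace.real_norm_sq_eq, nsq, Fin.sum_univ_three]; ring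

theorem sm_nsq : Sm nsq :=
  (((sm_coord 0).mul (sm_coord 0)).add ((sm_coord 1).mul (sm_coord 1))).add
    ((sm_coord 2).mul (sm_coord 2))

theorem dX_nsq (i : Fin 3) (z) : dX i nsq z = 2 * z.1 i := by
  have s := sm_coord
  have : nsq = fun z => (z.1 0 * z.1 0 + z.1 1 * z.1 1) + z.1 2 * z.1 2 := rfl
  rw [this, dX_add (((s 0).mul (s 0)).add ((s 1).mul (s 1))) ((s 2).mul (s 2)),
    dX_add ((s 0).mul (s 0)) ((s 1).mul (s 1)), dX_mul (s 0) (s 0), dX_mul (s 1) (s 1),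
    dX_mul (s 2) (s 2)]
  simp only [dX_coord]
  fin_cases i <;> simp <;> ring

theorem dT_nsq (z) : dT nsq z = 0 := by
  have s := sm_coord
  have : nsq = fun z => (z.1 0 * z.1 0 + z.1 1 * z.1 1) + z.1 2 * z.1 2 := rfl
  rw [this, dT_add (((s 0).mul (s 0)).add ((s 1).mul (s 1))) ((s 2).mul (s 2)),
    dT_add ((s 0).mul (s 0)) ((s 1).mul (s 1)), dT_mul (s 0) (s 0), dT_mul (s 1) (s 1),
    dT_mul (s 2) (s 2)]
  simp only [dT_coord]
  ring

theorem sm_time : Sm (fun z : E3 × ℝ => z.2) := contDiff_snd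
theorem dX_time (i : Fin 3) (z : E3 × ℝ) : dX i (fun z => z.2) z = 0 := by
  rw [dX]
  have : (fun z : E3 × ℝ => z.2) = ContinuousLinearMap.snd ℝ E3 ℝ := rfl
  rw [this, ContinuousLinearMap.fderiv]; rfl
theorem dT_time (z : E3 × ℝ) : dT (fun z => z.2) z = 1 := by
  rw [dT]
  have : (fun z : E3 × ℝ => z.2) = ContinuousLinearMap.snd ℝ E3 ℝ := rfl
  rw [this, ContinuousLinearMap.fderiv]; rfl

/-- One-dimensional smooth cutoff, `1` below `b` and `0` above `a`, with derivative bounds. -/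
theorem exists_cutoff_line : ∃ M : ℝ, 0 < M ∧ ∀ a b : ℝ, b < a → ∃ k k' k'' : ℝ → ℝ,
    ContDiff ℝ (⊤ : ℕ∞) k ∧ ContDiff ℝ (⊤ : ℕ∞) k' ∧
    (∀ y, HasDerivAt k (k' y) y) ∧ (∀ y, HasDerivAt k' (k'' y) y) ∧
    (∀ y, 0 ≤ k y ∧ k y ≤ 1) ∧ (∀ y, a ≤ y → k y = 0) ∧ (∀ y, y ≤ b → k y = 1) ∧
    (∀ y, |k' y| ≤ M / (a - b)) ∧ (∀ y, |k'' y| ≤ M / (a - b) ^ 2) ∧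
    (∀ y, a ≤ y → k' y = 0) ∧ (∀ y, a ≤ y → k'' y = 0) := by
  obtain ⟨M, hM, hb⟩ := smoothTransition_deriv_bound
  refine ⟨M, hM, fun a b hab => ?_⟩
  have hd : 0 < a - b := by linarith
  have hs : ContDiff ℝ (⊤ : ℕ∞) smoothTransition := smoothTransition.contDiff
  have h1 : ContDiff ℝ (⊤ : ℕ∞) (deriv smoothTransition) :=
    ((contDiff_succ_iff_deriv (n := ((⊤ : ℕ∞) : WithTop ℕ∞))).1 (by simpa using hs)).2.2
  have hl : ContDiff ℝ (⊤ : ℕ∞) (fun y : ℝ => (a - y) / (a - b)) := by fun_prop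
  have hl' : ∀ y, HasDerivAt (fun y : ℝ => (a - y) / (a - b)) (-1 / (a - b)) y := fun y =>
    ((hasDerivAt_id y).const_sub a).div_const (a - b)
  have zero : ∀ y ≤ 0, deriv smoothTransition y = 0 := by
    intro y hy
    apply IsLocalMin.deriv_eq_zero
    refine Filter.Eventually.of_forall fun w => ?_
    rw [smoothTransition.zero_of_nonpos hy]
    exact smoothTransition.nonneg w
  have zero2 : ∀ y ≤ 0, deriv (deriv smoothTransition) y = 0 := by
    intro y hy
    have hh : HasDerivAt (deriv smoothTransition) (deriv (deriv smoothTransition) y) y :=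
      ((h1.differentiable (by simp)) y).hasDerivAt
    have h2 := hh.hasDerivWithinAt (s := Iic 0)
    have h3 : HasDerivWithinAt (deriv smoothTransition) 0 (Iic 0) y :=
      (hasDerivWithinAt_const y (Iic 0) (0 : ℝ)).congr (fun w hw => zero w hw) (zero y hy)
    exact ((uniqueDiffOn_Iic (0 : ℝ)) y hy).eq_deriv _ h2 h3
  refine ⟨fun y => smoothTransition ((a - y) / (a - b)),
    fun y => deriv smoothTransition ((a - y) / (a - b)) * (-1 / (a - b)),
    fun y => deriv (deriv smoothTransition) ((a - y) / (a - b)) * (-1 / (a - b)) * (-1 / (a - b)),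
    hs.comp hl, (h1.comp hl).mul contDiff_const, fun y => ?_, fun y => ?_, fun y => ?_,
    fun y hy => ?_, fun y hy => ?_, fun y => ?_, fun y => ?_, fun y hy => ?_, fun y hy => ?_⟩
  · exact (((hs.differentiable (by simp)) _).hasDerivAt).comp y (hl' y)
  · exact ((((h1.differentiable (by simp)) _).hasDerivAt).comp y (hl' y)).mul_const _
  · exact ⟨smoothTransition.nonneg _, smoothTransition.le_one _⟩
  · exact smoothTransition.zero_of_nonpos (div_nonpos_of_nonpos_of_nonneg (by linarith) hd.le)
  · exact smoothTransition.one_of_one_le ((one_le_div hd).2 (by linarith))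
  · rw [abs_mul, abs_div, abs_neg, abs_one, abs_of_pos hd, mul_one_div]
    gcongr
    exact (hb _).1
  · rw [abs_mul, abs_mul, abs_div, abs_neg, abs_one, abs_of_pos hd, mul_one_div, mul_one_div,
      div_div, ← sq]
    gcongr
    exact (hb _).2
  · simp only
    rw [zero _ (div_nonpos_of_nonpos_of_nonneg (by linarith) hd.le), zero_mul]
  · simp only
    rw [zero2 _ (div_nonpos_of_nonpos_of_nonneg (by linarith) hd.le), zero_mul, zero_mul]

/-- Parabolic cutoff functions with derivative bounds. -/
theorem exists_cutoff : ∃ K : ℝ, 1 ≤ K ∧ ∀ a b : ℝ, b < a → a ≤ 1 → 0 < b →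
    ∃ φ : E3 × ℝ → ℝ, Sm φ ∧ (∀ z, 0 ≤ φ z) ∧ (∀ z, φ z ≤ 1) ∧
    (∀ x t, a ≤ ‖x‖ ^ 2 → φ (x, t) = 0) ∧ (∀ x t, t ≤ -a → φ (x, t) = 0) ∧
    (∀ x t, ‖x‖ ^ 2 ≤ b → -b ≤ t → φ (x, t) = 1) ∧
    (∀ i z, |dX i φ z| ≤ K / (a - b)) ∧ (∀ i z, |dX i (dX i φ) z| ≤ K / (a - b) ^ 2) ∧
    (∀ z, |dT φ z| ≤ K / (a - b)) ∧
    (∀ z, |z.1 0 * dX 0 φ z + z.1 1 * dX 1 φ z| ≤ K / (a - b) * (z.1 0 ^ 2 + z.1 1 ^ 2)) := by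
  obtain ⟨M, hM, h⟩ := exists_cutoff_line
  refine ⟨6 * M + 1, by linarith, fun a b hab ha hb => ?_⟩
  obtain ⟨k, k', k'', hk, hk', d1, d2, k01, ka, kb, B1, B2, z1, z2⟩ := h a b hab
  have hd : 0 < a - b := by linarith
  have hd1 : a - b ≤ 1 := by linarith
  have st : Sm (fun z : E3 × ℝ => -z.2) := contDiff_snd.neg
  have s1 : Sm (fun z => k (nsq z)) := hk.comp sm_nsq
  have s1' : Sm (fun z => k' (nsq z)) := hk'.comp sm_nsq
  have s2 : Sm (fun z : E3 × ℝ => k (-z.2)) := hk.comp st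
  have dneg : ∀ y, HasDerivAt (fun y => k (-y)) (-(k' (-y))) y := fun y => by
    have := (d1 (-y)).comp y (hasDerivAt_neg y)
    rwa [mul_neg_one] at this
  have et : ∀ i z, dX i (fun z : E3 × ℝ => k (-z.2)) z = 0 := by
    intro i z
    rw [dX_comp sm_time (F := fun y => k (-y)) (F' := -(k' (-z.2))) i z
      (dneg z.2), dX_time, mul_zero]
  have eX : ∀ i z, dX i (fun z => k (nsq z) * k (-z.2)) z =
      2 * z.1 i * k' (nsq z) * k (-z.2) := by
    intro i z
    rw [dX_mul s1 s2, et, dX_comp sm_nsq i z (d1 _), dX_nsq]; ring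
  have eXX : ∀ i z, dX i (dX i (fun z => k (nsq z) * k (-z.2))) z =
      (2 * k' (nsq z) + 4 * z.1 i ^ 2 * k'' (nsq z)) * k (-z.2) := by
    intro i z
    have : dX i (fun z => k (nsq z) * k (-z.2)) =
        fun z => ((2 * z.1 i) * k' (nsq z)) * k (-z.2) := funext (eX i)
    have sc : Sm (fun z => 2 * z.1 i) := contDiff_const.mul (sm_coord i)
    rw [this, dX_mul (sc.mul s1') s2, dX_mul sc s1', et,
      dX_mul contDiff_const (sm_coord i), dX_const, dX_coord, dX_comp sm_nsq i z (d2 _), dX_nsq,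
      if_pos rfl]
    ring
  have eT : ∀ z, dT (fun z => k (nsq z) * k (-z.2)) z = -(k (nsq z) * k' (-z.2)) := by
    intro z
    rw [dT_mul s1 s2, dT_comp sm_nsq z (d1 _), dT_nsq,
      dT_comp sm_time (F := fun y => k (-y)) (F' := -(k' (-z.2))) z
      (dneg z.2), dT_time]; ring
  have xi : ∀ (z : E3 × ℝ) i, nsq z < 1 → |z.1 i| ≤ 1 ∧ z.1 i ^ 2 ≤ 1 := by
    intro z i hz
    have h2 : z.1 i ^ 2 ≤ 1 := by
      unfold nsq at hz
      fin_cases i <;> simp only [Fin.zero_eta, Fin.mk_one, Fin.reduceFinMk] <;>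
        nlinarith [sq_nonneg (z.1 0), sq_nonneg (z.1 1), sq_nonneg (z.1 2)]
    exact ⟨by rwa [← sq_le_one_iff_abs_le_one], h2⟩
  have n0 : 0 ≤ M / (a - b) := by positivity
  have M12 : M / (a - b) ≤ M / (a - b) ^ 2 := by
    gcongr; nlinarith
  have kabs : ∀ y, |k y| ≤ 1 := fun y => abs_le.2 ⟨by linarith [(k01 y).1], (k01 y).2⟩
  refine ⟨fun z => k (nsq z) * k (-z.2), s1.mul s2, fun z => mul_nonneg (k01 _).1 (k01 _).1,
    fun z => mul_le_one₀ (k01 _).2 (k01 _).1 (k01 _).2, fun x t hx => ?_, fun x t ht => ?_,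
    fun x t hx ht => ?_, fun i z => ?_, fun i z => ?_, fun z => ?_, fun z => ?_⟩
  · simp only
    rw [ka _ (by rw [nsq_eq]; exact hx), zero_mul]
  · simp only
    rw [ka (-t) (by linarith), mul_zero]
  · simp only
    rw [kb _ (by rw [nsq_eq]; exact hx), kb _ (by linarith), one_mul]
  · rw [eX]
    rcases le_or_gt a (nsq z) with h | h
    · rw [z1 _ h]; simp; positivity
    · rw [abs_mul, abs_mul, abs_mul, abs_two]
      calc 2 * |z.1 i| * |k' (nsq z)| * |k (-z.2)| ≤ 2 * 1 * (M / (a - b)) * 1 := by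
            gcongr
            · exact (xi z i (by linarith)).1
            · exact B1 _
            · exact kabs _
        _ = 2 * M / (a - b) := by ring
        _ ≤ _ := by gcongr; linarith
  · rw [eXX]
    rcases le_or_gt a (nsq z) with h | h
    · rw [z1 _ h, z2 _ h]; simp; positivity
    · rw [abs_mul]
      have : |2 * k' (nsq z) + 4 * z.1 i ^ 2 * k'' (nsq z)| ≤ 6 * (M / (a - b) ^ 2) := by
        calc _ ≤ 2 * |k' (nsq z)| + 4 * z.1 i ^ 2 * |k'' (nsq z)| := by
              refine (abs_add_le _ _).trans ?_
              rw [abs_mul, abs_mul, abs_two, abs_of_nonneg (by positivity : 0 ≤ 4 * z.1 i ^ 2)]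
          _ ≤ 2 * (M / (a - b) ^ 2) + 4 * 1 * (M / (a - b) ^ 2) := by
              gcongr
              · exact (B1 _).trans M12
              · exact (xi z i (by linarith)).2
              · exact B2 _
          _ = _ := by ring
      calc _ ≤ 6 * (M / (a - b) ^ 2) * 1 := by gcongr; exact kabs _
        _ = 6 * M / (a - b) ^ 2 := by ring
        _ ≤ _ := by gcongr; linarith
  · rw [eT, abs_neg, abs_mul]
    calc _ ≤ 1 * (M / (a - b)) := by
          gcongr
          · exact kabs _
          · exact B1 _
      _ = M / (a - b) := by ring
      _ ≤ _ := by gcongr; linarith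
  · rw [eX, eX]
    rw [show z.1 0 * (2 * z.1 0 * k' (nsq z) * k (-z.2)) + z.1 1 * (2 * z.1 1 * k' (nsq z) * k (-z.2))
      = 2 * k' (nsq z) * k (-z.2) * (z.1 0 ^ 2 + z.1 1 ^ 2) by ring, abs_mul, abs_mul, abs_mul,
      abs_two, abs_of_nonneg (by positivity : 0 ≤ z.1 0 ^ 2 + z.1 1 ^ 2)]
    gcongr
    calc _ ≤ 2 * (M / (a - b)) * 1 := by
          gcongr
          · exact B1 _
          · exact kabs _
      _ = 2 * M / (a - b) := by ring
      _ ≤ _ := by gcongr; linarith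

/-- Globally smooth fields that solve the axisymmetric Navier–Stokes equations on the unit
parabolic cylinder; axial symmetry is recorded infinitesimally. -/
structure Sol (v : Fin 3 → E3 × ℝ → ℝ) (P : E3 × ℝ → ℝ) : Prop where
  smv : ∀ j, Sm (v j)
  smP : Sm P
  mom : ∀ z : E3 × ℝ, ‖z.1‖ < 1 → -1 < z.2 → z.2 < 0 → ∀ j,
    dT (v j) z + ∑ i, v i z * dX i (v j) z - ∑ i, dX i (dX i (v j)) z + dX j P z = 0
  div : ∀ z : E3 × ℝ, ‖z.1‖ < 1 → -1 < z.2 → z.2 < 0 → ∑ i, dX i (v i) z = 0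
  rot0 : ∀ z : E3 × ℝ, ‖z.1‖ < 1 → -1 < z.2 → z.2 < 0 →
    z.1 0 * dX 1 (v 0) z - z.1 1 * dX 0 (v 0) z = -v 1 z
  rot1 : ∀ z : E3 × ℝ, ‖z.1‖ < 1 → -1 < z.2 → z.2 < 0 →
    z.1 0 * dX 1 (v 1) z - z.1 1 * dX 0 (v 1) z = v 0 z
  rotP : ∀ z : E3 × ℝ, ‖z.1‖ < 1 → -1 < z.2 → z.2 < 0 →
    z.1 0 * dX 1 P z - z.1 1 * dX 0 P z = 0

/-- The squared modulus of the velocity. -/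
def usq (v : Fin 3 → E3 × ℝ → ℝ) (z : E3 × ℝ) : ℝ := ∑ j, v j z ^ 2

/-- The squared modulus of the velocity gradient. -/
def gsq (v : Fin 3 → E3 × ℝ → ℝ) (z : E3 × ℝ) : ℝ := ∑ j, ∑ i, dX i (v j) z ^ 2

theorem usq_nonneg (v : Fin 3 → E3 × ℝ → ℝ) (z) : 0 ≤ usq v z :=
  Finset.sum_nonneg fun _ _ => sq_nonneg _
theorem gsq_nonneg (v : Fin 3 → E3 × ℝ → ℝ) (z) : 0 ≤ gsq v z :=
  Finset.sum_nonneg fun _ _ => Finset.sum_nonneg fun _ _ => sq_nonneg _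
theorem sm_usq {v : Fin 3 → E3 × ℝ → ℝ} (hv : ∀ j, Sm (v j)) : Sm (usq v) :=
  ContDiff.sum fun j _ => (hv j).pow 2
theorem sm_gsq {v : Fin 3 → E3 × ℝ → ℝ} (hv : ∀ j, Sm (v j)) : Sm (gsq v) :=
  ContDiff.sum fun j _ => ContDiff.sum fun i _ => ((hv j).dX i).pow 2

theorem dX_sq {f : E3 × ℝ → ℝ} (hf : Sm f) (i : Fin 3) (z) :
    dX i (fun z => f z ^ 2) z = 2 * f z * dX i f z := by
  rw [dX_comp hf (F := fun y => y ^ 2) i z (hasDerivAt_pow 2 (f z))]; simp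
theorem dT_sq {f : E3 × ℝ → ℝ} (hf : Sm f) (z) :
    dT (fun z => f z ^ 2) z = 2 * f z * dT f z := by
  rw [dT_comp hf (F := fun y => y ^ 2) z (hasDerivAt_pow 2 (f z))]; simp

theorem dX_usq {v : Fin 3 → E3 × ℝ → ℝ} (hv : ∀ j, Sm (v j)) (i : Fin 3) (z) :
    dX i (usq v) z = ∑ j, 2 * v j z * dX i (v j) z := by
  have := dX_sum (f := fun j z => v j z ^ 2) (fun j => (hv j).pow 2) i z
  simp only [dX_sq (hv _)] at this
  exact this
theorem dT_usq {v : Fin 3 → E3 × ℝ → ℝ} (hv : ∀ j, Sm (v j)) (z) :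
    dT (usq v) z = ∑ j, 2 * v j z * dT (v j) z := by
  have := dT_sum (f := fun j z => v j z ^ 2) (fun j => (hv j).pow 2) z
  simp only [dT_sq (hv _)] at this
  exact this
theorem dX_dX_usq {v : Fin 3 → E3 × ℝ → ℝ} (hv : ∀ j, Sm (v j)) (i : Fin 3) (z) :
    dX i (dX i (usq v)) z = ∑ j, (2 * dX i (v j) z ^ 2 + 2 * v j z * dX i (dX i (v j)) z) := by
  have e : dX i (usq v) = fun z => ∑ j, (fun z => (2 * v j z) * dX i (v j) z) z :=
    funext fun z => dX_usq hv i z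
  have s : ∀ j, Sm fun z => 2 * v j z := fun j => contDiff_const.mul (hv j)
  rw [e, dX_sum fun j => (s j).mul ((hv j).dX i)]
  refine Finset.sum_congr rfl fun j _ => ?_
  rw [dX_mul (s j) ((hv j).dX i), dX_mul contDiff_const (hv j), dX_const]
  ring

theorem energy_flux {v : Fin 3 → E3 × ℝ → ℝ} {P φ : E3 × ℝ → ℝ} (hs : Sol v P) (hφ : Sm φ)
    {ρ T : ℝ} (hρ : ρ < 1) (h0 : ∀ x t, ρ ≤ ‖x‖ → φ (x, t) = 0) (h1 : ∀ x, φ (x, -1) = 0)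
    (hT : -1 ≤ T) (hT0 : T ≤ 0) :
    ∫ x in Metric.ball (0 : E3) 1, usq v (x, T) * φ (x, T) =
      ∫ z in (Metric.ball (0 : E3) 1) ×ˢ (Ioo (-1) T),
        (usq v z * (dT φ z + ∑ i, dX i (dX i φ) z) +
          (usq v z + 2 * P z) * ∑ i, v i z * dX i φ z - 2 * φ z * gsq v z) := by
  have su := sm_usq hs.smv
  have sW : ∀ i, Sm (fun z => (φ z * dX i (usq v) z - usq v z * dX i φ z) -
      ((usq v z + 2 * P z) * v i z) * φ z) := fun i =>
    ((hφ.mul (su.dX i)).sub (su.mul (hφ.dX i))).sub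
      (((su.add (contDiff_const.mul hs.smP)).mul (hs.smv i)).mul hφ)
  have hd0 : ∀ i x t, (1 + ρ) / 2 ≤ ‖x‖ → dX i φ (x, t) = 0 := by
    intro i x t hx
    rw [dX_congr (g := fun _ => 0), dX_const]
    have : ∀ᶠ z : E3 × ℝ in nhds (x, t), ρ < ‖z.1‖ :=
      (continuous_norm.comp continuous_fst).continuousAt.eventually_mem
        (Ioi_mem_nhds (by simp; linarith))
    filter_upwards [this] with z hz using h0 z.1 z.2 hz.le
  refine flux (WT := fun z => usq v z * φ z) (su.mul hφ) sW hT (ρ := (1 + ρ) / 2) (by linarith)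
    (fun i x t hx => ?_) (fun x => by simp [h1]) (fun x t hx ht htT => ?_)
  · simp [hd0 i x t hx, h0 x t (by linarith)]
  · set z := (x, t) with hz
    have hm := hs.mom z hx ht (by simp [hz]; linarith)
    have hd := hs.div z hx ht (by simp [hz]; linarith)
    have eW : ∀ i, dX i (fun z => (φ z * dX i (usq v) z - usq v z * dX i φ z) -
        ((usq v z + 2 * P z) * v i z) * φ z) z =
        φ z * dX i (dX i (usq v)) z - usq v z * dX i (dX i φ) z -
        ((dX i (usq v) z + 2 * dX i P z) * v i z + (usq v z + 2 * P z) * dX i (v i) z) * φ z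
        - (usq v z + 2 * P z) * v i z * dX i φ z := by
      intro i
      have sP : Sm fun z => 2 * P z := contDiff_const.mul hs.smP
      rw [dX_sub ((hφ.mul (su.dX i)).sub (su.mul (hφ.dX i)))
        (((su.add sP).mul (hs.smv i)).mul hφ), dX_sub (hφ.mul (su.dX i)) (su.mul (hφ.dX i)),
        dX_mul hφ (su.dX i), dX_mul su (hφ.dX i), dX_mul ((su.add sP).mul (hs.smv i)) hφ,
        dX_mul (su.add sP) (hs.smv i), dX_add su sP, dX_mul contDiff_const hs.smP, dX_const]
      ring
    rw [dT_mul su hφ, dT_usq hs.smv]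
    simp only [eW]
    simp only [dX_usq hs.smv, dX_dX_usq hs.smv, gsq]
    have m0 := hm 0
    have m1 := hm 1
    have m2 := hm 2
    simp only [Fin.sum_univ_three] at m0 m1 m2 hd ⊢
    linear_combination (2 * v 0 z * φ z) * m0 + (2 * v 1 z * φ z) * m1 + (2 * v 2 z * φ z) * m2
      + (usq v z + 2 * P z) * φ z * hd

/-- The parabolic cylinder of radius `√a`. -/
def cy (a : ℝ) : Set (E3 × ℝ) := {z | ‖z.1‖ ^ 2 < a ∧ -a < z.2 ∧ z.2 < 0}

theorem cy_sq {r : ℝ} (hr : 0 ≤ r) : cy (r ^ 2) = Metric.ball 0 r ×ˢ Ioo (-r ^ 2) 0 := by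
  ext z
  simp only [cy, mem_setOf_eq, mem_prod, Metric.mem_ball, dist_zero_right, mem_Ioo]
  rw [sq_lt_sq₀ (norm_nonneg _) hr]

theorem cy_one : cy 1 = Metric.ball 0 1 ×ˢ Ioo (-1) 0 := by
  simpa using cy_sq zero_le_one

theorem isOpen_cy (a : ℝ) : IsOpen (cy a) := by
  have : cy a = {z | ‖z.1‖ ^ 2 < a} ∩ ({z | -a < z.2} ∩ {z | z.2 < 0}) := rfl
  rw [this]
  exact (isOpen_lt (by fun_prop) (by fun_prop)).inter
    ((isOpen_lt (by fun_prop) (by fun_prop)).inter (isOpen_lt (by fun_prop) (by fun_prop)))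

theorem meas_cy (a : ℝ) : MeasurableSet (cy a) := (isOpen_cy a).measurableSet

theorem cy_mono {a b : ℝ} (h : a ≤ b) : cy a ⊆ cy b := fun _ hz =>
  ⟨hz.1.trans_le h, by have := hz.2.1; linarith, hz.2.2⟩

theorem bdd_cy {a : ℝ} : Bornology.IsBounded (cy a) := by
  rcases le_or_gt a 0 with h | h
  · have : cy a = ∅ := by
      ext z; simp only [cy, mem_setOf_eq, mem_empty_iff_false, iff_false, not_and]
      intro h1; nlinarith [sq_nonneg ‖z.1‖]
    rw [this]; exact Bornology.isBounded_empty
  · rw [← Real.sq_sqrt h.le, cy_sq (Real.sqrt_nonneg a)]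
    exact bdd_cyl _ _ _ _

theorem icy {f : E3 × ℝ → ℝ} (hf : Continuous f) (a : ℝ) : IntegrableOn f (cy a) := ion hf bdd_cy

theorem cy_sub_one {a : ℝ} (h : a ≤ 1) {z : E3 × ℝ} (hz : z ∈ cy a) :
    ‖z.1‖ < 1 ∧ -1 < z.2 ∧ z.2 < 0 := by
  obtain ⟨h1, h2, h3⟩ := cy_mono h hz
  exact ⟨by nlinarith [norm_nonneg z.1], h2, h3⟩

theorem setIntegral_le_of_cut {X : Type*} [MetricSpace X] [ProperSpace X] [MeasurableSpace X]
    [BorelSpace X] {μ : Measure X} [IsFiniteMeasureOnCompacts μ] {I G : X → ℝ} {S A : Set X}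
    (hI : Continuous I) (hG : Continuous G) (hS : MeasurableSet S) (hA : MeasurableSet A)
    (bS : Bornology.IsBounded S) (bA : Bornology.IsBounded A)
    (h1 : ∀ z ∈ S, z ∈ A → I z ≤ G z) (h2 : ∀ z ∈ S, z ∉ A → I z ≤ 0) (h3 : ∀ z ∈ A, 0 ≤ G z) :
    ∫ z in S, I z ∂μ ≤ ∫ z in A, G z ∂μ := by
  calc ∫ z in S, I z ∂μ ≤ ∫ z in S, A.indicator G z ∂μ := by
        refine setIntegral_mono_on (ion hI bS) ((ion hG bS).indicator hA) hS fun z hz => ?_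
        by_cases hzA : z ∈ A
        · rw [indicator_of_mem hzA]; exact h1 z hz hzA
        · rw [indicator_of_notMem hzA]; exact h2 z hz hzA
    _ = ∫ z in S ∩ A, G z ∂μ := setIntegral_indicator hA
    _ ≤ ∫ z in A, G z ∂μ := by
        refine setIntegral_mono_set (ion hG bA) ?_ (HasSubset.Subset.eventuallyLE inter_subset_right)
        exact (ae_restrict_iff' hA).2 (.of_forall h3)

theorem min_deriv_zero {c : E3 × ℝ → ℝ} (h : ∀ z, 0 ≤ c z) {z : E3 × ℝ} (hz : c z = 0) :
    fderiv ℝ c z = 0 := by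
  refine IsLocalMin.fderiv_eq_zero (Filter.Eventually.of_forall fun w => ?_)
  rw [hz]; exact h w

/-- `c` is a cutoff between the cylinders `cy b ⊆ cy a` whose square has derivatives bounded
by `K`. -/
structure IsCut (a b K : ℝ) (c : E3 × ℝ → ℝ) : Prop where
  sm : Sm c
  nonneg : ∀ z, 0 ≤ c z
  le_one : ∀ z, c z ≤ 1
  out : ∀ x t, (a ≤ ‖x‖ ^ 2 ∨ t ≤ -a) → c (x, t) = 0
  one : ∀ z ∈ cy b, c z = 1
  dx : ∀ i z, |dX i c z| ≤ K
  sqx : ∀ i z, |dX i (fun z => c z ^ 2) z| ≤ K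
  sqxx : ∀ i z, |dX i (dX i (fun z => c z ^ 2)) z| ≤ K
  sqt : ∀ z, |dT (fun z => c z ^ 2) z| ≤ K
  sqr : ∀ z, |z.1 0 * dX 0 (fun z => c z ^ 2) z + z.1 1 * dX 1 (fun z => c z ^ 2) z| ≤
    K * (z.1 0 ^ 2 + z.1 1 ^ 2)
  outx : ∀ i z, c z = 0 → dX i c z = 0
  outsx : ∀ i z, c z = 0 → dX i (fun z => c z ^ 2) z = 0
  outsxx : ∀ i z, c z = 0 → dX i (dX i (fun z => c z ^ 2)) z = 0
  outt : ∀ z, c z = 0 → dT (fun z => c z ^ 2) z = 0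

theorem exists_isCut : ∃ K : ℝ, 1 ≤ K ∧ ∀ a b : ℝ, b < a → a ≤ 1 → 0 < b →
    ∃ c, IsCut a b (K / (a - b) ^ 2) c := by
  obtain ⟨K, hK, h⟩ := exists_cutoff
  refine ⟨4 * K ^ 2, by nlinarith, fun a b hab ha hb => ?_⟩
  obtain ⟨c, sm, nn, le1, o1, o2, one, dx, dxx, dt, rr⟩ := h a b hab ha hb
  have hd : 0 < a - b := by linarith
  have hd1 : a - b ≤ 1 := by linarith
  have hK0 : 0 < K := by linarith
  have i1 : 2 * (K / (a - b)) ≤ 4 * K ^ 2 / (a - b) ^ 2 := by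
    rw [← mul_div_assoc, div_le_div_iff₀ hd (by positivity)]
    have : (a - b) ^ 2 ≤ (a - b) := by nlinarith
    nlinarith [mul_le_mul_of_nonneg_left this (by positivity : 0 ≤ 2 * K),
      mul_pos hK0 hd, mul_pos (mul_pos hK0 hK0) hd]
  have i2 : 2 * (K / (a - b)) ^ 2 + 2 * (K / (a - b) ^ 2) ≤ 4 * K ^ 2 / (a - b) ^ 2 := by
    rw [div_pow, ← mul_div_assoc, ← mul_div_assoc, ← add_div]
    gcongr
    nlinarith
  have eX : ∀ i z, dX i (fun z => c z ^ 2) z = 2 * c z * dX i c z := fun i z => dX_sq sm i z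
  have eXX : ∀ i z, dX i (dX i (fun z => c z ^ 2)) z =
      2 * dX i c z ^ 2 + 2 * c z * dX i (dX i c) z := by
    intro i z
    have : dX i (fun z => c z ^ 2) = fun z => (2 * c z) * dX i c z := funext fun z => eX i z
    rw [this, dX_mul (contDiff_const.mul sm) (sm.dX i), dX_mul contDiff_const sm, dX_const]; ring
  have eT : ∀ z, dT (fun z => c z ^ 2) z = 2 * c z * dT c z := fun z => dT_sq sm z
  have a2 : ∀ z, |2 * c z| ≤ 2 := fun z => by
    rw [abs_of_nonneg (by have := nn z; linarith)]; linarith [le1 z]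
  have zx : ∀ i z, c z = 0 → dX i c z = 0 := fun i z hz => by
    rw [dX, min_deriv_zero nn hz]; rfl
  refine ⟨c, sm, nn, le1, fun x t hxt => hxt.elim (o1 x t) (o2 x t),
    fun z hz => one z.1 z.2 hz.1.le hz.2.1.le, fun i z => ?_, fun i z => ?_, fun i z => ?_,
    fun z => ?_, fun z => ?_, zx, fun i z hz => ?_, fun i z hz => ?_, fun z hz => ?_⟩
  · refine (dx i z).trans (le_trans ?_ i1)
    have : 0 ≤ K / (a - b) := by positivity
    linarith
  · rw [eX, abs_mul]
    exact (mul_le_mul (a2 z) (dx i z) (abs_nonneg _) (by norm_num)).trans i1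
  · rw [eXX]
    refine (abs_add_le _ _).trans (le_trans (add_le_add ?_ ?_) i2)
    · rw [abs_mul, abs_pow, abs_two]
      gcongr
      exact dx i z
    · rw [abs_mul]
      exact mul_le_mul (a2 z) (dxx i z) (abs_nonneg _) (by norm_num)
  · rw [eT, abs_mul]
    exact (mul_le_mul (a2 z) (dt z) (abs_nonneg _) (by norm_num)).trans i1
  · rw [eX, eX, show z.1 0 * (2 * c z * dX 0 c z) + z.1 1 * (2 * c z * dX 1 c z) =
      (2 * c z) * (z.1 0 * dX 0 c z + z.1 1 * dX 1 c z) by ring, abs_mul]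
    calc _ ≤ 2 * (K / (a - b) * (z.1 0 ^ 2 + z.1 1 ^ 2)) :=
          mul_le_mul (a2 z) (rr z) (abs_nonneg _) (by norm_num)
      _ = 2 * (K / (a - b)) * (z.1 0 ^ 2 + z.1 1 ^ 2) := by ring
      _ ≤ _ := by gcongr
  · rw [eX, hz]; ring
  · rw [eXX, hz, zx i z hz]; ring
  · rw [eT, hz]; ring

theorem IsCut.out_cy {a b K : ℝ} {c : E3 × ℝ → ℝ} (hc : IsCut a b K c) {z : E3 × ℝ}
    (hz : z ∉ cy a) (h0 : z.2 < 0) : c z = 0 := by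
  apply hc.out z.1 z.2
  by_contra! h
  exact hz ⟨h.1, h.2, h0⟩

/-- The modulus of the velocity. -/
def un (v : Fin 3 → E3 × ℝ → ℝ) (z : E3 × ℝ) : ℝ := Real.sqrt (usq v z)

theorem un_nonneg (v : Fin 3 → E3 × ℝ → ℝ) (z) : 0 ≤ un v z := Real.sqrt_nonneg _
theorem un_sq (v : Fin 3 → E3 × ℝ → ℝ) (z) : un v z ^ 2 = usq v z := Real.sq_sqrt (usq_nonneg v z)
theorem cont_un {v : Fin 3 → E3 × ℝ → ℝ} (hv : ∀ j, Sm (v j)) : Continuous (un v) :=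
  Real.continuous_sqrt.comp (sm_usq hv).cont
theorem abs_le_un (v : Fin 3 → E3 × ℝ → ℝ) (z) (j) : |v j z| ≤ un v z := by
  refine Real.abs_le_sqrt ?_
  exact Finset.single_le_sum (f := fun j => v j z ^ 2) (fun _ _ => sq_nonneg _) (Finset.mem_univ j)

theorem abs_sum3_le {f : Fin 3 → ℝ} {B : ℝ} (h : ∀ i, |f i| ≤ B) : |∑ i, f i| ≤ 3 * B := by
  calc |∑ i, f i| ≤ ∑ i, |f i| := Finset.abs_sum_le_sum_abs _ _
    _ ≤ ∑ _i : Fin 3, B := Finset.sum_le_sum fun i _ => h i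
    _ = 3 * B := by simp

theorem energy_est : ∃ C : ℝ, 1 ≤ C ∧ ∀ v P, Sol v P →
    (∀ t, -(1 / 4) < t → t < 0 → ∫ x in Metric.ball (0 : E3) (1 / 2), usq v (x, t) ≤
      C * ∫ z in cy (9 / 16), (usq v z + un v z ^ 3 + |P z| * un v z)) ∧
    ∫ z in cy (1 / 4), gsq v z ≤
      C * ∫ z in cy (9 / 16), (usq v z + un v z ^ 3 + |P z| * un v z) := by
  obtain ⟨K, hK, h⟩ := exists_isCut
  obtain ⟨c, hc⟩ := h (9 / 16) (1 / 4) (by norm_num) (by norm_num) (by norm_num)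
  set L := K / (9 / 16 - 1 / 4) ^ 2
  have hL : 1 ≤ L := by
    rw [one_le_div (by norm_num)]; norm_num; linarith
  refine ⟨6 * L, by linarith, fun v P hs => ?_⟩
  set φ : E3 × ℝ → ℝ := fun z => c z ^ 2
  have sφ : Sm φ := hc.sm.pow 2
  have su := sm_usq hs.smv
  have cu := cont_un hs.smv
  have sg := sm_gsq hs.smv
  set F : E3 × ℝ → ℝ := fun z => usq v z + un v z ^ 3 + |P z| * un v z
  have cF : Continuous F := (su.cont.add (cu.pow 3)).add (hs.smP.cont.abs.mul cu)
  have F0 : ∀ z, 0 ≤ F z := fun z => by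
    have := usq_nonneg v z; have := un_nonneg v z; positivity
  have key : ∀ T, -1 < T → T ≤ 0 → (∫ x in Metric.ball (0 : E3) 1, usq v (x, T) * φ (x, T)) +
      ∫ z in (Metric.ball (0 : E3) 1) ×ˢ (Ioo (-1) T), 2 * φ z * gsq v z ≤
      6 * L * ∫ z in cy (9 / 16), F z := by
    intro T hT hT0
    have cI : Continuous fun z => usq v z * (dT φ z + ∑ i, dX i (dX i φ) z) +
        (usq v z + 2 * P z) * ∑ i, v i z * dX i φ z := by
      refine (su.cont.mul (sφ.dT.cont.add (continuous_finsetSum _ fun i _ =>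
        ((sφ.dX i).dX i).cont))).add ((su.cont.add (continuous_const.mul hs.smP.cont)).mul
        (continuous_finsetSum _ fun i _ => (hs.smv i).cont.mul (sφ.dX i).cont))
    have cg : Continuous fun z => 2 * φ z * gsq v z :=
      (continuous_const.mul sφ.cont).mul sg.cont
    rw [energy_flux hs sφ (ρ := 3 / 4) (by norm_num) (fun x t hx => by
        simp only [φ]; rw [hc.out x t (Or.inl (by nlinarith))]; norm_num) (fun x => by
        simp only [φ]; rw [hc.out x (-1) (Or.inr (by norm_num))]; norm_num) hT.le hT0,
      integral_sub (ion cI (bdd_cyl _ _ _ _)) (ion cg (bdd_cyl _ _ _ _)), sub_add_cancel,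
      ← integral_const_mul]
    refine setIntegral_le_of_cut cI (continuous_const.mul cF)
      (Metric.isOpen_ball.measurableSet.prod measurableSet_Ioo) (meas_cy _) (bdd_cyl _ _ _ _) bdd_cy
      (fun z _ _ => ?_) (fun z hz hzn => ?_) (fun z _ => mul_nonneg (by linarith) (F0 z))
    · have b1 : |dT φ z + ∑ i, dX i (dX i φ) z| ≤ 4 * L := by
        refine (abs_add_le _ _).trans ?_
        linarith [hc.sqt z, abs_sum3_le fun i => hc.sqxx i z]
      have b2 : |∑ i, v i z * dX i φ z| ≤ 3 * (un v z * L) := by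
        refine abs_sum3_le fun i => ?_
        rw [abs_mul]
        exact mul_le_mul (abs_le_un v z i) (hc.sqx i z) (abs_nonneg _) (un_nonneg v z)
      have u0 := usq_nonneg v z
      have n0 := un_nonneg v z
      calc _ ≤ usq v z * |dT φ z + ∑ i, dX i (dX i φ) z| +
            (usq v z + 2 * |P z|) * |∑ i, v i z * dX i φ z| := by
            refine add_le_add (mul_le_mul_of_nonneg_left (le_abs_self _) u0) ?_
            refine (le_abs_self _).trans ?_
            rw [abs_mul]
            gcongr
            refine (abs_add_le _ _).trans ?_
            rw [abs_mul, abs_two, abs_of_nonneg u0]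
        _ ≤ usq v z * (4 * L) + (usq v z + 2 * |P z|) * (3 * (un v z * L)) := by gcongr
        _ = 4 * L * usq v z + 3 * L * un v z ^ 3 + 6 * L * (|P z| * un v z) := by
            rw [← un_sq]; ring
        _ ≤ 6 * L * (usq v z + un v z ^ 3 + |P z| * un v z) := by
            have : 0 ≤ L * usq v z := by positivity
            have : 0 ≤ L * un v z ^ 3 := by positivity
            nlinarith
    · have hz2 : z.2 < 0 := (hz.2.2).trans_le hT0
      have c0 := hc.out_cy hzn hz2
      have e1 : dT φ z = 0 := hc.outt z c0
      have e2 : ∀ i, dX i φ z = 0 := fun i => hc.outsx i z c0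
      have e3 : ∀ i, dX i (dX i φ) z = 0 := fun i => hc.outsxx i z c0
      simp [e1, e2, e3]
  have φ0 : ∀ z, 0 ≤ φ z := fun z => sq_nonneg _
  refine ⟨fun t ht ht0 => ?_, ?_⟩
  · have k1 := key t (by linarith) ht0.le
    have k2 : 0 ≤ ∫ z in (Metric.ball (0 : E3) 1) ×ˢ (Ioo (-1) t), 2 * φ z * gsq v z :=
      integral_nonneg fun z => mul_nonneg (mul_nonneg zero_le_two (φ0 z)) (gsq_nonneg v z)
    refine le_trans ?_ (le_trans (le_add_of_nonneg_right k2) k1)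
    refine setIntegral_le_of_cut (slice_cont su.cont t) ((slice_cont su.cont t).mul
      (slice_cont sφ.cont t)) measurableSet_ball measurableSet_ball Metric.isBounded_ball
      Metric.isBounded_ball (fun x hx _ => ?_) (fun x hx hxn => ?_)
      (fun x _ => mul_nonneg (usq_nonneg _ _) (φ0 _))
    · simp only [φ]
      rw [hc.one (x, t) ⟨?_, ht, ht0⟩]
      · simp
      · simp at hx; simp only; nlinarith [norm_nonneg x]
    · exact absurd (Metric.ball_subset_ball (by norm_num) hx) hxn
  · have k1 := key 0 (by norm_num) le_rfl
    have k2 : 0 ≤ ∫ x in Metric.ball (0 : E3) 1, usq v (x, 0) * φ (x, 0) :=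
      integral_nonneg fun z => mul_nonneg (usq_nonneg v _) (φ0 _)
    refine le_trans ?_ (le_trans (le_add_of_nonneg_left k2) k1)
    refine setIntegral_le_of_cut sg.cont ((continuous_const.mul sφ.cont).mul sg.cont) (meas_cy _)
      (Metric.isOpen_ball.measurableSet.prod measurableSet_Ioo) bdd_cy (bdd_cyl _ _ _ _)
      (fun x hx _ => ?_) (fun x hx hxn => ?_)
      (fun x _ => mul_nonneg (mul_nonneg zero_le_two (φ0 x)) (gsq_nonneg v x))
    · simp only [φ]
      rw [hc.one x hx]
      linarith [gsq_nonneg v x]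
    · exact absurd (cy_one ▸ cy_mono (by norm_num) hx) hxn

/-- The swirl `Γ = r u^θ` as a function on space-time. -/
def gam (v : Fin 3 → E3 × ℝ → ℝ) (z : E3 × ℝ) : ℝ := z.1 0 * v 1 z - z.1 1 * v 0 z

theorem sm_gam {v : Fin 3 → E3 × ℝ → ℝ} (hv : ∀ j, Sm (v j)) : Sm (gam v) :=
  ((sm_coord 0).mul (hv 1)).sub ((sm_coord 1).mul (hv 0))

theorem dX_gam {v : Fin 3 → E3 × ℝ → ℝ} (hv : ∀ j, Sm (v j)) (i : Fin 3) (z) :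
    dX i (gam v) z = (if (0 : Fin 3) = i then 1 else 0) * v 1 z + z.1 0 * dX i (v 1) z -
      ((if (1 : Fin 3) = i then 1 else 0) * v 0 z + z.1 1 * dX i (v 0) z) := by
  have : gam v = fun z => z.1 0 * v 1 z - z.1 1 * v 0 z := rfl
  rw [this, dX_sub ((sm_coord 0).mul (hv 1)) ((sm_coord 1).mul (hv 0)),
    dX_mul (sm_coord 0) (hv 1), dX_mul (sm_coord 1) (hv 0), dX_coord, dX_coord]

theorem dT_gam {v : Fin 3 → E3 × ℝ → ℝ} (hv : ∀ j, Sm (v j)) (z) :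
    dT (gam v) z = z.1 0 * dT (v 1) z - z.1 1 * dT (v 0) z := by
  have : gam v = fun z => z.1 0 * v 1 z - z.1 1 * v 0 z := rfl
  rw [this, dT_sub ((sm_coord 0).mul (hv 1)) ((sm_coord 1).mul (hv 0)),
    dT_mul (sm_coord 0) (hv 1), dT_mul (sm_coord 1) (hv 0), dT_coord, dT_coord]
  ring

theorem dX_dX_gam {v : Fin 3 → E3 × ℝ → ℝ} (hv : ∀ j, Sm (v j)) (i : Fin 3) (z) :
    dX i (dX i (gam v)) z = 2 * (if (0 : Fin 3) = i then 1 else 0) * dX i (v 1) z +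
      z.1 0 * dX i (dX i (v 1)) z - (2 * (if (1 : Fin 3) = i then 1 else 0) * dX i (v 0) z +
      z.1 1 * dX i (dX i (v 0)) z) := by
  have e : dX i (gam v) = _ := funext (dX_gam hv i)
  have s1 := (sm_coord 0).mul ((hv 1).dX i)
  have s2 := (sm_coord 1).mul ((hv 0).dX i)
  have t1 : ∀ k : ℝ, Sm fun z => k * v 1 z := fun k => contDiff_const.mul (hv 1)
  have t2 : ∀ k : ℝ, Sm fun z => k * v 0 z := fun k => contDiff_const.mul (hv 0)
  rw [e, dX_sub ((t1 _).add s1) ((t2 _).add s2), dX_add (t1 _) s1, dX_add (t2 _) s2,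
    dX_mul contDiff_const (hv 1), dX_mul contDiff_const (hv 0),
    dX_mul (sm_coord 0) ((hv 1).dX i), dX_mul (sm_coord 1) ((hv 0).dX i), dX_coord, dX_coord,
    dX_const, dX_const]
  ring

section
variable {v : Fin 3 → E3 × ℝ → ℝ} {P : E3 × ℝ → ℝ} (hs : Sol v P) {z : E3 × ℝ}
  (h1 : ‖z.1‖ < 1) (h2 : -1 < z.2) (h3 : z.2 < 0)
include hs h1 h2 h3

theorem gam_eq : dT (gam v) z = ∑ i, dX i (dX i (gam v)) z - ∑ i, v i z * dX i (gam v) z -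
    2 * (dX 0 (v 1) z - dX 1 (v 0) z) := by
  have m0 := hs.mom z h1 h2 h3 0
  have m1 := hs.mom z h1 h2 h3 1
  have hp := hs.rotP z h1 h2 h3
  rw [dT_gam hs.smv]
  simp only [dX_gam hs.smv, dX_dX_gam hs.smv, Fin.sum_univ_three] at m0 m1 ⊢
  simp only [show ((0 : Fin 3) = 2) = False by simp, show ((1 : Fin 3) = 2) = False by simp,
    show ((0 : Fin 3) = 1) = False by simp, show ((1 : Fin 3) = 0) = False by simp, if_true,
    if_false]
  linear_combination z.1 0 * m1 - z.1 1 * m0 - hp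

theorem gam_rot : (z.1 0 ^ 2 + z.1 1 ^ 2) * (dX 0 (v 1) z - dX 1 (v 0) z) =
    z.1 0 * dX 0 (gam v) z + z.1 1 * dX 1 (gam v) z := by
  have r0 := hs.rot0 z h1 h2 h3
  have r1 := hs.rot1 z h1 h2 h3
  simp only [dX_gam hs.smv]
  norm_num
  linear_combination (-z.1 0) * r0 - z.1 1 * r1

theorem gam_sq_le_grad : gam v z ^ 2 ≤ (z.1 0 ^ 2 + z.1 1 ^ 2) ^ 2 * gsq v z := by
  have r0 := hs.rot0 z h1 h2 h3
  have r1 := hs.rot1 z h1 h2 h3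
  have c1 : gam v z ^ 2 ≤ (z.1 0 ^ 2 + z.1 1 ^ 2) * (v 0 z ^ 2 + v 1 z ^ 2) := by
    unfold gam; nlinarith [sq_nonneg (z.1 0 * v 0 z + z.1 1 * v 1 z)]
  have c2 : v 1 z ^ 2 ≤ (z.1 0 ^ 2 + z.1 1 ^ 2) * (dX 1 (v 0) z ^ 2 + dX 0 (v 0) z ^ 2) := by
    have : v 1 z ^ 2 = (z.1 0 * dX 1 (v 0) z - z.1 1 * dX 0 (v 0) z) ^ 2 := by rw [r0]; ring
    rw [this]; nlinarith [sq_nonneg (z.1 0 * dX 0 (v 0) z + z.1 1 * dX 1 (v 0) z)]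
  have c3 : v 0 z ^ 2 ≤ (z.1 0 ^ 2 + z.1 1 ^ 2) * (dX 1 (v 1) z ^ 2 + dX 0 (v 1) z ^ 2) := by
    have : v 0 z ^ 2 = (z.1 0 * dX 1 (v 1) z - z.1 1 * dX 0 (v 1) z) ^ 2 := by rw [r1]
    rw [this]; nlinarith [sq_nonneg (z.1 0 * dX 0 (v 1) z + z.1 1 * dX 1 (v 1) z)]
  have r2 : 0 ≤ z.1 0 ^ 2 + z.1 1 ^ 2 := by positivity
  have c4 : dX 1 (v 0) z ^ 2 + dX 0 (v 0) z ^ 2 + (dX 1 (v 1) z ^ 2 + dX 0 (v 1) z ^ 2) ≤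
      gsq v z := by
    simp only [gsq, Fin.sum_univ_three]
    nlinarith [sq_nonneg (dX 2 (v 0) z), sq_nonneg (dX 2 (v 1) z), sq_nonneg (dX 2 (v 2) z),
      sq_nonneg (dX 0 (v 2) z), sq_nonneg (dX 1 (v 2) z)]
  calc gam v z ^ 2 ≤ (z.1 0 ^ 2 + z.1 1 ^ 2) * (v 0 z ^ 2 + v 1 z ^ 2) := c1
    _ ≤ (z.1 0 ^ 2 + z.1 1 ^ 2) * ((z.1 0 ^ 2 + z.1 1 ^ 2) * gsq v z) := by
        gcongr; nlinarith
    _ = _ := by ring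
end

theorem gam_sq_le (v : Fin 3 → E3 × ℝ → ℝ) (z : E3 × ℝ) :
    gam v z ^ 2 ≤ (z.1 0 ^ 2 + z.1 1 ^ 2) * usq v z := by
  simp only [gam, usq, Fin.sum_univ_three]
  nlinarith [sq_nonneg (z.1 0 * v 0 z + z.1 1 * v 1 z), mul_nonneg (add_nonneg (sq_nonneg (z.1 0))
    (sq_nonneg (z.1 1))) (sq_nonneg (v 2 z))]

theorem axis_null : (volume : Measure (E3 × ℝ)) {z | z.1 0 = 0} = 0 := by
  set l : (E3 × ℝ) →ₗ[ℝ] ℝ :=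
    ((EuclideanSpace.proj (𝕜 := ℝ) (0 : Fin 3)).comp (ContinuousLinearMap.fst ℝ E3 ℝ)).toLinearMap
  have : (volume : Measure (E3 × ℝ)).IsAddHaarMeasure :=
    Measure.prod.instIsAddHaarMeasure volume volume
  have h := Measure.addHaar_submodule (volume : Measure (E3 × ℝ)) (LinearMap.ker l) (by
    intro h
    have : (ee 0, (0 : ℝ)) ∈ LinearMap.ker l := by rw [h]; trivial
    rw [LinearMap.mem_ker] at this
    have e : l (ee 0, 0) = 1 := by simp [l, ee]
    rw [e] at this
    norm_num at this)
  have e : {z : E3 × ℝ | z.1 0 = 0} = (LinearMap.ker l : Set (E3 × ℝ)) := by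
    ext z; simp [l]
  rw [e]; exact h

theorem exists_small_regularization {S : Set (E3 × ℝ)} (hS : Bornology.IsBounded S)
    {η : ℝ} (hη : 0 < η) : ∃ ε : ℝ, 0 < ε ∧
      ∫ z in S, ε / (z.1 0 ^ 2 + z.1 1 ^ 2 + ε) ≤ η := by
  have ht := tendsto_integral_of_dominated_convergence (μ := volume.restrict S)
    (F := fun (n : ℕ) (z : E3 × ℝ) => (1 / ((n : ℝ) + 1)) /
      (z.1 0 ^ 2 + z.1 1 ^ 2 + 1 / ((n : ℝ) + 1))) (f := fun _ => 0) (fun _ => 1)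
    (fun n => by
      have : Continuous fun z : E3 × ℝ => (1 / ((n : ℝ) + 1)) /
          (z.1 0 ^ 2 + z.1 1 ^ 2 + 1 / ((n : ℝ) + 1)) := by
        have c := fun j => (sm_coord j).cont
        refine continuous_const.div ((((c 0).pow 2).add ((c 1).pow 2)).add continuous_const) ?_
        intro z; positivity
      exact this.aestronglyMeasurable)
    (ion (f := fun _ => (1 : ℝ)) continuous_const hS)
    (fun n => .of_forall fun z => by
      have p : 0 < 1 / ((n : ℝ) + 1) := by positivity
      rw [Real.norm_of_nonneg (by positivity), div_le_one (by positivity)]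
      nlinarith [sq_nonneg (z.1 0), sq_nonneg (z.1 1)])
    (by
      have : ∀ᵐ z : E3 × ℝ ∂(volume.restrict S), z.1 0 ≠ 0 := by
        refine ae_restrict_of_ae ?_
        rw [ae_iff]; simpa using axis_null
      filter_upwards [this] with z hz
      have h1 := tendsto_one_div_add_atTop_nhds_zero_nat (𝕜 := ℝ)
      have h2 := h1.div (h1.const_add (z.1 0 ^ 2 + z.1 1 ^ 2)) (by
        have : 0 < z.1 0 ^ 2 := by positivity
        nlinarith [sq_nonneg (z.1 1)])
      rw [add_zero, zero_div] at h2
      exact h2)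
  simp only [integral_zero] at ht
  obtain ⟨n, hn⟩ := (ht.eventually_lt_const hη).exists
  exact ⟨1 / ((n : ℝ) + 1), by positivity, hn.le⟩

/-- A renormalisation of the swirl: `F` together with the derivative data needed for the
Caccioppoli inequality. -/
structure Renorm (F F1 F2 B : ℝ → ℝ) : Prop where
  sm : ContDiff ℝ (⊤ : ℕ∞) F
  sm1 : ContDiff ℝ (⊤ : ℕ∞) F1
  cont2 : Continuous F2
  contB : Continuous B
  d1 : ∀ y, HasDerivAt F (F1 y) y
  d2 : ∀ y, HasDerivAt F1 (F2 y) y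
  one_le : ∀ y, 1 ≤ F y
  sub_le : ∀ y, F y - 1 ≤ y ^ 2 * B y

theorem renorm_flux {v : Fin 3 → E3 × ℝ → ℝ} {P : E3 × ℝ → ℝ} (hs : Sol v P)
    {F F1 F2 B : ℝ → ℝ} (hF : Renorm F F1 F2 B)
    {φ : E3 × ℝ → ℝ} (hφ : Sm φ) {ρ T ε : ℝ} (hρ : ρ < 1) (h0 : ∀ x t, ρ ≤ ‖x‖ → φ (x, t) = 0)
    (h1 : ∀ x, φ (x, -1) = 0) (hT : -1 ≤ T) (hT0 : T ≤ 0) (hε : 0 < ε) :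
    ∫ x in Metric.ball (0 : E3) 1, F (gam v (x, T)) * φ (x, T) =
      ∫ z in (Metric.ball (0 : E3) 1) ×ˢ (Ioo (-1) T),
        (F (gam v z) * (dT φ z + ∑ i, dX i (dX i φ) z + ∑ i, v i z * dX i φ z)
          + 2 * (F (gam v z) - 1) * (2 * ε * ((z.1 0 ^ 2 + z.1 1 ^ 2 + ε)⁻¹) ^ 2 * φ z +
            (z.1 0 ^ 2 + z.1 1 ^ 2 + ε)⁻¹ * (z.1 0 * dX 0 φ z + z.1 1 * dX 1 φ z))
          - 2 * φ z * F1 (gam v z) * (dX 0 (v 1) z - dX 1 (v 0) z) *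
            (ε * (z.1 0 ^ 2 + z.1 1 ^ 2 + ε)⁻¹)
          - φ z * F2 (gam v z) * ∑ i, dX i (gam v) z ^ 2) := by
  have sG := sm_gam hs.smv
  set f : E3 × ℝ → ℝ := fun z => F (gam v z) with hf
  set f1 : E3 × ℝ → ℝ := fun z => F1 (gam v z) with hf1
  set R : E3 × ℝ → ℝ := fun z => (z.1 0 ^ 2 + z.1 1 ^ 2 + ε)⁻¹ with hR
  have sf : Sm f := hF.sm.comp sG
  have sf1 : Sm f1 := hF.sm1.comp sG
  have sm1 : Sm fun z => f z - 1 := sf.sub contDiff_const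
  have pos : ∀ z : E3 × ℝ, 0 < z.1 0 ^ 2 + z.1 1 ^ 2 + ε := fun z => by positivity
  have sq' : Sm fun z : E3 × ℝ => z.1 0 ^ 2 + z.1 1 ^ 2 + ε :=
    (((sm_coord 0).pow 2).add ((sm_coord 1).pow 2)).add contDiff_const
  have sR : Sm R := sq'.inv fun z => (pos z).ne'
  have df : ∀ i z, dX i f z = f1 z * dX i (gam v) z := fun i z => dX_comp sG i z (hF.d1 _)
  have dfT : ∀ z, dT f z = f1 z * dT (gam v) z := fun z => dT_comp sG z (hF.d1 _)
  have df1 : ∀ i z, dX i f1 z = F2 (gam v z) * dX i (gam v) z := fun i z =>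
    dX_comp sG i z (hF.d2 _)
  have dR : ∀ (i : Fin 3) z, dX i R z = -(R z) ^ 2 * ((if (0 : Fin 3) = i then 2 * z.1 0 else 0) +
      (if (1 : Fin 3) = i then 2 * z.1 1 else 0)) := by
    intro i z
    rw [hR, dX_comp sq' (F := fun y => y⁻¹) i z (hasDerivAt_inv (pos z).ne'),
      dX_add (((sm_coord 0).pow 2).add ((sm_coord 1).pow 2)) contDiff_const,
      dX_add ((sm_coord 0).pow 2) ((sm_coord 1).pow 2), dX_sq (sm_coord 0), dX_sq (sm_coord 1),
      dX_const, dX_coord, dX_coord]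
    simp only [mul_ite, mul_one, mul_zero, add_zero, inv_pow]
  set X : Fin 3 → E3 × ℝ → ℝ := fun i z => if i = 2 then 0 else z.1 i with hX
  have sX : ∀ i, Sm (X i) := fun i => by
    by_cases h : i = 2
    · simp only [hX, h, if_true]; exact contDiff_const
    · simp only [hX, h, if_false]; exact sm_coord i
  have dXX : ∀ i z, dX i (X i) z = if i = 2 then 0 else 1 := fun i z => by
    by_cases h : i = 2
    · simp only [hX, h, if_true]; exact dX_const _ _ _
    · simp only [hX, h, if_false]; rw [dX_coord, if_pos rfl]
  have sW : ∀ i, Sm (fun z => ((φ z * f1 z) * dX i (gam v) z - f z * dX i φ z) -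
      (φ z * f z) * v i z - ((2 * R z) * φ z) * (X i z * (f z - 1))) := fun i =>
    ((((hφ.mul sf1).mul (sG.dX i)).sub (sf.mul (hφ.dX i))).sub ((hφ.mul sf).mul (hs.smv i))).sub
      (((contDiff_const.mul sR).mul hφ).mul ((sX i).mul sm1))
  have hd0 : ∀ i x t, (1 + ρ) / 2 ≤ ‖x‖ → dX i φ (x, t) = 0 := by
    intro i x t hx
    rw [dX_congr (g := fun _ => 0), dX_const]
    have : ∀ᶠ z : E3 × ℝ in nhds (x, t), ρ < ‖z.1‖ :=
      (continuous_norm.comp continuous_fst).continuousAt.eventually_mem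
        (Ioi_mem_nhds (by simp; linarith))
    filter_upwards [this] with z hz using h0 z.1 z.2 hz.le
  refine flux (WT := fun z => f z * φ z) (sf.mul hφ) sW hT (ρ := (1 + ρ) / 2) (by linarith)
    (fun i x t hx => ?_) (fun x => by simp [h1]) (fun x t hx ht htT => ?_)
  · simp [hd0 i x t hx, h0 x t (by linarith)]
  · set z := (x, t) with hz
    have hd := hs.div z hx ht (by simp [hz]; linarith)
    have hg := gam_eq hs (z := z) hx ht (by simp [hz]; linarith)
    have hr := gam_rot hs (z := z) hx ht (by simp [hz]; linarith)
    have eW : ∀ i, dX i (fun z => ((φ z * f1 z) * dX i (gam v) z - f z * dX i φ z) -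
        (φ z * f z) * v i z - ((2 * R z) * φ z) * (X i z * (f z - 1))) z =
        φ z * F2 (gam v z) * dX i (gam v) z ^ 2 + φ z * f1 z * dX i (dX i (gam v)) z
        - f z * dX i (dX i φ) z - (dX i φ z * f z + φ z * (f1 z * dX i (gam v) z)) * v i z
        - φ z * f z * dX i (v i) z
        - (2 * dX i R z * φ z + 2 * R z * dX i φ z) * (X i z * (f z - 1))
        - 2 * R z * φ z * ((if i = 2 then 0 else 1) * (f z - 1) +
          X i z * (f1 z * dX i (gam v) z)) := by
      intro i
      have s1 := (hφ.mul sf1).mul (sG.dX i)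
      have s2 := sf.mul (hφ.dX i)
      have s3 := (hφ.mul sf).mul (hs.smv i)
      have s2R : Sm fun z => 2 * R z := contDiff_const.mul sR
      have s4 := (s2R.mul hφ).mul ((sX i).mul sm1)
      rw [dX_sub ((s1.sub s2).sub s3) s4, dX_sub (s1.sub s2) s3, dX_sub s1 s2,
        dX_mul (hφ.mul sf1) (sG.dX i), dX_mul hφ sf1, dX_mul sf (hφ.dX i),
        dX_mul (hφ.mul sf) (hs.smv i), dX_mul hφ sf, dX_mul (s2R.mul hφ) ((sX i).mul sm1),
        dX_mul s2R hφ, dX_mul contDiff_const sR, dX_mul (sX i) sm1, dX_sub sf contDiff_const,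
        dX_const, dX_const, dXX, df, df1]
      ring
    rw [dT_mul sf hφ, dfT, hg]
    simp only [eW]
    simp only [dR, hX, Fin.sum_univ_three] at hd ⊢
    have hRm : R z * (z.1 0 ^ 2 + z.1 1 ^ 2 + ε) = 1 := inv_mul_cancel₀ (pos z).ne'
    simp only [show ((0 : Fin 3) = 2) = False by simp, show ((1 : Fin 3) = 2) = False by simp,
      show ((0 : Fin 3) = 1) = False by simp, show ((1 : Fin 3) = 0) = False by simp, if_true,
      if_false]
    change _ = f z * _ + 2 * (f z - 1) * (2 * ε * R z ^ 2 * φ z + R z * _) -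
      2 * φ z * f1 z * _ * (ε * R z) - _ + _
    linear_combination (φ z * f z) * hd - (2 * φ z * f1 z * R z) * hr +
      (2 * φ z * f1 z * (dX 0 (v 1) z - dX 1 (v 0) z) - 4 * (f z - 1) * R z * φ z) * hRm

theorem caccioppoli {v : Fin 3 → E3 × ℝ → ℝ} {P : E3 × ℝ → ℝ} (hs : Sol v P)
    {F F1 F2 B : ℝ → ℝ} (hF : Renorm F F1 F2 B)
    {a b L : ℝ} {c : E3 × ℝ → ℝ} (hc : IsCut a b L c) (ha : a ≤ 9 / 16) {T : ℝ}
    (hT : -1 < T) (hT0 : T ≤ 0) :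
    (∫ x in Metric.ball (0 : E3) 1, F (gam v (x, T)) * c (x, T) ^ 2) +
      ∫ z in (Metric.ball (0 : E3) 1) ×ˢ (Ioo (-1) T),
        c z ^ 2 * F2 (gam v z) * ∑ i, dX i (gam v) z ^ 2 ≤
    6 * L * ∫ z in cy a, F (gam v z) * (1 + un v z) := by
  have hL : 0 ≤ L := (abs_nonneg _).trans (hc.dx 0 0)
  have sG := sm_gam hs.smv
  have cG := sG.cont
  have cu := cont_un hs.smv
  have c01 : Continuous (dX 0 (v 1)) := ((hs.smv 1).dX 0).cont
  have c10 : Continuous (dX 1 (v 0)) := ((hs.smv 0).dX 1).cont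
  set φ : E3 × ℝ → ℝ := fun z => c z ^ 2
  have sφ : Sm φ := hc.sm.pow 2
  have φ0 : ∀ z, 0 ≤ φ z := fun z => sq_nonneg _
  have φ1 : ∀ z, φ z ≤ 1 := fun z => pow_le_one₀ (hc.nonneg z) (hc.le_one z)
  have cF : Continuous fun z => F (gam v z) := hF.sm.continuous.comp cG
  have cF1 : Continuous fun z => F1 (gam v z) := hF.sm1.continuous.comp cG
  have cF2 : Continuous fun z => F2 (gam v z) := hF.cont2.comp cG
  have cB : Continuous fun z => B (gam v z) := hF.contB.comp cG
  set H : E3 × ℝ → ℝ := fun z => 4 * usq v z * |B (gam v z)| +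
    2 * |F1 (gam v z)| * |dX 0 (v 1) z - dX 1 (v 0) z|
  have cH : Continuous H := ((continuous_const.mul (sm_usq hs.smv).cont).mul cB.abs).add
    ((continuous_const.mul cF1.abs).mul (c01.sub c10).abs)
  have H0 : ∀ z, 0 ≤ H z := fun z => by
    have := usq_nonneg v z
    positivity
  obtain ⟨M, hM⟩ := (bdd_cy (a := a)).isCompact_closure.exists_bound_of_continuousOn
    cH.continuousOn
  set M' := max M 1
  have hM' : ∀ z ∈ cy a, H z ≤ M' := fun z hz =>
    (le_abs_self _).trans ((hM z (subset_closure hz)).trans (le_max_left _ _))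
  have M0 : 0 < M' := lt_of_lt_of_le one_pos (le_max_right _ _)
  refine le_of_forall_pos_le_add fun δ hδ => ?_
  obtain ⟨ε, hε, hεi⟩ := exists_small_regularization (bdd_cy (a := a))
    (η := δ / M') (by positivity)
  have pos : ∀ z : E3 × ℝ, 0 < z.1 0 ^ 2 + z.1 1 ^ 2 + ε := fun z => by positivity
  have cR : Continuous fun z : E3 × ℝ => (z.1 0 ^ 2 + z.1 1 ^ 2 + ε)⁻¹ :=
    ((((sm_coord 0).cont.pow 2).add ((sm_coord 1).cont.pow 2)).add continuous_const).inv₀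
      fun z => (pos z).ne'
  have cX0 := (sm_coord 0).cont
  have cX1 := (sm_coord 1).cont
  have cS : Continuous fun z => ∑ i, dX i (gam v) z ^ 2 :=
    continuous_finsetSum _ fun i _ => (sG.dX i).cont.pow 2
  have cE1 : Continuous fun z => dT φ z + ∑ i, dX i (dX i φ) z + ∑ i, v i z * dX i φ z :=
    (sφ.dT.cont.add (continuous_finsetSum _ fun i _ => ((sφ.dX i).dX i).cont)).add
      (continuous_finsetSum _ fun i _ => (hs.smv i).cont.mul (sφ.dX i).cont)
  have cE2 : Continuous fun z : E3 × ℝ => z.1 0 * dX 0 φ z + z.1 1 * dX 1 φ z :=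
    (cX0.mul (sφ.dX 0).cont).add (cX1.mul (sφ.dX 1).cont)
  have cI : Continuous fun z => F (gam v z) * (dT φ z + ∑ i, dX i (dX i φ) z +
      ∑ i, v i z * dX i φ z)
      + 2 * (F (gam v z) - 1) * (2 * ε * ((z.1 0 ^ 2 + z.1 1 ^ 2 + ε)⁻¹) ^ 2 * φ z +
        (z.1 0 ^ 2 + z.1 1 ^ 2 + ε)⁻¹ * (z.1 0 * dX 0 φ z + z.1 1 * dX 1 φ z))
      - 2 * φ z * F1 (gam v z) * (dX 0 (v 1) z - dX 1 (v 0) z) *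
        (ε * (z.1 0 ^ 2 + z.1 1 ^ 2 + ε)⁻¹) :=
    ((cF.mul cE1).add ((continuous_const.mul (cF.sub continuous_const)).mul
      (((continuous_const.mul (cR.pow 2)).mul sφ.cont).add (cR.mul cE2)))).sub
      ((((continuous_const.mul sφ.cont).mul cF1).mul (c01.sub c10)).mul (continuous_const.mul cR))
  have cD : Continuous fun z => φ z * F2 (gam v z) * ∑ i, dX i (gam v) z ^ 2 :=
    (sφ.cont.mul cF2).mul cS
  have cJ : Continuous fun z => 6 * L * (F (gam v z) * (1 + un v z)) :=
    continuous_const.mul (cF.mul (continuous_const.add cu))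
  have cK : Continuous fun z : E3 × ℝ => M' * (ε / (z.1 0 ^ 2 + z.1 1 ^ 2 + ε)) :=
    continuous_const.mul (continuous_const.mul cR)
  rw [renorm_flux hs hF sφ (ρ := 3 / 4) (by norm_num) (fun x t hx => by
      simp only [φ]; rw [hc.out x t (Or.inl (by nlinarith))]; norm_num) (fun x => by
      simp only [φ]; rw [hc.out x (-1) (Or.inr (by linarith))]; norm_num) hT.le hT0 hε,
    integral_sub (ion cI (bdd_cyl _ _ _ _)) (ion cD (bdd_cyl _ _ _ _)), sub_add_cancel]
  calc _ ≤ ∫ z in cy a, (6 * L * (F (gam v z) * (1 + un v z)) +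
        M' * (ε / (z.1 0 ^ 2 + z.1 1 ^ 2 + ε))) := by
        refine setIntegral_le_of_cut cI (cJ.add cK)
          (Metric.isOpen_ball.measurableSet.prod measurableSet_Ioo) (meas_cy _)
          (bdd_cyl _ _ _ _) bdd_cy (fun z _ hz => ?_) (fun z hz hzn => ?_) (fun z _ => ?_)
        · have b1 : |dT φ z + ∑ i, dX i (dX i φ) z + ∑ i, v i z * dX i φ z| ≤
              4 * L + 3 * (un v z * L) := by
            refine (abs_add_le _ _).trans (add_le_add ((abs_add_le _ _).trans ?_) ?_)
            · linarith [hc.sqt z, abs_sum3_le fun i => hc.sqxx i z]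
            · refine abs_sum3_le fun i => ?_
              rw [abs_mul]
              exact mul_le_mul (abs_le_un v z i) (hc.sqx i z) (abs_nonneg _) (un_nonneg v z)
          have n0 := un_nonneg v z
          have f1 := hF.one_le (gam v z)
          have p := pos z
          have r0 : 0 ≤ z.1 0 ^ 2 + z.1 1 ^ 2 := by positivity
          set R := (z.1 0 ^ 2 + z.1 1 ^ 2 + ε)⁻¹ with hR
          have R0 : 0 < R := inv_pos.2 p
          have rR : R * (z.1 0 ^ 2 + z.1 1 ^ 2) ≤ 1 := by
            have : R * (z.1 0 ^ 2 + z.1 1 ^ 2 + ε) = 1 := inv_mul_cancel₀ p.ne'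
            nlinarith [mul_pos R0 hε]
          have b2 : R * (z.1 0 * dX 0 φ z + z.1 1 * dX 1 φ z) ≤ L := by
            calc _ ≤ R * (L * (z.1 0 ^ 2 + z.1 1 ^ 2)) :=
                  mul_le_mul_of_nonneg_left ((le_abs_self _).trans (hc.sqr z)) R0.le
              _ = L * (R * (z.1 0 ^ 2 + z.1 1 ^ 2)) := by ring
              _ ≤ L * 1 := mul_le_mul_of_nonneg_left rR hL
              _ = L := mul_one L
          have b3 : (F (gam v z) - 1) * R ≤ usq v z * |B (gam v z)| := by
            have u0 := usq_nonneg v z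
            calc _ ≤ (gam v z ^ 2 * |B (gam v z)|) * R := by
                  refine mul_le_mul_of_nonneg_right ?_ R0.le
                  exact (hF.sub_le _).trans (mul_le_mul_of_nonneg_left (le_abs_self _) (sq_nonneg _))
              _ ≤ (((z.1 0 ^ 2 + z.1 1 ^ 2) * usq v z) * |B (gam v z)|) * R := by
                  gcongr; exact gam_sq_le v z
              _ = (usq v z * |B (gam v z)|) * (R * (z.1 0 ^ 2 + z.1 1 ^ 2)) := by ring
              _ ≤ (usq v z * |B (gam v z)|) * 1 := mul_le_mul_of_nonneg_left rR (by positivity)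
              _ = _ := mul_one _
          have t1 : F (gam v z) * (dT φ z + ∑ i, dX i (dX i φ) z + ∑ i, v i z * dX i φ z) ≤
              F (gam v z) * (4 * L + 3 * (un v z * L)) :=
            mul_le_mul_of_nonneg_left ((le_abs_self _).trans b1) (by linarith)
          have t2 : 2 * (F (gam v z) - 1) * (R * (z.1 0 * dX 0 φ z + z.1 1 * dX 1 φ z)) ≤
              2 * (F (gam v z) - 1) * L := mul_le_mul_of_nonneg_left b2 (by linarith)
          have t3 : 2 * (F (gam v z) - 1) * (2 * ε * R ^ 2 * φ z) ≤
              4 * (usq v z * |B (gam v z)|) * (ε * R) := by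
            calc _ = (F (gam v z) - 1) * R * (4 * (ε * R)) * φ z := by ring
              _ ≤ (F (gam v z) - 1) * R * (4 * (ε * R)) * 1 :=
                  mul_le_mul_of_nonneg_left (φ1 z)
                    (mul_nonneg (mul_nonneg (by linarith) R0.le) (by positivity))
              _ ≤ (usq v z * |B (gam v z)|) * (4 * (ε * R)) * 1 := by gcongr
              _ = _ := by ring
          have t4 : -(2 * φ z * F1 (gam v z) * (dX 0 (v 1) z - dX 1 (v 0) z) * (ε * R)) ≤
              2 * |F1 (gam v z)| * |dX 0 (v 1) z - dX 1 (v 0) z| * (ε * R) := by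
            refine (neg_le_abs _).trans ?_
            rw [abs_mul, abs_mul, abs_mul, abs_mul, abs_two, abs_of_nonneg (φ0 z),
              abs_of_pos (mul_pos hε R0)]
            have : 2 * φ z ≤ 2 := by linarith [φ1 z]
            gcongr
          have t5 : H z * (ε * R) ≤ M' * (ε * R) :=
            mul_le_mul_of_nonneg_right (hM' z hz) (by positivity)
          have t6 : H z * (ε * R) = 4 * (usq v z * |B (gam v z)|) * (ε * R) +
            2 * |F1 (gam v z)| * |dX 0 (v 1) z - dX 1 (v 0) z| * (ε * R) := by
            simp only [H]; ring
          rw [div_eq_mul_inv, ← hR]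
          nlinarith [mul_nonneg (mul_nonneg (by linarith : 0 ≤ F (gam v z)) n0) hL]
        · have hz2 : z.2 < 0 := (hz.2.2).trans_le hT0
          have c0 := hc.out_cy hzn hz2
          have e0 : φ z = 0 := by simp [φ, c0]
          have e1 : dT φ z = 0 := hc.outt z c0
          have e2 : ∀ i, dX i φ z = 0 := fun i => hc.outsx i z c0
          have e3 : ∀ i, dX i (dX i φ) z = 0 := fun i => hc.outsxx i z c0
          simp [e0, e1, e2, e3]
        · have := pos z
          have := un_nonneg v z
          have := hF.one_le (gam v z)
          have : 0 ≤ F (gam v z) := by linarith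
          positivity
    _ = 6 * L * (∫ z in cy a, F (gam v z) * (1 + un v z)) +
        M' * ∫ z in cy a, ε / (z.1 0 ^ 2 + z.1 1 ^ 2 + ε) := by
        rw [integral_add (icy cJ a) (icy cK a), integral_const_mul, integral_const_mul]
    _ ≤ _ := by
        gcongr
        calc _ ≤ M' * (δ / M') := mul_le_mul_of_nonneg_left hεi M0.le
          _ = δ := mul_div_cancel₀ _ M0.ne'

theorem renorm_rpow {n : ℝ} (hn : 1 ≤ n) : Renorm (fun y => (1 + y ^ 2) ^ n)
    (fun y => 2 * n * y * (1 + y ^ 2) ^ (n - 1))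
    (fun y => 2 * n * (1 + y ^ 2) ^ (n - 1) + 4 * n * (n - 1) * y ^ 2 * (1 + y ^ 2) ^ (n - 2))
    (fun y => n * (1 + y ^ 2) ^ (n - 1)) := by
  have p : ∀ y : ℝ, 0 < 1 + y ^ 2 := fun y => by positivity
  have s : ContDiff ℝ (⊤ : ℕ∞) fun y : ℝ => 1 + y ^ 2 := contDiff_const.add (contDiff_id.pow 2)
  have sr : ∀ m : ℝ, ContDiff ℝ (⊤ : ℕ∞) fun y : ℝ => (1 + y ^ 2) ^ m := fun m =>
    s.rpow_const_of_ne fun y => (p y).ne'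
  have d : ∀ (m y : ℝ), HasDerivAt (fun y : ℝ => (1 + y ^ 2) ^ m)
      (2 * m * y * (1 + y ^ 2) ^ (m - 1)) y := fun m y => by
    have h := ((hasDerivAt_pow 2 y).const_add 1).rpow_const (p := m) (Or.inl (p y).ne')
    convert h using 1
    push_cast; ring
  refine ⟨sr n, (contDiff_const.mul contDiff_id).mul (sr _),
    (continuous_const.mul (sr _).continuous).add
      ((continuous_const.mul (continuous_id.pow 2)).mul (sr _).continuous),
    continuous_const.mul (sr _).continuous, d n, fun y => ?_,
    fun y => one_le_rpow (by nlinarith) (by linarith), fun y => ?_⟩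
  · have h := ((hasDerivAt_id y).const_mul (2 * n)).mul (d (n - 1) y)
    refine HasDerivAt.congr_deriv (f := fun y => 2 * n * y * (1 + y ^ 2) ^ (n - 1)) h ?_
    rw [show n - 2 = n - 1 - 1 by ring]
    simp only [id]
    ring
  · have hs : -1 ≤ -(y ^ 2 / (1 + y ^ 2)) := by
      rw [neg_le_neg_iff, div_le_one (p y)]; linarith
    have h := one_add_mul_self_le_rpow_one_add hs hn
    have e : 1 + -(y ^ 2 / (1 + y ^ 2)) = (1 + y ^ 2)⁻¹ := by
      have := (p y).ne'
      field_simp; ring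
    rw [e, inv_rpow (p y).le] at h
    have q : 0 < (1 + y ^ 2) ^ n := rpow_pos_of_pos (p y) n
    have h2 := mul_le_mul_of_nonneg_right h q.le
    rw [inv_mul_cancel₀ q.ne'] at h2
    have e2 : (1 + y ^ 2) ^ (n - 1) = (1 + y ^ 2) ^ n / (1 + y ^ 2) := by
      rw [rpow_sub (p y), rpow_one]
    rw [e2]
    have e3 : (1 + n * -(y ^ 2 / (1 + y ^ 2))) * (1 + y ^ 2) ^ n = (1 + y ^ 2) ^ n -
      y ^ 2 * (n * ((1 + y ^ 2) ^ n / (1 + y ^ 2))) := by ring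
    linarith

theorem moser_step : ∃ C : ℝ, 1 ≤ C ∧ ∀ v P, Sol v P → ∀ n a b L : ℝ, 1 ≤ n → a ≤ 9 / 16 →
    b ≤ a → 1 ≤ L → (∃ c, IsCut a b L c) →
    ∫ z in cy b, (1 + gam v z ^ 2) ^ (5 / 3 * n) ≤
      C * L ^ 5 * (∫ z in cy a, (1 + gam v z ^ 2) ^ n * (1 + un v z)) ^ (5 / 3 : ℝ) := by
  obtain ⟨C, hC, hsob⟩ := parabolic_sobolev
  have hC2 : 0 < C * 2 * 6 ^ (5 / 3 : ℝ) := by positivity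
  refine ⟨1 + C * 2 * 6 ^ (5 / 3 : ℝ), by linarith, ?_⟩
  rintro v P hs n a b L hn ha hba hL ⟨c, hc⟩
  have hF := renorm_rpow hn
  have hcac := fun {T : ℝ} => caccioppoli (T := T) hs hF hc ha
  set S := ∫ z in cy a, (1 + gam v z ^ 2) ^ n * (1 + un v z) with hS
  have sG := sm_gam hs.smv
  have p : ∀ y : ℝ, 0 < 1 + y ^ 2 := fun y => by positivity
  have cu := cont_un hs.smv
  have cV : ∀ m : ℝ, Continuous fun z => (1 + gam v z ^ 2) ^ m := fun m =>
    (continuous_const.add (sG.cont.pow 2)).rpow_const fun z => Or.inl (p _).ne'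
  have V0 : ∀ (m : ℝ) z, 0 < (1 + gam v z ^ 2) ^ m := fun m z => rpow_pos_of_pos (p _) _
  have S0 : 0 ≤ S := integral_nonneg fun z =>
    mul_nonneg (V0 _ _).le (by have := un_nonneg v z; linarith)
  have hI : ∫ z in cy a, (1 + gam v z ^ 2) ^ n ≤ S :=
    setIntegral_mono_on (icy (cV n) a) (icy ((cV n).mul (continuous_const.add cu)) a) (meas_cy a)
      fun z _ => by nlinarith [V0 n z, un_nonneg v z]
  have sg : Sm fun z => (1 + gam v z ^ 2) ^ (n / 2) :=
    (contDiff_const.add (sG.pow 2)).rpow_const_of_ne fun z => (p _).ne'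
  have dg : ∀ i z, dX i (fun z => (1 + gam v z ^ 2) ^ (n / 2)) z =
      n * gam v z * (1 + gam v z ^ 2) ^ (n / 2 - 1) * dX i (gam v) z := fun i z => by
    refine dX_comp sG (F := fun y => (1 + y ^ 2) ^ (n / 2)) i z ?_
    have h := ((hasDerivAt_pow 2 (gam v z)).const_add 1).rpow_const (p := n / 2)
      (Or.inl (p _).ne')
    convert h using 1
    push_cast; ring
  set w : E3 × ℝ → ℝ := fun z => (1 + gam v z ^ 2) ^ (n / 2) * c z
  have sw : Sm w := sg.mul hc.sm
  have wsq : ∀ z, w z ^ 2 = (1 + gam v z ^ 2) ^ n * c z ^ 2 := fun z => by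
    simp only [w]
    rw [mul_pow, ← rpow_mul_natCast (p _).le]; norm_num
  have F2nn : ∀ z, 0 ≤ c z ^ 2 * (2 * n * (1 + gam v z ^ 2) ^ (n - 1) +
      4 * n * (n - 1) * gam v z ^ 2 * (1 + gam v z ^ 2) ^ (n - 2)) *
      ∑ i, dX i (gam v) z ^ 2 := fun z => by
    have := V0 (n - 1) z
    have := V0 (n - 2) z
    have : 0 ≤ n - 1 := by linarith
    positivity
  have hM : ∀ t, -1 < t → t < 0 → ∫ x in Metric.ball (0 : E3) 1, w (x, t) ^ 2 ≤ 6 * L * S := by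
    intro t h1 h2
    refine le_trans ?_ (hcac h1 h2.le)
    simp only [wsq]
    exact le_add_of_nonneg_right (integral_nonneg fun z => F2nn z)
  have hD : ∫ z in (Metric.ball 0 1) ×ˢ (Ioo (-1) 0), ∑ i, (dX i w z) ^ 2 ≤ 12 * L ^ 2 * S := by
    have h0 := hcac (T := 0) (by norm_num) le_rfl
    have cD : Continuous fun z => c z ^ 2 * (2 * n * (1 + gam v z ^ 2) ^ (n - 1) +
      4 * n * (n - 1) * gam v z ^ 2 * (1 + gam v z ^ 2) ^ (n - 2)) *
      ∑ i, dX i (gam v) z ^ 2 :=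
      ((hc.sm.cont.pow 2).mul (((continuous_const.mul (cV _))).add ((continuous_const.mul
        (sG.cont.pow 2)).mul (cV _)))).mul
        (continuous_finsetSum _ fun i _ => (sG.dX i).cont.pow 2)
    have cL : Continuous fun z => 6 * L ^ 2 * (1 + gam v z ^ 2) ^ n := continuous_const.mul (cV n)
    have h1 : ∫ z in (Metric.ball 0 1) ×ˢ (Ioo (-1) 0), ∑ i, (dX i w z) ^ 2 ≤
        ∫ z in cy 1, (c z ^ 2 * (2 * n * (1 + gam v z ^ 2) ^ (n - 1) +
          4 * n * (n - 1) * gam v z ^ 2 * (1 + gam v z ^ 2) ^ (n - 2)) *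
          ∑ i, dX i (gam v) z ^ 2 + (cy a).indicator (fun z => 6 * L ^ 2 *
          (1 + gam v z ^ 2) ^ n) z) := by
      rw [← cy_one]
      refine setIntegral_mono_on (icy (continuous_finsetSum _ fun i _ => (sw.dX i).cont.pow 2) 1)
        ((icy cD 1).add ((icy cL 1).indicator (meas_cy a))) (meas_cy 1) fun z hz => ?_
      have ew : ∀ i, dX i w z = (n * gam v z * (1 + gam v z ^ 2) ^ (n / 2 - 1) * dX i (gam v) z) *
          c z + (1 + gam v z ^ 2) ^ (n / 2) * dX i c z := fun i => by
        simp only [w]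
        rw [dX_mul sg hc.sm, dg]
      have A : (1 + gam v z ^ 2) ^ (n - 1) = (1 + gam v z ^ 2) * (1 + gam v z ^ 2) ^ (n - 2) := by
        rw [show n - 1 = 1 + (n - 2) by ring, rpow_add (p _), rpow_one]
      have A2 : ((1 + gam v z ^ 2) ^ (n / 2 - 1)) ^ 2 = (1 + gam v z ^ 2) ^ (n - 2) := by
        rw [← rpow_mul_natCast (p _).le]; congr 1; push_cast; ring
      have A3 : ((1 + gam v z ^ 2) ^ (n / 2)) ^ 2 = (1 + gam v z ^ 2) ^ n := by
        rw [← rpow_mul_natCast (p _).le]; congr 1; push_cast; ring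
      have b0 : ∀ i, dX i w z ^ 2 ≤ c z ^ 2 * (2 * n * (1 + gam v z ^ 2) ^ (n - 1) +
          4 * n * (n - 1) * gam v z ^ 2 * (1 + gam v z ^ 2) ^ (n - 2)) * dX i (gam v) z ^ 2 +
          2 * (1 + gam v z ^ 2) ^ n * dX i c z ^ 2 := fun i => by
        have V2 := V0 (n - 2) z
        set V := (1 + gam v z ^ 2) ^ (n - 2)
        rw [ew, A]
        refine (add_sq_le (a := n * gam v z * (1 + gam v z ^ 2) ^ (n / 2 - 1) * dX i (gam v) z *
          c z) (b := (1 + gam v z ^ 2) ^ (n / 2) * dX i c z)).trans ?_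
        simp only [mul_pow, A2, A3]
        have : 0 ≤ 2 * n * V * (1 + (n - 1) * gam v z ^ 2) * (dX i (gam v) z ^ 2 * c z ^ 2) := by
          have : 0 ≤ n - 1 := by linarith
          positivity
        nlinarith
      by_cases hza : z ∈ cy a
      · rw [indicator_of_mem hza, Finset.mul_sum]
        refine (Finset.sum_le_sum fun i _ => b0 i).trans ?_
        rw [Finset.sum_add_distrib]
        gcongr
        rw [← Finset.mul_sum]
        have : ∑ i, dX i c z ^ 2 ≤ ∑ _i : Fin 3, L ^ 2 := Finset.sum_le_sum fun i _ =>
          sq_le_sq' (abs_le.1 (hc.dx i z)).1 (abs_le.1 (hc.dx i z)).2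
        simp only [Finset.sum_const, Finset.card_univ, Fintype.card_fin, nsmul_eq_mul] at this
        push_cast at this
        nlinarith [V0 n z]
      · have c0 := hc.out_cy hza hz.2.2
        rw [indicator_of_notMem hza]
        simp [ew, c0, hc.outx _ z c0]
    refine h1.trans ?_
    rw [integral_add (icy cD 1) ((icy cL 1).indicator (meas_cy a)),
      setIntegral_indicator (meas_cy a), inter_eq_right.2 (cy_mono (by linarith)),
      integral_const_mul]
    have h2 : 0 ≤ ∫ x in Metric.ball (0 : E3) 1, (1 + gam v (x, 0) ^ 2) ^ n * c (x, 0) ^ 2 :=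
      integral_nonneg fun x => mul_nonneg (V0 _ _).le (sq_nonneg _)
    rw [← cy_one] at h0
    have h3 : 6 * L ^ 2 * ∫ z in cy a, (1 + gam v z ^ 2) ^ n ≤ 6 * L ^ 2 * S := by gcongr
    nlinarith [mul_nonneg (by linarith : 0 ≤ L - 1) (mul_nonneg (by linarith : 0 ≤ L) S0)]
  have hmain := hsob w (3 / 4) (6 * L * S) sw (by norm_num) (fun x t hx => by
    simp only [w]; rw [hc.out x t (Or.inl (by nlinarith)), mul_zero]) hM
  have h5 : ∫ z in cy b, (1 + gam v z ^ 2) ^ (5 / 3 * n) ≤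
      ∫ z in (Metric.ball 0 1) ×ˢ (Ioo (-1) 0), |w z| ^ (10 / 3 : ℝ) := by
    rw [← cy_one]
    have cw : Continuous fun z => |w z| ^ (10 / 3 : ℝ) :=
      sw.cont.abs.rpow_const fun _ => Or.inr (by norm_num)
    refine setIntegral_le_of_cut (cV _) cw (meas_cy b) (meas_cy 1) bdd_cy bdd_cy
      (fun z hz _ => ?_) (fun z hz hzn => absurd (cy_mono (by linarith) hz) hzn)
      (fun z _ => by positivity)
    simp only [w]
    rw [hc.one z hz, mul_one, abs_of_pos (V0 _ _), ← rpow_mul (p _).le]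
    apply le_of_eq; congr 1; ring
  refine h5.trans (hmain.trans ?_)
  have L0 : 0 < L := by linarith
  calc C * (6 * L * S) ^ (2 / 3 : ℝ) * ∫ z in (Metric.ball 0 1) ×ˢ (Ioo (-1) 0), ∑ i, (dX i w z) ^ 2
      ≤ C * (6 * L * S) ^ (2 / 3 : ℝ) * (2 * L * (6 * L * S)) := by
        gcongr; refine hD.trans (le_of_eq (by ring))
    _ = C * 2 * L * ((6 * L * S) ^ (2 / 3 : ℝ) * (6 * L * S)) := by ring
    _ = C * 2 * L * (6 ^ (5 / 3 : ℝ) * L ^ (5 / 3 : ℝ) * S ^ (5 / 3 : ℝ)) := by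
        have e : ∀ s : ℝ, 0 ≤ s → s ^ (2 / 3 : ℝ) * s = s ^ (5 / 3 : ℝ) := fun s hs => by
          rw [show (5 / 3 : ℝ) = 2 / 3 + 1 by norm_num, rpow_add_one' hs (by norm_num)]
        rw [e _ (by positivity), mul_rpow (by positivity) S0, mul_rpow (by norm_num) L0.le]
    _ ≤ C * 2 * L * (6 ^ (5 / 3 : ℝ) * L ^ (4 : ℝ) * S ^ (5 / 3 : ℝ)) := by
        have := rpow_le_rpow_of_exponent_le hL (by norm_num : (5 / 3 : ℝ) ≤ 4)
        gcongr
    _ = C * 2 * 6 ^ (5 / 3 : ℝ) * L ^ 5 * S ^ (5 / 3 : ℝ) := by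
        rw [show (4 : ℝ) = (4 : ℕ) by norm_num, rpow_natCast]; ring
    _ ≤ _ := by
        gcongr; linarith

/-- The energy of `v` on the unit parabolic cylinder is bounded by `x`. -/
structure EnergyLe (v : Fin 3 → E3 × ℝ → ℝ) (x : ℝ) : Prop where
  nonneg : 0 ≤ x
  slice : ∀ t, -1 < t → t < 0 → ∫ y in Metric.ball (0 : E3) 1, usq v (y, t) ≤ x
  grad : ∫ z in cy 1, gsq v z ≤ x

theorem EnergyLe.usq_le {v : Fin 3 → E3 × ℝ → ℝ} {x : ℝ} (h : EnergyLe v x)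
    (hv : ∀ j, Sm (v j)) : ∫ z in cy 1, usq v z ≤ x := by
  rw [cy_one, setInt_prod_symm (sm_usq hv).cont]
  calc _ ≤ ∫ t in Ioo (-1 : ℝ) 0, x := by
        refine integral_mono_of_nonneg (.of_forall fun t => integral_nonneg fun y =>
          usq_nonneg v _) (integrable_const x) ?_
        exact (ae_restrict_iff' measurableSet_Ioo).2 (.of_forall fun t ht => h.slice t ht.1 ht.2)
    _ = x := by simp

theorem add_sum_rpow_le {s : ℝ} (hs : 0 ≤ s) {a b : ℝ} (ha : 0 ≤ a) (hb : 0 ≤ b) :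
    (a + b) ^ s ≤ 2 ^ s * (a ^ s + b ^ s) := by
  have h1 := rpow_nonneg ha s
  have h2 := rpow_nonneg hb s
  rcases le_total a b with h | h
  · calc (a + b) ^ s ≤ (2 * b) ^ s := by gcongr; linarith
      _ = 2 ^ s * b ^ s := mul_rpow zero_le_two hb
      _ ≤ _ := by gcongr; linarith
  · calc (a + b) ^ s ≤ (2 * a) ^ s := by gcongr; linarith
      _ = 2 ^ s * a ^ s := mul_rpow zero_le_two ha
      _ ≤ _ := by gcongr; linarith

theorem un_rpow_bound : ∃ C : ℝ, 1 ≤ C ∧ ∀ v x, (∀ j, Sm (v j)) → EnergyLe v x →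
    ∫ z in cy (9 / 16), un v z ^ (10 / 3 : ℝ) ≤ C * x ^ (5 / 3 : ℝ) := by
  obtain ⟨C, hC, hsob⟩ := parabolic_sobolev
  obtain ⟨K, hK, h⟩ := exists_isCut
  obtain ⟨c, hc⟩ := h (3 / 4) (9 / 16) (by norm_num) (by norm_num) (by norm_num)
  set L := K / (3 / 4 - 9 / 16) ^ 2
  have hq : (0 : ℝ) < 3 ^ (10 / 3 : ℝ) * (3 * (C * (2 + 6 * L ^ 2))) := by positivity
  refine ⟨1 + 3 ^ (10 / 3 : ℝ) * (3 * (C * (2 + 6 * L ^ 2))), by linarith, fun v x hv hx => ?_⟩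
  have x0 := hx.nonneg
  have sw : ∀ j, Sm fun z => v j z * c z := fun j => (hv j).mul hc.sm
  have cw : ∀ j, Continuous fun z => |v j z * c z| ^ (10 / 3 : ℝ) := fun j =>
    (sw j).cont.abs.rpow_const fun _ => Or.inr (by norm_num)
  have h1 : ∀ j, ∫ z in cy 1, |v j z * c z| ^ (10 / 3 : ℝ) ≤
      C * (2 + 6 * L ^ 2) * x ^ (5 / 3 : ℝ) := by
    intro j
    have hM : ∀ t, -1 < t → t < 0 →
        ∫ y in Metric.ball (0 : E3) 1, (v j (y, t) * c (y, t)) ^ 2 ≤ x := by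
      intro t t1 t2
      refine le_trans ?_ (hx.slice t t1 t2)
      refine integral_mono (ion ((slice_cont (sw j).cont t).pow 2) Metric.isBounded_ball)
        (ion (slice_cont (sm_usq hv).cont t) Metric.isBounded_ball) fun y => ?_
      simp only
      have hl : v j (y, t) ^ 2 ≤ usq v (y, t) :=
        Finset.single_le_sum (f := fun j => v j (y, t) ^ 2) (fun _ _ => sq_nonneg _)
          (Finset.mem_univ j)
      have := pow_le_one₀ (n := 2) (hc.nonneg (y, t)) (hc.le_one (y, t))
      rw [mul_pow]
      nlinarith [sq_nonneg (v j (y, t))]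
    have hD : ∫ z in cy 1, ∑ i, (dX i (fun z => v j z * c z) z) ^ 2 ≤ (2 + 6 * L ^ 2) * x := by
      calc _ ≤ ∫ z in cy 1, (2 * gsq v z + 6 * L ^ 2 * usq v z) := by
            refine integral_mono (icy (continuous_finsetSum _ fun i _ => ((sw j).dX i).cont.pow 2) 1)
              (icy ((continuous_const.mul (sm_gsq hv).cont).add
                (continuous_const.mul (sm_usq hv).cont)) 1) fun z => ?_
            have hl : v j z ^ 2 ≤ usq v z :=
              Finset.single_le_sum (f := fun j => v j z ^ 2) (fun _ _ => sq_nonneg _)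
                (Finset.mem_univ j)
            have hg : ∑ i, dX i (v j) z ^ 2 ≤ gsq v z :=
              Finset.single_le_sum (f := fun j => ∑ i, dX i (v j) z ^ 2)
                (fun _ _ => Finset.sum_nonneg fun _ _ => sq_nonneg _) (Finset.mem_univ j)
            have c1 := pow_le_one₀ (n := 2) (hc.nonneg z) (hc.le_one z)
            have b0 : ∀ i, dX i (fun z => v j z * c z) z ^ 2 ≤
                2 * dX i (v j) z ^ 2 + 2 * (v j z ^ 2 * L ^ 2) := fun i => by
              rw [dX_mul (hv j) hc.sm]
              have d := sq_le_sq' (abs_le.1 (hc.dx i z)).1 (abs_le.1 (hc.dx i z)).2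
              refine (add_sq_le (a := dX i (v j) z * c z) (b := v j z * dX i c z)).trans ?_
              rw [mul_pow, mul_pow]
              nlinarith [mul_le_mul_of_nonneg_left c1 (sq_nonneg (dX i (v j) z)),
                mul_le_mul_of_nonneg_left d (sq_nonneg (v j z))]
            refine (Finset.sum_le_sum fun i _ => b0 i).trans ?_
            rw [Finset.sum_add_distrib, ← Finset.mul_sum]
            simp only [Finset.sum_const, Finset.card_univ, Fintype.card_fin, nsmul_eq_mul]
            push_cast
            nlinarith [sq_nonneg L]
        _ = 2 * (∫ z in cy 1, gsq v z) + 6 * L ^ 2 * ∫ z in cy 1, usq v z := by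
            have i1 : Continuous fun z => 2 * gsq v z := continuous_const.mul (sm_gsq hv).cont
            have i2 : Continuous fun z => 6 * L ^ 2 * usq v z :=
              continuous_const.mul (sm_usq hv).cont
            rw [integral_add (icy i1 1) (icy i2 1), integral_const_mul, integral_const_mul]
        _ ≤ 2 * x + 6 * L ^ 2 * x := by
            have := hx.grad
            have := hx.usq_le hv
            gcongr
        _ = _ := by ring
    have h2 := hsob (fun z => v j z * c z) (9 / 10) x (sw j) (by norm_num) (fun y t hy => by
      rw [hc.out y t (Or.inl (by nlinarith)), mul_zero]) hM
    rw [← cy_one] at h2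
    refine h2.trans ?_
    calc _ ≤ C * x ^ (2 / 3 : ℝ) * ((2 + 6 * L ^ 2) * x) := by gcongr
      _ = C * (2 + 6 * L ^ 2) * (x ^ (2 / 3 : ℝ) * x) := by ring
      _ = _ := by
        rw [show (5 / 3 : ℝ) = 2 / 3 + 1 by norm_num, rpow_add_one' x0 (by norm_num)]
  have x53 := rpow_nonneg x0 (5 / 3)
  have cs : Continuous fun z => 3 ^ (10 / 3 : ℝ) * ∑ j, |v j z * c z| ^ (10 / 3 : ℝ) :=
    continuous_const.mul (continuous_finsetSum _ fun j _ => cw j)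
  calc _ ≤ ∫ z in cy 1, 3 ^ (10 / 3 : ℝ) * ∑ j, |v j z * c z| ^ (10 / 3 : ℝ) := by
        refine setIntegral_le_of_cut ((cont_un hv).rpow_const fun _ => Or.inr (by norm_num))
          cs (meas_cy _) (meas_cy _) bdd_cy bdd_cy (fun z hz _ => ?_)
          (fun z hz hzn => absurd (cy_mono (by norm_num) hz) hzn) fun z _ => by positivity
        simp only [hc.one z hz, mul_one]
        obtain ⟨j, -, hj⟩ := Finset.exists_max_image Finset.univ (fun j => |v j z|)
          Finset.univ_nonempty
        have hu : un v z ≤ 3 * |v j z| := by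
          refine Real.sqrt_le_iff.2 ⟨by positivity, ?_⟩
          calc usq v z ≤ ∑ _i : Fin 3, |v j z| ^ 2 := Finset.sum_le_sum fun i hi => by
                rw [← sq_abs]; have := hj i hi; gcongr
            _ = 3 * |v j z| ^ 2 := by simp
            _ ≤ _ := by nlinarith [sq_nonneg |v j z|]
        calc un v z ^ (10 / 3 : ℝ) ≤ (3 * |v j z|) ^ (10 / 3 : ℝ) := by
              have := un_nonneg v z
              gcongr
          _ = 3 ^ (10 / 3 : ℝ) * |v j z| ^ (10 / 3 : ℝ) :=
              mul_rpow (by norm_num) (abs_nonneg _)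
          _ ≤ _ := by
              gcongr
              exact Finset.single_le_sum (f := fun j => |v j z| ^ (10 / 3 : ℝ))
                (fun _ _ => by positivity) (Finset.mem_univ j)
    _ = 3 ^ (10 / 3 : ℝ) * ∑ j, ∫ z in cy 1, |v j z * c z| ^ (10 / 3 : ℝ) := by
        rw [integral_const_mul, integral_finsetSum _ fun j _ => icy (cw j) 1]
    _ ≤ 3 ^ (10 / 3 : ℝ) * ∑ _j : Fin 3, C * (2 + 6 * L ^ 2) * x ^ (5 / 3 : ℝ) := by
        gcongr with j _; exact h1 j
    _ = 3 ^ (10 / 3 : ℝ) * (3 * (C * (2 + 6 * L ^ 2))) * x ^ (5 / 3 : ℝ) := by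
        simp; ring
    _ ≤ _ := by gcongr; linarith

/-- The limiting step of Moser's iteration. -/
theorem le_of_integral_rpow_le {V : E3 × ℝ → ℝ} (hV : Continuous V) (hV0 : ∀ z, 0 ≤ V z)
    {A : ℝ} {s : ℕ → ℝ} (hs : Filter.Tendsto s Filter.atTop Filter.atTop) {lam : ℝ} (hl : 0 ≤ lam)
    (hs0 : ∀ k, 0 < s k) (h : ∀ k, ∫ z in cy A, V z ^ s k ≤ lam ^ s k) {z : E3 × ℝ}
    (hz : z ∈ cy A) : V z ≤ lam := by
  by_contra! hlt
  obtain ⟨μ, h1, h2⟩ := exists_between hlt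
  have μ0 : 0 < μ := hl.trans_lt h1
  set O := {z | μ < V z} ∩ cy A
  have hO : IsOpen O := (isOpen_lt continuous_const hV).inter (isOpen_cy A)
  have hm : 0 < (volume : Measure (E3 × ℝ)).real O := by
    refine ENNReal.toReal_pos (hO.measure_pos _ ⟨z, h2, hz⟩).ne' ?_
    exact ((bdd_cy (a := A)).subset inter_subset_right).measure_lt_top.ne
  have hk : ∀ k, volume.real O ≤ (lam / μ) ^ s k := by
    intro k
    have cV : Continuous fun z => V z ^ s k := hV.rpow_const fun _ => Or.inr (hs0 k).le
    have : volume.real O * μ ^ s k ≤ lam ^ s k := by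
      refine le_trans ?_ (h k)
      calc volume.real O * μ ^ s k = ∫ _z in O, μ ^ s k := by
            rw [setIntegral_const, smul_eq_mul]
        _ ≤ ∫ z in O, V z ^ s k := by
            refine setIntegral_mono_on (integrableOn_const
              (((bdd_cy (a := A)).subset inter_subset_right).measure_lt_top.ne))
              ((icy cV A).mono_set inter_subset_right) hO.measurableSet fun w hw => ?_
            exact rpow_le_rpow μ0.le hw.1.le (hs0 k).le
        _ ≤ _ := setIntegral_mono_set (icy cV A) (.of_forall fun w => rpow_nonneg (hV0 w) _)
            inter_subset_right.eventuallyLE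
    rw [div_rpow hl μ0.le]
    exact (le_div_iff₀ (rpow_pos_of_pos μ0 _)).2 this
  have ht : Filter.Tendsto (fun k => (lam / μ) ^ s k) Filter.atTop (nhds 0) :=
    (tendsto_rpow_atTop_of_base_lt_one _ (by
      have : 0 ≤ lam / μ := by positivity
      linarith) ((div_lt_one μ0).2 h1)).comp hs
  exact absurd (ge_of_tendsto' ht hk) (by linarith)

theorem rpow_iterate_le {Y : ℕ → ℝ} (Y0 : ∀ k, 0 ≤ Y k) {H b : ℝ} (hH : 1 ≤ H) (hb : 1 ≤ b)
    (h : ∀ k, Y (k + 1) ≤ H * b ^ k * Y k ^ (7 / 6 : ℝ)) (k : ℕ) :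
    Y k ≤ (Y 0 * H ^ 6 * b ^ 36) ^ ((7 / 6 : ℝ) ^ k) := by
  have H0 : 0 < H := by linarith
  have b0 : 0 < b := by linarith
  have key : Y k * H ^ 6 * b ^ (6 * k + 36) ≤ (Y 0 * H ^ 6 * b ^ 36) ^ ((7 / 6 : ℝ) ^ k) := by
    induction k with
    | zero => simp
    | succ k ih =>
      have y := Y0 k
      have e1 : (H ^ 6) ^ (7 / 6 : ℝ) = H ^ 7 := by
        rw [← rpow_natCast, ← rpow_mul H0.le, ← rpow_natCast]; norm_num
      have e2 : (b ^ (6 * k + 36)) ^ (7 / 6 : ℝ) = b ^ (7 * k + 42) := by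
        rw [← rpow_natCast, ← rpow_mul b0.le, ← rpow_natCast]; congr 1; push_cast; ring
      calc Y (k + 1) * H ^ 6 * b ^ (6 * (k + 1) + 36)
          ≤ H * b ^ k * Y k ^ (7 / 6 : ℝ) * H ^ 6 * b ^ (6 * (k + 1) + 36) := by
            gcongr; exact h k
        _ = (Y k * H ^ 6 * b ^ (6 * k + 36)) ^ (7 / 6 : ℝ) := by
            rw [mul_rpow (by positivity) (by positivity), mul_rpow (by positivity) (by positivity),
              e1, e2]
            ring
        _ ≤ ((Y 0 * H ^ 6 * b ^ 36) ^ ((7 / 6 : ℝ) ^ k)) ^ (7 / 6 : ℝ) := by gcongr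
        _ = _ := by
            rw [← rpow_mul (by have := Y0 0; positivity), pow_succ (7 / 6 : ℝ) k]
  refine le_trans ?_ key
  have := Y0 k
  calc Y k = Y k * 1 * 1 := by ring
    _ ≤ _ := by
      gcongr
      · exact one_le_pow₀ hH
      · exact one_le_pow₀ hb

theorem gam_bound : ∃ C : ℝ, 1 ≤ C ∧ ∀ v P x, Sol v P → EnergyLe v x →
    ∀ z ∈ cy (1 / 4), 1 + gam v z ^ 2 ≤ C * (1 + x) ^ 4 := by
  obtain ⟨C, hC, hstep⟩ := moser_step
  obtain ⟨C', hC', hun⟩ := un_rpow_bound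
  obtain ⟨K, hK, hcut⟩ := exists_isCut
  set m := (volume : Measure (E3 × ℝ)).real (cy (9 / 16))
  have m0 : 0 ≤ m := measureReal_nonneg
  set L0 := K * (32 / 5) ^ 2
  have hL0 : 1 ≤ L0 := by simp only [L0]; nlinarith
  set D := 1 + 2 ^ (10 / 3 : ℝ) * (m + C')
  have hD : 1 ≤ D := by
    have : 0 < 2 ^ (10 / 3 : ℝ) * (m + C') := by positivity
    simp only [D]; linarith
  set Q := D ^ 4 * (C * L0 ^ 5) ^ 6 * (1024 : ℝ) ^ 36
  have hCL : 1 ≤ C * L0 ^ 5 := one_le_mul_of_one_le_of_one_le hC (one_le_pow₀ hL0)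
  have hQ : 1 ≤ Q := one_le_mul_of_one_le_of_one_le (one_le_mul_of_one_le_of_one_le
    (one_le_pow₀ hD) (one_le_pow₀ hCL)) (by norm_num)
  refine ⟨Q ^ (3 / 5 : ℝ), one_le_rpow hQ (by norm_num), fun v P x hs hx => ?_⟩
  have x0 := hx.nonneg
  have sG := sm_gam hs.smv
  have p : ∀ y : ℝ, 0 < 1 + y ^ 2 := fun y => by positivity
  have cu := cont_un hs.smv
  have cV : ∀ m : ℝ, Continuous fun z => (1 + gam v z ^ 2) ^ m := fun m =>
    (continuous_const.add (sG.cont.pow 2)).rpow_const fun z => Or.inl (p _).ne'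
  have V0 : ∀ (m : ℝ) z, 0 < (1 + gam v z ^ 2) ^ m := fun m z => rpow_pos_of_pos (p _) _
  have u1 : ∀ z, 0 ≤ 1 + un v z := fun z => by have := un_nonneg v z; linarith
  have c1u : Continuous fun z => (1 + un v z) ^ (10 / 3 : ℝ) :=
    (continuous_const.add cu).rpow_const fun _ => Or.inr (by norm_num)
  have cu10 : Continuous fun z => un v z ^ (10 / 3 : ℝ) :=
    cu.rpow_const fun _ => Or.inr (by norm_num)
  set W := ∫ z in cy (9 / 16), (1 + un v z) ^ (10 / 3 : ℝ)
  have W0 : 0 ≤ W := integral_nonneg fun z => rpow_nonneg (u1 z) _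
  have hW : 1 + W ≤ D * (1 + x) ^ (5 / 3 : ℝ) := by
    have h1 : W ≤ 2 ^ (10 / 3 : ℝ) * (m + C' * x ^ (5 / 3 : ℝ)) := by
      calc W ≤ ∫ z in cy (9 / 16), 2 ^ (10 / 3 : ℝ) * (1 + un v z ^ (10 / 3 : ℝ)) := by
            refine integral_mono (icy c1u _)
              (icy (continuous_const.mul (continuous_const.add cu10)) _) fun z => ?_
            have := add_sum_rpow_le (s := 10 / 3) (by norm_num) zero_le_one (un_nonneg v z)
            rwa [one_rpow] at this
        _ = 2 ^ (10 / 3 : ℝ) * (m + ∫ z in cy (9 / 16), un v z ^ (10 / 3 : ℝ)) := by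
            rw [integral_const_mul, integral_add (icy continuous_const _) (icy cu10 _),
              setIntegral_const, smul_eq_mul, mul_one]
        _ ≤ _ := by gcongr; exact hun v x hs.smv hx
    have h2 : x ^ (5 / 3 : ℝ) ≤ (1 + x) ^ (5 / 3 : ℝ) := by gcongr; linarith
    have h3 : 1 ≤ (1 + x) ^ (5 / 3 : ℝ) := one_le_rpow (by linarith) (by norm_num)
    calc 1 + W ≤ 1 * (1 + x) ^ (5 / 3 : ℝ) +
          2 ^ (10 / 3 : ℝ) * (m * (1 + x) ^ (5 / 3 : ℝ) + C' * (1 + x) ^ (5 / 3 : ℝ)) := by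
          refine add_le_add (by linarith) (h1.trans ?_)
          gcongr
          nlinarith
      _ = _ := by simp only [D]; ring
  set a : ℕ → ℝ := fun k => 1 / 4 + 5 / 16 * (1 / 2) ^ k
  have ha0 : a 0 = 9 / 16 := by simp only [a]; norm_num
  have hpow : ∀ k : ℕ, (1 / 2 : ℝ) ^ k ≤ 1 := fun k => pow_le_one₀ (by norm_num) (by norm_num)
  have ha : ∀ k, a k ≤ 9 / 16 := fun k => by
    have := hpow k
    simp only [a]; linarith
  have ha4 : ∀ k, 1 / 4 ≤ a k := fun k => by simp only [a]; linarith [pow_pos (by norm_num : (0 : ℝ) < 1 / 2) k]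
  have hdiff : ∀ k, a k - a (k + 1) = 5 / 32 * (1 / 2) ^ k := fun k => by
    simp only [a, pow_succ]; ring
  set Y : ℕ → ℝ := fun k => ∫ z in cy (a k), (1 + gam v z ^ 2) ^ (5 / 3 * (7 / 6 : ℝ) ^ k)
  have Y0 : ∀ k, 0 ≤ Y k := fun k => integral_nonneg fun z => (V0 _ z).le
  have hrec : ∀ k, Y (k + 1) ≤ (C * L0 ^ 5 * (1 + W) ^ (1 / 2 : ℝ)) * 1024 ^ k *
      Y k ^ (7 / 6 : ℝ) := by
    intro k
    have hLk : K / (a k - a (k + 1)) ^ 2 = L0 * 4 ^ k := by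
      rw [hdiff, mul_pow, ← pow_mul, mul_comm k 2, pow_mul]
      have : ((1 / 2 : ℝ) ^ 2) ^ k * 4 ^ k = 1 := by rw [← mul_pow]; norm_num
      simp only [L0]
      have q : (0 : ℝ) < ((1 / 2 : ℝ) ^ 2) ^ k := by positivity
      rw [div_eq_iff (by positivity)]
      linear_combination (-K) * this
    have h4 : (1 : ℝ) ≤ 4 ^ k := one_le_pow₀ (by norm_num)
    have hs1 := hstep v P hs ((7 / 6) ^ (k + 1)) (a k) (a (k + 1)) (L0 * 4 ^ k)
      (one_le_pow₀ (by norm_num)) (ha k) (by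
        have := hdiff k
        have : (0 : ℝ) < (1 / 2) ^ k := by positivity
        linarith) (one_le_mul_of_one_le_of_one_le hL0 h4) (by
        rw [← hLk]
        exact hcut (a k) (a (k + 1)) (by
          have := hdiff k
          have : (0 : ℝ) < (1 / 2) ^ k := by positivity
          linarith) ((ha k).trans (by norm_num)) (by have := ha4 (k + 1); linarith))
    refine hs1.trans ?_
    have hh := holder2 (μ := volume.restrict (cy (a k)))
      (f := fun z => (1 + gam v z ^ 2) ^ (5 / 3 * (7 / 6 : ℝ) ^ k))
      (g := fun z => (1 + un v z) ^ (10 / 3 : ℝ)) (icy (cV _) _) (icy c1u _)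
      (fun z => (V0 _ z).le) (fun z => rpow_nonneg (u1 z) _) (a := 7 / 10) (b := 3 / 10)
      (by norm_num) (by norm_num) (by norm_num)
    have e1 : ∀ z, ((1 + gam v z ^ 2) ^ (5 / 3 * (7 / 6 : ℝ) ^ k)) ^ (7 / 10 : ℝ) *
        ((1 + un v z) ^ (10 / 3 : ℝ)) ^ (3 / 10 : ℝ) =
        (1 + gam v z ^ 2) ^ ((7 / 6 : ℝ) ^ (k + 1)) * (1 + un v z) := fun z => by
      rw [← rpow_mul (p _).le, ← rpow_mul (u1 z)]
      norm_num
      left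
      congr 1
      rw [pow_succ]; ring
    simp only [e1] at hh
    have hWk : ∫ z in cy (a k), (1 + un v z) ^ (10 / 3 : ℝ) ≤ 1 + W := by
      have := setIntegral_mono_set (icy c1u (9 / 16)) (.of_forall fun z => rpow_nonneg (u1 z) _)
        (cy_mono (ha k)).eventuallyLE
      linarith
    have hWk0 : 0 ≤ ∫ z in cy (a k), (1 + un v z) ^ (10 / 3 : ℝ) :=
      integral_nonneg fun z => rpow_nonneg (u1 z) _
    have hI0 : 0 ≤ ∫ z in cy (a k), (1 + gam v z ^ 2) ^ ((7 / 6 : ℝ) ^ (k + 1)) * (1 + un v z) :=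
      integral_nonneg fun z => mul_nonneg (V0 _ z).le (u1 z)
    have y0 := Y0 k
    calc _ ≤ C * (L0 * 4 ^ k) ^ 5 * (Y k ^ (7 / 10 : ℝ) * (1 + W) ^ (3 / 10 : ℝ)) ^ (5 / 3 : ℝ) := by
          gcongr
          exact hh.trans (by gcongr)
      _ = C * L0 ^ 5 * (1024 : ℝ) ^ k * (Y k ^ (7 / 6 : ℝ) * (1 + W) ^ (1 / 2 : ℝ)) := by
          rw [mul_rpow (by positivity) (by positivity), ← rpow_mul y0, ← rpow_mul (by positivity),
            mul_pow, ← pow_mul, mul_comm k 5, pow_mul,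
            show (7 / 10 * (5 / 3) : ℝ) = 7 / 6 by norm_num,
            show (3 / 10 * (5 / 3) : ℝ) = 1 / 2 by norm_num, show (4 : ℝ) ^ 5 = 1024 by norm_num]
          ring
      _ = _ := by ring
  have hW1 : 1 ≤ (1 + W) ^ (1 / 2 : ℝ) := one_le_rpow (by linarith) (by norm_num)
  have hit := rpow_iterate_le Y0 (one_le_mul_of_one_le_of_one_le hCL hW1) (by norm_num) hrec
  have hY0 : Y 0 ≤ W := by
    simp only [Y, pow_zero, mul_one, ha0]
    refine setIntegral_mono_on (icy (cV _) _) (icy c1u _) (meas_cy _) fun z hz => ?_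
    have r1 : z.1 0 ^ 2 + z.1 1 ^ 2 ≤ 1 := by
      have := hz.1
      rw [EuclideanSpace.norm_sq_eq, Fin.sum_univ_three] at this
      simp only [Real.norm_eq_abs, sq_abs] at this
      nlinarith [sq_nonneg (z.1 2)]
    have g1 : gam v z ^ 2 ≤ usq v z := (gam_sq_le v z).trans (by nlinarith [usq_nonneg v z])
    rw [← un_sq] at g1
    have n0 := un_nonneg v z
    calc (1 + gam v z ^ 2) ^ (5 / 3 : ℝ) ≤ ((1 + un v z) ^ 2) ^ (5 / 3 : ℝ) := by
          gcongr; nlinarith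
      _ = _ := by
          rw [← rpow_natCast, ← rpow_mul (u1 z)]; norm_num
  set Z := Y 0 * (C * L0 ^ 5 * (1 + W) ^ (1 / 2 : ℝ)) ^ 6 * 1024 ^ 36
  have Z0 : 0 ≤ Z := by have := Y0 0; positivity
  intro z hz
  have hfin := le_of_integral_rpow_le (V := fun z => 1 + gam v z ^ 2) (A := 1 / 4)
    (s := fun k => 5 / 3 * (7 / 6 : ℝ) ^ k) (lam := Z ^ (3 / 5 : ℝ))
    (continuous_const.add (sG.cont.pow 2)) (fun z => (p _).le)
    ((tendsto_pow_atTop_atTop_of_one_lt (by norm_num)).const_mul_atTop (by norm_num))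
    (by positivity) (fun k => by positivity) (fun k => by
      rw [← rpow_mul Z0, show 3 / 5 * (5 / 3 * (7 / 6 : ℝ) ^ k) = (7 / 6 : ℝ) ^ k by ring]
      refine le_trans ?_ (hit k)
      exact setIntegral_mono_set (icy (cV _) _) (.of_forall fun z => (V0 _ z).le)
        (cy_mono (ha4 k)).eventuallyLE) hz
  refine hfin.trans ?_
  have hZ : Z ≤ Q * (1 + x) ^ (20 / 3 : ℝ) := by
    have y0 := Y0 0
    calc Z ≤ (1 + W) * (C * L0 ^ 5 * (1 + W) ^ (1 / 2 : ℝ)) ^ 6 * 1024 ^ 36 := by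
          simp only [Z]; gcongr; linarith
      _ = (1 + W) ^ 4 * (C * L0 ^ 5) ^ 6 * 1024 ^ 36 := by
          rw [mul_pow, ← rpow_mul_natCast (by positivity)]
          norm_num
          ring
      _ ≤ (D * (1 + x) ^ (5 / 3 : ℝ)) ^ 4 * (C * L0 ^ 5) ^ 6 * 1024 ^ 36 := by gcongr
      _ = _ := by
          rw [mul_pow, ← rpow_mul_natCast (by positivity)]
          simp only [Q]
          norm_num
          ring
  calc Z ^ (3 / 5 : ℝ) ≤ (Q * (1 + x) ^ (20 / 3 : ℝ)) ^ (3 / 5 : ℝ) := by gcongr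
    _ = Q ^ (3 / 5 : ℝ) * (1 + x) ^ 4 := by
        rw [mul_rpow (by positivity) (by positivity), ← rpow_mul (by positivity), ← rpow_natCast]
        norm_num

/-- The pressure Poisson equation. -/
theorem Sol.poisson {v : Fin 3 → E3 × ℝ → ℝ} {P : E3 × ℝ → ℝ} (hs : Sol v P) {z : E3 × ℝ}
    (h1 : ‖z.1‖ < 1) (h2 : -1 < z.2) (h3 : z.2 < 0) :
    ∑ j, dX j (dX j P) z = -∑ j, ∑ i, dX j (dX i (fun z => v i z * v j z)) z := by
  have sv := hs.smv
  have sF : ∀ i j, Sm (fun z => v i z * v j z) := fun i j => (sv i).mul (sv j)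
  have nb : ∀ᶠ w : E3 × ℝ in nhds z, ‖w.1‖ < 1 ∧ -1 < w.2 ∧ w.2 < 0 := by
    have o1 : IsOpen {w : E3 × ℝ | ‖w.1‖ < 1} := isOpen_lt (by fun_prop) (by fun_prop)
    have o2 : IsOpen {w : E3 × ℝ | -1 < w.2} := isOpen_lt (by fun_prop) (by fun_prop)
    have o3 : IsOpen {w : E3 × ℝ | w.2 < 0} := isOpen_lt (by fun_prop) (by fun_prop)
    filter_upwards [o1.mem_nhds h1, o2.mem_nhds h2, o3.mem_nhds h3] with w a b c using ⟨a, b, c⟩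
  have dv : ∀ i, ∑ j, dX i (dX j (v j)) z = 0 := by
    intro i
    rw [← dX_sum fun j => (sv j).dX j, dX_congr (g := fun _ => 0), dX_const]
    filter_upwards [nb] with w hw using hs.div w hw.1 hw.2.1 hw.2.2
  have dvT : ∑ j, dX j (dT (v j)) z = 0 := by
    simp only [dX_dT_comm (sv _)]
    rw [← dT_sum fun j => (sv j).dX j, dT_congr (g := fun _ => 0), dT_const]
    filter_upwards [nb] with w hw using hs.div w hw.1 hw.2.1 hw.2.2
  have dvL : ∀ i, ∑ j, dX j (dX i (dX i (v j))) z = 0 := by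
    intro i
    have e1 : ∀ j, dX j (dX i (dX i (v j))) z = dX i (dX i (dX j (v j))) z := fun j => by
      rw [dX_comm ((sv j).dX i), show dX j (dX i (v j)) = dX i (dX j (v j)) from
        funext fun w => dX_comm (sv j) j i w]
    simp only [e1]
    rw [← dX_sum fun j => ((sv j).dX j).dX i, dX_congr (g := fun _ => 0), dX_const]
    filter_upwards [nb.eventually_nhds] with w hw
    rw [← dX_sum fun j => (sv j).dX j, dX_congr (g := fun _ => 0), dX_const]
    filter_upwards [hw] with w hw using hs.div w hw.1 hw.2.1 hw.2.2
  have key : ∀ j, dX j (fun w => (dT (v j) w + ∑ i, dX i (fun z => v i z * v j z) w)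
      - ∑ i, dX i (dX i (v j)) w + dX j P w) z = 0 := by
    intro j
    rw [dX_congr (g := fun _ => 0), dX_const]
    filter_upwards [nb] with w hw
    have m := hs.mom w hw.1 hw.2.1 hw.2.2 j
    have d := hs.div w hw.1 hw.2.1 hw.2.2
    simp only [dX_mul (sv _) (sv _), Finset.sum_add_distrib, ← Finset.sum_mul, d]
    linarith
  have ex : ∀ j, dX j (dT (v j)) z + ∑ i, dX j (dX i (fun z => v i z * v j z)) z
      - ∑ i, dX j (dX i (dX i (v j))) z + dX j (dX j P) z = 0 := by
    intro j
    rw [← key j]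
    have a1 : Sm fun w => ∑ i, dX i (fun z => v i z * v j z) w :=
      ContDiff.sum fun i _ => (sF i j).dX i
    have a2 : Sm fun w => ∑ i, dX i (dX i (v j)) w := ContDiff.sum fun i _ => ((sv j).dX i).dX i
    have a3 : Sm fun w => dT (v j) w + ∑ i, dX i (fun z => v i z * v j z) w := (sv j).dT.add a1
    have a4 : Sm fun w => (dT (v j) w + ∑ i, dX i (fun z => v i z * v j z) w)
      - ∑ i, dX i (dX i (v j)) w := a3.sub a2
    rw [dX_add a4 (hs.smP.dX j), dX_sub a3 a2, dX_add (sv j).dT a1,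
      dX_sum fun i => (sF i j).dX i, dX_sum fun i => ((sv j).dX i).dX i]
  have tot := Finset.sum_eq_zero (s := Finset.univ) fun j _ => ex j
  simp only [Finset.sum_add_distrib, Finset.sum_sub_distrib] at tot
  rw [dvT, Finset.sum_comm (f := fun j i => dX j (dX i (dX i (v j))) z)] at tot
  simp only [dvL, Finset.sum_const_zero] at tot
  linarith

/-- A radial bump function `Ψ` whose gradient is `-y η(y)` with `η ≥ 0`. -/
theorem exists_kernel : ∃ (Ψ η : E3 × ℝ → ℝ) (c M : ℝ), Sm Ψ ∧ Sm η ∧ 0 < c ∧ 0 < M ∧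
    (∀ z : E3 × ℝ, 3 / 4 ≤ ‖z.1‖ → Ψ z = 0) ∧ (∀ z : E3 × ℝ, 3 / 4 ≤ ‖z.1‖ → η z = 0) ∧
    (∀ i z, dX i Ψ z = -(z.1 i * η z)) ∧ ∫ y in Metric.ball 0 1, η (y, 0) = c ∧
    (∀ y, |η (y, 0)| ≤ M) ∧ ∀ i j y, |dX i (dX j Ψ) (y, 0)| ≤ M := by
  have hf : ContDiff ℝ (⊤ : ℕ∞) expNegInvGlue := expNegInvGlue.contDiff
  have hf' : ContDiff ℝ (⊤ : ℕ∞) (deriv expNegInvGlue) :=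
    ((contDiff_succ_iff_deriv (n := ((⊤ : ℕ∞) : WithTop ℕ∞))).1 (by simpa using hf)).2.2
  have hl : Sm fun z => 1 / 2 - nsq z := contDiff_const.sub sm_nsq
  have hd : ∀ y, HasDerivAt expNegInvGlue (deriv expNegInvGlue y) y := fun y =>
    ((hf.differentiable (by simp)) y).hasDerivAt
  have n0 : ∀ z : E3 × ℝ, 3 / 4 ≤ ‖z.1‖ → 1 / 2 - nsq z < 0 := by
    intro z hz; rw [nsq_eq]; nlinarith
  have dz : ∀ y, y < 0 → deriv expNegInvGlue y = 0 := by
    intro y hy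
    have : expNegInvGlue =ᶠ[nhds y] fun _ => 0 := by
      filter_upwards [Iio_mem_nhds hy] with w hw using expNegInvGlue.zero_of_nonpos (le_of_lt hw)
    rw [this.deriv_eq, deriv_const]
  set Ψ : E3 × ℝ → ℝ := fun z => expNegInvGlue (1 / 2 - nsq z)
  set η : E3 × ℝ → ℝ := fun z => 2 * deriv expNegInvGlue (1 / 2 - nsq z)
  have sΨ : Sm Ψ := hf.comp hl
  have sη : Sm η := contDiff_const.mul (hf'.comp hl)
  have zΨ : ∀ z : E3 × ℝ, 3 / 4 ≤ ‖z.1‖ → Ψ z = 0 := fun z hz =>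
    expNegInvGlue.zero_of_nonpos (n0 z hz).le
  have zη : ∀ z : E3 × ℝ, 3 / 4 ≤ ‖z.1‖ → η z = 0 := fun z hz => by
    simp only [η, dz _ (n0 z hz), mul_zero]
  have η0 : ∀ z, 0 ≤ η z := fun z => by
    have := expNegInvGlue.monotone.deriv_nonneg (x := 1 / 2 - nsq z)
    positivity
  have eX : ∀ i z, dX i Ψ z = -(z.1 i * η z) := by
    intro i z
    rw [dX_comp hl i z (hd _), dX_sub contDiff_const sm_nsq, dX_const, dX_nsq]
    simp only [η]; ring
  have ηc : Continuous fun y : E3 => η (y, 0) := slice_cont sη.cont 0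
  have ηs : HasCompactSupport fun y : E3 => η (y, 0) := hcs_of_ball fun x hx => zη (x, 0) hx
  obtain ⟨s, hs, hse⟩ := exists_deriv_eq_slope expNegInvGlue (show (0 : ℝ) < 1 / 2 by norm_num)
    hf.continuous.continuousOn (hf.differentiable (by simp)).differentiableOn
  have hsp : 0 < deriv expNegInvGlue s := by
    rw [hse, expNegInvGlue.zero]
    have := expNegInvGlue.pos_of_pos (show (0 : ℝ) < 1 / 2 by norm_num)
    rw [sub_zero, sub_zero]; positivity
  have hne : ∃ y : E3, η (y, 0) ≠ 0 := by
    refine ⟨Real.sqrt (1 / 2 - s) • ee 0, ?_⟩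
    have : nsq (Real.sqrt (1 / 2 - s) • ee 0, 0) = 1 / 2 - s := by
      rw [nsq_eq]
      simp only [norm_smul, ee, PiLp.norm_single]
      rw [norm_one, mul_one, norm_eq_abs, sq_abs, Real.sq_sqrt]
      linarith [hs.2]
    simp only [η, this, sub_sub_cancel]
    positivity
  obtain ⟨y0, hy0⟩ := hne
  have pos := ηc.integral_pos_of_hasCompactSupport_nonneg_nonzero (μ := volume) ηs
    (fun y => η0 (y, 0)) hy0
  have ei : ∫ y in Metric.ball 0 1, η (y, 0) = ∫ y, η (y, 0) := by
    apply setIntegral_eq_integral_of_forall_compl_eq_zero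
    intro y hy
    simp at hy
    exact zη _ (by simp only; linarith)
  obtain ⟨M0, hM0⟩ := ηs.exists_bound_of_continuous ηc
  have zD : ∀ i j (y : E3), 4 / 5 ≤ ‖y‖ → dX i (dX j Ψ) (y, 0) = 0 := by
    intro i j y hy
    have ev : ∀ᶠ z : E3 × ℝ in nhds (y, 0), 3 / 4 < ‖z.1‖ :=
      (isOpen_lt continuous_const (by fun_prop)).mem_nhds
        (show (3 / 4 : ℝ) < ‖y‖ by linarith)
    rw [dX_congr (g := fun _ => 0), dX_const]
    filter_upwards [ev] with z hz
    rw [eX, zη _ hz.le, mul_zero, neg_zero]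
  have bD : ∀ i j, ∃ B, ∀ y, |dX i (dX j Ψ) (y, 0)| ≤ B := fun i j =>
    (hcs_of_ball (zD i j)).exists_bound_of_continuous (slice_cont ((sΨ.dX j).dX i).cont 0)
  choose B hB using bD
  have hB0 : ∀ i j, 0 ≤ B i j := fun i j => (abs_nonneg _).trans (hB i j 0)
  have hM00 : 0 ≤ M0 := (norm_nonneg _).trans (hM0 0)
  refine ⟨Ψ, η, _, 1 + M0 + ∑ i, ∑ j, B i j, sΨ, sη, pos, ?_, zΨ, zη, eX, ei, ?_, ?_⟩
  · have := Finset.sum_nonneg fun i (_ : i ∈ Finset.univ) =>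
      Finset.sum_nonneg fun j (_ : j ∈ Finset.univ) => hB0 i j
    linarith
  · intro y
    have := Finset.sum_nonneg fun i (_ : i ∈ Finset.univ) =>
      Finset.sum_nonneg fun j (_ : j ∈ Finset.univ) => hB0 i j
    have h := hM0 y
    rw [norm_eq_abs] at h
    linarith
  · intro i j y
    have h1 := Finset.single_le_sum (f := fun i => ∑ j, B i j) (fun i _ =>
      Finset.sum_nonneg fun j (_ : j ∈ Finset.univ) => hB0 i j) (Finset.mem_univ i)
    have h2 := Finset.single_le_sum (f := fun j => B i j) (fun j _ => hB0 i j) (Finset.mem_univ j)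
    have h3 := hB i j y
    linarith

/-- Translation and dilation in the space variable. -/
def shift (x : E3) (t ρ : ℝ) (g : E3 × ℝ → ℝ) (z : E3 × ℝ) : ℝ := g (x + ρ • z.1, t)

theorem sm_shift {g : E3 × ℝ → ℝ} (hg : Sm g) (x : E3) (t ρ : ℝ) : Sm (shift x t ρ g) := by
  have : ContDiff ℝ (⊤ : ℕ∞) fun z : E3 × ℝ => (x + ρ • z.1, t) := by fun_prop
  exact hg.comp this

theorem dX_shift {g : E3 × ℝ → ℝ} (hg : Sm g) (x : E3) (t ρ : ℝ) (i : Fin 3) (z : E3 × ℝ) :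
    dX i (shift x t ρ g) z = ρ * dX i g (x + ρ • z.1, t) := by
  have h : HasFDerivAt (fun z : E3 × ℝ => (x + ρ • z.1, t))
      ((ρ • ContinuousLinearMap.fst ℝ E3 ℝ).prod 0) z :=
    (((hasFDerivAt_fst (p := z)).const_smul ρ).const_add x).prodMk (hasFDerivAt_const t z)
  have := ((hg.diff (x + ρ • z.1, t)).hasFDerivAt.comp z h).fderiv
  change fderiv ℝ (g ∘ _) z _ = _
  rw [this]
  simp only [ContinuousLinearMap.comp_apply, ContinuousLinearMap.prod_apply,
    smul_apply, ContinuousLinearMap.coe_fst', zero_apply, dX]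
  rw [show (ρ • ee i, (0 : ℝ)) = ρ • (ee i, (0 : ℝ)) by simp, map_smul, smul_eq_mul]

/-- Integration by parts against a compactly supported kernel. -/
theorem shift_ibp {g Φ : E3 × ℝ → ℝ} (hg : Sm g) (hΦ : Sm Φ)
    (h0 : ∀ z : E3 × ℝ, 3 / 4 ≤ ‖z.1‖ → Φ z = 0) (x : E3) (t ρ : ℝ) (i : Fin 3) :
    ∫ y in Metric.ball (0 : E3) 1, g (x + ρ • y, t) * dX i Φ (y, 0) =
      -(ρ * ∫ y in Metric.ball (0 : E3) 1, dX i g (x + ρ • y, t) * Φ (y, 0)) := by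
  have sW := (sm_shift hg x t ρ).mul hΦ
  have z := int_dX_zero sW 0 (ρ := 3 / 4) (fun y hy => by
    rw [h0 (y, 0) hy, mul_zero]) i
  have e : ∫ y in Metric.ball (0 : E3) 1, dX i (fun z => shift x t ρ g z * Φ z) (y, 0) = 0 := by
    rw [setIntegral_eq_integral_of_forall_compl_eq_zero]
    · exact z
    intro y hy
    simp at hy
    have ev : ∀ᶠ z : E3 × ℝ in nhds (y, 0), 3 / 4 < ‖z.1‖ :=
      (isOpen_lt continuous_const (by fun_prop)).mem_nhds
        (show (3 / 4 : ℝ) < ‖y‖ by linarith)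
    rw [dX_congr (g := fun _ => 0), dX_const]
    filter_upwards [ev] with z hz
    rw [h0 _ hz.le, mul_zero]
  simp only [dX_mul (sm_shift hg x t ρ) hΦ, dX_shift hg] at e
  have c1 : Continuous fun y : E3 => dX i g (x + ρ • y, t) * Φ (y, 0) :=
    ((hg.dX i).cont.comp (by fun_prop)).mul (slice_cont hΦ.cont 0)
  have c2 : Continuous fun y : E3 => g (x + ρ • y, t) * dX i Φ (y, 0) :=
    (hg.cont.comp (by fun_prop)).mul (slice_cont (hΦ.dX i).cont 0)
  have := integral_add (ion (μ := volume) (c1.const_mul ρ) (Metric.isBounded_ball (x := 0) (r := 1)))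
    (ion (μ := volume) c2 (Metric.isBounded_ball (x := 0) (r := 1)))
  rw [integral_const_mul] at this
  simp only [shift, mul_assoc] at e
  rw [e] at this
  linarith

/-- Modulus of the velocity increment `v(x + ρ y, t) - v(x, t)`. -/
def incr (v : Fin 3 → E3 × ℝ → ℝ) (y : E3) (ρ : ℝ) (z : E3 × ℝ) : ℝ :=
  Real.sqrt (∑ j, (v j (z.1 + ρ • y, z.2) - v j z) ^ 2)

/-- Sum of the velocity moduli at `x` and `x + ρ y`. -/
def unsum (v : Fin 3 → E3 × ℝ → ℝ) (y : E3) (ρ : ℝ) (z : E3 × ℝ) : ℝ :=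
  un v z + un v (z.1 + ρ • y, z.2)

section
variable {v : Fin 3 → E3 × ℝ → ℝ} {P : E3 × ℝ → ℝ}

theorem cont_incr (hv : ∀ j, Sm (v j)) :
    Continuous fun p : (E3 × ℝ) × (E3 × ℝ) => incr v p.2.1 p.2.2 p.1 :=
  Real.continuous_sqrt.comp (continuous_finsetSum _ fun j _ =>
    (((hv j).cont.comp (by fun_prop)).sub ((hv j).cont.comp (by fun_prop))).pow 2)

theorem cont_unsum (hv : ∀ j, Sm (v j)) :
    Continuous fun p : (E3 × ℝ) × (E3 × ℝ) => unsum v p.2.1 p.2.2 p.1 :=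
  ((cont_un hv).comp (by fun_prop)).add ((cont_un hv).comp (by fun_prop))

theorem incr_nonneg (v : Fin 3 → E3 × ℝ → ℝ) (y ρ z) : 0 ≤ incr v y ρ z := Real.sqrt_nonneg _
theorem unsum_nonneg (v : Fin 3 → E3 × ℝ → ℝ) (y ρ z) : 0 ≤ unsum v y ρ z :=
  add_nonneg (un_nonneg _ _) (un_nonneg _ _)

theorem abs_sub_le_incr (v : Fin 3 → E3 × ℝ → ℝ) (y ρ z) (j) :
    |v j (z.1 + ρ • y, z.2) - v j z| ≤ incr v y ρ z := by
  rw [← Real.sqrt_sq_eq_abs]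
  exact Real.sqrt_le_sqrt (Finset.single_le_sum
    (f := fun j => (v j (z.1 + ρ • y, z.2) - v j z) ^ 2) (fun _ _ => sq_nonneg _)
    (Finset.mem_univ j))

theorem incr_le_unsum (v : Fin 3 → E3 × ℝ → ℝ) (y ρ z) : incr v y ρ z ≤ unsum v y ρ z := by
  set w : E3 × ℝ := (z.1 + ρ • y, z.2)
  have h1 := un_nonneg v z
  have h2 := un_nonneg v w
  rw [incr, Real.sqrt_le_left (unsum_nonneg _ _ _ _)]
  have e1 := un_sq v z
  have e2 := un_sq v w
  have cs : -(∑ j, v j w * v j z) ≤ un v z * un v w := by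
    have := Finset.sum_mul_sq_le_sq_mul_sq (Finset.univ) (fun j => v j w) (fun j => v j z)
    have h : (∑ j, v j w * v j z) ^ 2 ≤ (un v z * un v w) ^ 2 := by
      rw [mul_pow, e1, e2, mul_comm]; exact this
    have := (abs_le.1 (abs_le_of_sq_le_sq h (by positivity))).1
    linarith
  have : ∑ j, (v j w - v j z) ^ 2 = usq v w + usq v z - 2 * ∑ j, v j w * v j z := by
    simp only [usq, Finset.mul_sum, ← Finset.sum_add_distrib, ← Finset.sum_sub_distrib]
    exact Finset.sum_congr rfl fun j _ => by ring
  rw [this, unsum]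
  nlinarith

theorem abs_prod_sub_le (v : Fin 3 → E3 × ℝ → ℝ) (y ρ z) (i j) :
    |v i (z.1 + ρ • y, z.2) * v j (z.1 + ρ • y, z.2) - v i z * v j z| ≤
      unsum v y ρ z * incr v y ρ z := by
  set w : E3 × ℝ := (z.1 + ρ • y, z.2) with hw
  have e : v i w * v j w - v i z * v j z =
      v i w * (v j w - v j z) + (v i w - v i z) * v j z := by ring
  rw [e]
  refine (abs_add_le _ _).trans ?_
  rw [abs_mul, abs_mul]
  have a1 := abs_le_un v w i
  have a2 := abs_le_un v z j
  have a3 := abs_sub_le_incr v y ρ z i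
  have a4 := abs_sub_le_incr v y ρ z j
  have b1 := mul_le_mul a1 a4 (abs_nonneg _) (un_nonneg _ _)
  have b2 := mul_le_mul a3 a2 (abs_nonneg _) (incr_nonneg _ _ _ _)
  rw [unsum, ← hw]
  rw [← hw] at b1 b2
  linarith

theorem ball_shift {x y : E3} {ρ : ℝ} {a b : ℝ} (hx : ‖x‖ < a) (hy : ‖y‖ < 1) (h0 : 0 ≤ ρ)
    (hρ : ρ ≤ b) : ‖x + ρ • y‖ < a + b := by
  have := norm_add_le x (ρ • y)
  rw [norm_smul, norm_eq_abs, abs_of_nonneg h0] at this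
  nlinarith [norm_nonneg y]

set_option maxHeartbeats 600000 in
theorem pressure_slope (hs : Sol v P) {Ψ η : E3 × ℝ → ℝ} {M : ℝ} (sΨ : Sm Ψ)
    (zΨ : ∀ z : E3 × ℝ, 3 / 4 ≤ ‖z.1‖ → Ψ z = 0)
    (zη : ∀ z : E3 × ℝ, 3 / 4 ≤ ‖z.1‖ → η z = 0)
    (eX : ∀ i z, dX i Ψ z = -(z.1 i * η z))
    (bD : ∀ i j y, |dX i (dX j Ψ) (y, 0)| ≤ M) {x : E3} {t ρ : ℝ} (hx : ‖x‖ < 1 / 4)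
    (ht : -1 < t) (ht' : t < 0) (hρ : 0 < ρ) (hρ' : ρ ≤ 1 / 4) :
    |∫ y in Metric.ball (0 : E3) 1, η (y, 0) * ∑ i, y i * dX i P (x + ρ • y, t)| ≤
      9 * M * (ρ⁻¹ * ∫ y in Metric.ball (0 : E3) 1, unsum v y ρ (x, t) * incr v y ρ (x, t)) := by
  have sv := hs.smv
  have sP := hs.smP
  have bb : Bornology.IsBounded (Metric.ball (0 : E3) 1) := Metric.isBounded_ball
  have sF : ∀ i j, Sm (fun z => v i z * v j z) := fun i j => (sv i).mul (sv j)
  have zΨ' : ∀ i, ∀ z : E3 × ℝ, 3 / 4 ≤ ‖z.1‖ → dX i Ψ z = 0 := fun i z hz => by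
    rw [eX, zη z hz, mul_zero, neg_zero]
  have sl : ∀ {g : E3 × ℝ → ℝ}, Continuous g → Continuous fun y : E3 => g (x + ρ • y, t) :=
    fun hg => hg.comp (by fun_prop)
  have sk : ∀ {g : E3 × ℝ → ℝ}, Continuous g → Continuous fun y : E3 => g (y, 0) :=
    fun hg => slice_cont hg 0
  have s1 : ∫ y in Metric.ball (0 : E3) 1, η (y, 0) * ∑ i, y i * dX i P (x + ρ • y, t) =
      -∑ i, ∫ y in Metric.ball (0 : E3) 1, dX i P (x + ρ • y, t) * dX i Ψ (y, 0) := by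
    have ic : ∀ i, IntegrableOn (fun y : E3 => dX i P (x + ρ • y, t) * dX i Ψ (y, 0))
      (Metric.ball 0 1) := fun i => ion ((sl (sP.dX i).cont).mul (sk (sΨ.dX i).cont)) bb
    rw [← integral_finsetSum _ fun i _ => ic i, ← integral_neg]
    congr 1; funext y
    rw [Finset.mul_sum, ← Finset.sum_neg_distrib]
    refine Finset.sum_congr rfl fun i _ => ?_
    rw [eX]; ring
  have s2 : ∀ i, ∫ y in Metric.ball (0 : E3) 1, dX i P (x + ρ • y, t) * dX i Ψ (y, 0) =
      -(ρ * ∫ y in Metric.ball (0 : E3) 1, dX i (dX i P) (x + ρ • y, t) * Ψ (y, 0)) := fun i =>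
    shift_ibp (sP.dX i) sΨ zΨ x t ρ i
  have s3 : ∑ i, ∫ y in Metric.ball (0 : E3) 1, dX i (dX i P) (x + ρ • y, t) * Ψ (y, 0) =
      -∑ j, ∑ i, ∫ y in Metric.ball (0 : E3) 1,
        dX j (dX i (fun z => v i z * v j z)) (x + ρ • y, t) * Ψ (y, 0) := by
    have ic : ∀ i j, IntegrableOn (fun y : E3 =>
        dX j (dX i (fun z => v i z * v j z)) (x + ρ • y, t) * Ψ (y, 0)) (Metric.ball 0 1) :=
      fun i j => ion ((sl (((sF i j).dX i).dX j).cont).mul (sk sΨ.cont)) bb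
    have ic' : ∀ i, IntegrableOn (fun y : E3 => dX i (dX i P) (x + ρ • y, t) * Ψ (y, 0))
      (Metric.ball 0 1) := fun i => ion ((sl ((sP.dX i).dX i).cont).mul (sk sΨ.cont)) bb
    simp only [← integral_finsetSum _ fun i _ => ic i _]
    rw [← integral_finsetSum _ fun j _ => integrable_finsetSum _ fun i _ => ic i j,
      ← integral_finsetSum _ fun i _ => ic' i,
      ← integral_neg]
    refine setIntegral_congr_fun measurableSet_ball fun y hy => ?_
    have hy' : ‖y‖ < 1 := by simpa using hy
    have hX := ball_shift hx hy' hρ.le hρ'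
    have := hs.poisson (z := (x + ρ • y, t)) (by simp only; linarith) ht ht'
    simp only [← Finset.sum_mul]
    rw [this, neg_mul]
  have s4 : ∀ j i, ∫ y in Metric.ball (0 : E3) 1, dX i (fun z => v i z * v j z) (x + ρ • y, t)
      * dX j Ψ (y, 0) = -(ρ * ∫ y in Metric.ball (0 : E3) 1,
        dX j (dX i (fun z => v i z * v j z)) (x + ρ • y, t) * Ψ (y, 0)) := fun j i =>
    shift_ibp ((sF i j).dX i) sΨ zΨ x t ρ j
  have s5 : ∀ j i, ∫ y in Metric.ball (0 : E3) 1, (v i (x + ρ • y, t) * v j (x + ρ • y, t)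
      - v i (x, t) * v j (x, t)) * dX i (dX j Ψ) (y, 0) = -(ρ * ∫ y in Metric.ball (0 : E3) 1,
        dX i (fun z => v i z * v j z) (x + ρ • y, t) * dX j Ψ (y, 0)) := by
    intro j i
    have := shift_ibp ((sF i j).sub (contDiff_const (c := v i (x, t) * v j (x, t)))) (sΨ.dX j)
      (zΨ' j) x t ρ i
    simp only [dX_sub (sF i j) (contDiff_const (c := v i (x, t) * v j (x, t))), dX_const,
      sub_zero] at this
    exact this
  have s6 : ∀ j i, |∫ y in Metric.ball (0 : E3) 1, (v i (x + ρ • y, t) * v j (x + ρ • y, t)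
      - v i (x, t) * v j (x, t)) * dX i (dX j Ψ) (y, 0)| ≤
      M * ∫ y in Metric.ball (0 : E3) 1, unsum v y ρ (x, t) * incr v y ρ (x, t) := by
    intro j i
    have cS : Continuous fun y : E3 => unsum v y ρ (x, t) * incr v y ρ (x, t) :=
      ((cont_unsum sv).comp (by fun_prop : Continuous fun y : E3 => ((x, t), (y, ρ)))).mul
        ((cont_incr sv).comp (by fun_prop : Continuous fun y : E3 => ((x, t), (y, ρ))))
    rw [← integral_const_mul, ← norm_eq_abs]
    refine norm_integral_le_of_norm_le (ion (cS.const_mul M) bb)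
      (Filter.Eventually.of_forall fun y => ?_)
    rw [norm_mul, norm_eq_abs, norm_eq_abs, mul_comm M]
    refine mul_le_mul ?_ (bD i j y) (abs_nonneg _)
      (mul_nonneg (unsum_nonneg _ _ _ _) (incr_nonneg _ _ _ _))
    exact abs_prod_sub_le v y ρ (x, t) i j
  set I := ∫ y in Metric.ball (0 : E3) 1, unsum v y ρ (x, t) * incr v y ρ (x, t)
  set Lh := ∫ y in Metric.ball (0 : E3) 1, η (y, 0) * ∑ i, y i * dX i P (x + ρ • y, t)
  have tot : ρ * Lh = -∑ j, ∑ i, ∫ y in Metric.ball (0 : E3) 1,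
      (v i (x + ρ • y, t) * v j (x + ρ • y, t)
      - v i (x, t) * v j (x, t)) * dX i (dX j Ψ) (y, 0) := by
    simp only [s5, s4]
    rw [s1]
    simp only [s2, Finset.sum_neg_distrib, ← Finset.mul_sum, s3]
    ring
  have b9 : |ρ * Lh| ≤ 9 * (M * I) := by
    rw [tot, abs_neg]
    have := abs_sum3_le fun j => abs_sum3_le (s6 j)
    linarith
  rw [abs_mul, abs_of_pos hρ] at b9
  rw [show 9 * M * (ρ⁻¹ * I) = (9 * (M * I)) / ρ by ring, le_div_iff₀ hρ]
  linarith
end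

theorem cont_kernel {X : Type*} [TopologicalSpace X] {v : Fin 3 → E3 × ℝ → ℝ}
    (hv : ∀ j, Sm (v j)) {z : X → E3 × ℝ} {y : X → E3} {ρ : X → ℝ} (hz : Continuous z)
    (hy : Continuous y) (hρ : Continuous ρ) :
    (Continuous fun a => unsum v (y a) (ρ a) (z a)) ∧
      Continuous fun a => incr v (y a) (ρ a) (z a) := by
  have hw : Continuous fun a => ((z a).1 + ρ a • y a, (z a).2) := by fun_prop
  refine ⟨((cont_un hv).comp hz).add ((cont_un hv).comp hw), ?_⟩
  exact Real.continuous_sqrt.comp (continuous_finsetSum _ fun j _ =>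
    (((hv j).cont.comp hw).sub ((hv j).cont.comp hz)).pow 2)

theorem hasDerivAt_line {g : E3 × ℝ → ℝ} (hg : Sm g) (x y : E3) (t ρ : ℝ) :
    HasDerivAt (fun ρ : ℝ => g (x + ρ • y, t)) (∑ i, y i * dX i g (x + ρ • y, t)) ρ := by
  have h1 : HasDerivAt (fun ρ : ℝ => (x + ρ • y, t)) ((1 : ℝ) • y, (0 : ℝ)) ρ :=
    (((hasDerivAt_id ρ).smul_const y).const_add x).prodMk (hasDerivAt_const ρ t)
  have h := (hg.diff (x + ρ • y, t)).hasFDerivAt.comp_hasDerivAt ρ h1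
  refine HasDerivAt.congr_deriv (f := fun ρ : ℝ => g (x + ρ • y, t)) h ?_
  have e : ((1 : ℝ) • y, (0 : ℝ)) = ∑ i, y i • (ee i, (0 : ℝ)) := by
    refine Prod.ext ?_ ?_
    · rw [one_smul, Prod.fst_sum]
      conv_lhs => rw [← (EuclideanSpace.basisFun (Fin 3) ℝ).sum_repr y]
      simp [ee]
    · rw [Prod.snd_sum]; simp
  rw [e, map_sum]
  refine Finset.sum_congr rfl fun i _ => ?_
  rw [map_smul, smul_eq_mul]; rfl

theorem line_sub_eq {g : E3 × ℝ → ℝ} (hg : Sm g) (x y : E3) (t : ℝ) {a b : ℝ} (hab : a ≤ b) :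
    g (x + b • y, t) - g (x + a • y, t) =
      ∫ ρ in Ioo a b, ∑ i, y i * dX i g (x + ρ • y, t) := by
  rw [← integral_Ioc_eq_integral_Ioo, ← intervalIntegral.integral_of_le hab,
    intervalIntegral.integral_eq_sub_of_hasDerivAt (fun ρ _ => hasDerivAt_line hg x y t ρ)]
  refine Continuous.intervalIntegrable ?_ _ _
  exact continuous_finsetSum _ fun i _ => continuous_const.mul ((hg.dX i).cont.comp (by fun_prop))

/-- Integrals over bounded sets of jointly continuous functions depend continuously on parameters. -/
theorem continuous_setIntegral_param {X Y : Type*} [TopologicalSpace X] [FirstCountableTopology X]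
    [LocallyCompactSpace X] [MetricSpace Y] [ProperSpace Y] [MeasurableSpace Y] [BorelSpace Y]
    {μ : Measure Y} [IsLocallyFiniteMeasure μ] {f : X → Y → ℝ}
    (hf : Continuous (Function.uncurry f)) {S : Set Y} (hS : Bornology.IsBounded S) : Continuous fun x => ∫ y in S, f x y ∂μ := by
  have := continuous_parametric_integral_of_continuous (μ := μ.restrict S) hf hS.isCompact_closure
  refine this.congr fun x => ?_
  rw [Measure.restrict_restrict isClosed_closure.measurableSet,
    inter_eq_self_of_subset_right subset_closure]

theorem setIntegral_swap {X Y : Type*} [MetricSpace X] [ProperSpace X] [MeasurableSpace X]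
    [BorelSpace X] [MetricSpace Y] [ProperSpace Y] [MeasurableSpace Y] [BorelSpace Y]
    {μ : Measure X} {ν : Measure Y} [IsFiniteMeasureOnCompacts μ] [IsFiniteMeasureOnCompacts ν]
    [SFinite μ] [SFinite ν] [SecondCountableTopology X] [SecondCountableTopology Y]
    {f : X → Y → ℝ} (hf : Continuous (Function.uncurry f)) {S : Set X} {T : Set Y}
    (hS : Bornology.IsBounded S) (hT : Bornology.IsBounded T) :
    ∫ x in S, ∫ y in T, f x y ∂ν ∂μ = ∫ y in T, ∫ x in S, f x y ∂μ ∂ν := by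
  refine integral_integral_swap ?_
  rw [Measure.prod_restrict]
  exact ion (μ := μ.prod ν) hf (hS.prod hT)

/-- Difference of the averages of the pressure at scales `1/4` and `ε`. -/
theorem pressure_average : ∃ (η : E3 → ℝ) (c M : ℝ), Continuous η ∧ 0 < c ∧ 0 < M ∧
    (∀ y, |η y| ≤ M) ∧ ∫ y in Metric.ball 0 1, η y = c ∧
    ∀ v P, Sol v P → ∀ (x : E3) (t ε : ℝ), ‖x‖ < 1 / 4 → -1 < t → t < 0 → 0 < ε → ε < 1 / 4 →
      |∫ y in Metric.ball (0 : E3) 1, η y * (P (x + (1 / 4 : ℝ) • y, t) - P (x + ε • y, t))| ≤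
        M * ∫ p in Metric.ball (0 : E3) 1 ×ˢ Ioo ε (1 / 4), (max ε p.2)⁻¹ *
          (unsum v p.1 p.2 (x, t) * incr v p.1 p.2 (x, t)) := by
  obtain ⟨Ψ, η, c, M, sΨ, sη, hc, hM, zΨ, zη, eX, ec, bη, bD⟩ := exists_kernel
  refine ⟨fun y => η (y, 0), c, 9 * M, slice_cont sη.cont 0, hc, by positivity,
    fun y => (bη y).trans (by linarith), ec, fun v P hs x t ε hx ht ht' hε hε' => ?_⟩
  have sv := hs.smv
  have sP := hs.smP
  have c1 : Continuous fun p : E3 × ℝ => η (p.1, 0) * ∑ i, p.1 i * dX i P (x + p.2 • p.1, t) :=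
    (sη.cont.comp (by fun_prop)).mul (continuous_finsetSum _ fun i _ =>
      ((sm_coord i).cont).mul ((sP.dX i).cont.comp (by fun_prop)))
  have c2 : Continuous fun p : E3 × ℝ => (max ε p.2)⁻¹ *
      (unsum v p.1 p.2 (x, t) * incr v p.1 p.2 (x, t)) := by
    refine Continuous.mul (Continuous.inv₀ (by fun_prop) fun p => ?_) ?_
    · exact (lt_of_lt_of_le hε (le_max_left _ _)).ne'
    · have := cont_kernel sv (z := fun _ : E3 × ℝ => (x, t)) continuous_const continuous_fst
        continuous_snd
      exact this.1.mul this.2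
  have e1 : ∫ y in Metric.ball (0 : E3) 1,
      η (y, 0) * (P (x + (1 / 4 : ℝ) • y, t) - P (x + ε • y, t)) =
      ∫ ρ in Ioo ε (1 / 4), ∫ y in Metric.ball (0 : E3) 1,
        η (y, 0) * ∑ i, y i * dX i P (x + ρ • y, t) := by
    rw [← setInt_prod_symm c1 0 1 ε (1 / 4), setInt_prod c1 0 1 ε (1 / 4)]
    congr 1; funext y
    rw [line_sub_eq sP x y t hε'.le]
    exact (integral_const_mul _ _).symm
  rw [e1, setInt_prod_symm c2, ← integral_const_mul, ← norm_eq_abs]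
  refine norm_integral_le_of_norm_le ?_ ?_
  · refine Integrable.const_mul (ion ?_ (Metric.isBounded_Ioo _ _)) _
    exact continuous_setIntegral_param (f := fun (ρ : ℝ) (y : E3) => (max ε ρ)⁻¹ *
      (unsum v y ρ (x, t) * incr v y ρ (x, t))) (c2.comp (by fun_prop : Continuous
        fun p : ℝ × E3 => (p.2, p.1))) Metric.isBounded_ball
  · refine (ae_restrict_iff' measurableSet_Ioo).2 (Filter.Eventually.of_forall fun ρ hρ => ?_)
    have hρ0 : 0 < ρ := hε.trans hρ.1
    have e : ∫ y in Metric.ball (0 : E3) 1, (max ε ρ)⁻¹ *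
        (unsum v y ρ (x, t) * incr v y ρ (x, t)) = ρ⁻¹ * ∫ y in Metric.ball (0 : E3) 1,
        unsum v y ρ (x, t) * incr v y ρ (x, t) := by
      rw [integral_const_mul, max_eq_right hρ.1.le]
    rw [norm_eq_abs]
    refine (pressure_slope hs sΨ zΨ zη eX bD hx ht ht' hρ0 hρ.2.le).trans ?_
    rw [← e]

theorem integral_translate_le {f : E3 × ℝ → ℝ} (hf : Continuous f) (f0 : ∀ z, 0 ≤ f z) {y : E3}
    {ρ : ℝ} (hy : ‖y‖ < 1) (h0 : 0 ≤ ρ) (hρ : ρ ≤ 1 / 4) :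
    ∫ z in cy (1 / 16), f (z.1 + ρ • y, z.2) ≤ ∫ z in cy (9 / 16), f z := by
  have : (volume : Measure (E3 × ℝ)).IsAddHaarMeasure := by
    rw [Measure.volume_eq_prod]; infer_instance
  have e := (measurePreserving_add_right (volume : Measure (E3 × ℝ)) (ρ • y, (0 : ℝ)))
    |>.setIntegral_preimage_emb (measurableEmbedding_addRight _) f (cy (9 / 16))
  rw [← e]
  have e2 : ∀ z : E3 × ℝ, z + (ρ • y, (0 : ℝ)) = (z.1 + ρ • y, z.2) := fun z => by
    ext <;> simp
  simp only [e2]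
  have hs : cy (1 / 16) ⊆ (fun z : E3 × ℝ => (z.1 + ρ • y, z.2)) ⁻¹' cy (9 / 16) := by
    rintro z ⟨h1, h2, h3⟩
    have : ‖z.1‖ < 1 / 4 := by nlinarith [norm_nonneg z.1]
    have := ball_shift this hy h0 hρ
    refine ⟨?_, ?_, h3⟩
    · simp only; nlinarith [norm_nonneg (z.1 + ρ • y)]
    · simp only; linarith
  have hb : Bornology.IsBounded ((fun z : E3 × ℝ => (z.1 + ρ • y, z.2)) ⁻¹' cy (9 / 16)) := by
    have h := (bdd_cy (a := 9 / 16)).sub (Bornology.isBounded_singleton (x := (ρ • y, (0 : ℝ))))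
    refine h.subset fun z hz => ?_
    refine Set.mem_sub.2 ⟨_, hz, (ρ • y, 0), rfl, ?_⟩
    ext <;> simp
  exact setIntegral_mono_set (ion (hf.comp (by fun_prop)) hb)
    (Filter.Eventually.of_forall fun z => f0 _) (Filter.Eventually.of_forall hs)

theorem sq_setIntegral_le {f : ℝ → ℝ} (hf : Continuous f) {ρ : ℝ} (h0 : 0 ≤ ρ) :
    (∫ s in Ioo 0 ρ, f s) ^ 2 ≤ ρ * ∫ s in Ioo 0 ρ, f s ^ 2 := by
  have i1 : IntegrableOn (fun s => f s ^ 2) (Ioo 0 ρ) := ion (hf.pow 2) (Metric.isBounded_Ioo _ _)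
  have i2 : IntegrableOn (fun _ : ℝ => (1 : ℝ)) (Ioo 0 ρ) :=
    ion continuous_const (Metric.isBounded_Ioo _ _)
  have h := holder2 i1 i2 (fun _ => sq_nonneg _) (fun _ => zero_le_one)
    (a := 1 / 2) (b := 1 / 2) (by norm_num) (by norm_num) (by norm_num)
  have e : ∀ s, (f s ^ 2) ^ (1 / 2 : ℝ) = |f s| := fun s => by
    rw [← Real.sqrt_eq_rpow, Real.sqrt_sq_eq_abs]
  simp only [e, one_rpow, mul_one] at h
  have hI : ∫ s in Ioo 0 ρ, (1 : ℝ) = ρ := by simp [h0]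
  rw [hI] at h
  have habs := (norm_integral_le_integral_norm (μ := volume.restrict (Ioo 0 ρ)) f)
  have hF : 0 ≤ ∫ s in Ioo 0 ρ, f s ^ 2 := integral_nonneg fun _ => sq_nonneg _
  have : |∫ s in Ioo 0 ρ, f s| ≤ Real.sqrt (∫ s in Ioo 0 ρ, f s ^ 2) * Real.sqrt ρ := by
    rw [Real.sqrt_eq_rpow, Real.sqrt_eq_rpow]; exact habs.trans h
  have := mul_self_le_mul_self (abs_nonneg _) this
  rw [abs_mul_abs_self, mul_mul_mul_comm, Real.mul_self_sqrt hF, Real.mul_self_sqrt h0] at this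
  linarith

theorem incr_sq_le {v : Fin 3 → E3 × ℝ → ℝ} (hv : ∀ j, Sm (v j)) {y : E3} {ρ : ℝ} (hy : ‖y‖ < 1)
    (h0 : 0 ≤ ρ) (z : E3 × ℝ) :
    incr v y ρ z ^ 2 ≤ ρ * ∫ s in Ioo 0 ρ, gsq v (z.1 + s • y, z.2) := by
  rw [incr, Real.sq_sqrt (Finset.sum_nonneg fun _ _ => sq_nonneg _)]
  have cD : ∀ i j, Continuous fun s : ℝ => dX i (v j) (z.1 + s • y, z.2) := fun i j =>
    ((hv j).dX i).cont.comp (by fun_prop)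
  have cL : ∀ j, Continuous fun s : ℝ => ∑ i, y i * dX i (v j) (z.1 + s • y, z.2) := fun j =>
    continuous_finsetSum _ fun i _ => continuous_const.mul (cD i j)
  have bb : Bornology.IsBounded (Ioo 0 ρ) := Metric.isBounded_Ioo _ _
  have h1 : ∀ j, (v j (z.1 + ρ • y, z.2) - v j z) ^ 2 ≤
      ρ * ∫ s in Ioo 0 ρ, ∑ i, dX i (v j) (z.1 + s • y, z.2) ^ 2 := by
    intro j
    have e := line_sub_eq (hv j) z.1 y z.2 h0
    rw [zero_smul, add_zero] at e
    rw [show v j z = v j (z.1, z.2) from rfl, e]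
    refine (sq_setIntegral_le (cL j) h0).trans ?_
    refine mul_le_mul_of_nonneg_left (integral_mono (ion ((cL j).pow 2) bb)
      (ion (continuous_finsetSum _ fun i _ => (cD i j).pow 2) bb) fun s => ?_) h0
    have cs := Finset.sum_mul_sq_le_sq_mul_sq Finset.univ (fun i => y i)
      (fun i => dX i (v j) (z.1 + s • y, z.2))
    refine cs.trans ?_
    have hn : ∑ i, y i ^ 2 ≤ 1 := by
      rw [← EuclideanSpace.real_norm_sq_eq]; nlinarith [norm_nonneg y]
    have : 0 ≤ ∑ i, dX i (v j) (z.1 + s • y, z.2) ^ 2 := Finset.sum_nonneg fun _ _ => sq_nonneg _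
    nlinarith
  refine (Finset.sum_le_sum fun j _ => h1 j).trans_eq ?_
  have ic : ∀ j, IntegrableOn (fun s => ∑ i, dX i (v j) (z.1 + s • y, z.2) ^ 2) (Ioo 0 ρ) :=
    fun j => ion (continuous_finsetSum _ fun i _ => (cD i j).pow 2) bb
  rw [← Finset.mul_sum, ← integral_finsetSum _ fun j _ => ic j]
  rfl

theorem integral_incr_sq_le {v : Fin 3 → E3 × ℝ → ℝ} (hv : ∀ j, Sm (v j)) {x : ℝ}
    (hx : EnergyLe v x) {y : E3} {ρ : ℝ} (hy : ‖y‖ < 1) (h0 : 0 ≤ ρ) (hρ : ρ ≤ 1 / 4) :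
    ∫ z in cy (1 / 16), incr v y ρ z ^ 2 ≤ ρ ^ 2 * x := by
  have cI : Continuous fun z : E3 × ℝ => incr v y ρ z ^ 2 :=
    (cont_kernel hv continuous_id continuous_const continuous_const).2.pow 2
  have cG : Continuous (Function.uncurry fun (z : E3 × ℝ) (s : ℝ) => gsq v (z.1 + s • y, z.2)) :=
    (sm_gsq hv).cont.comp (by fun_prop)
  have bb : Bornology.IsBounded (Ioo 0 ρ) := Metric.isBounded_Ioo _ _
  have cG1 : Continuous fun z : E3 × ℝ => ∫ s in Ioo 0 ρ, gsq v (z.1 + s • y, z.2) :=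
    continuous_setIntegral_param cG bb
  have h1 : ∫ z in cy (1 / 16), incr v y ρ z ^ 2 ≤
      ∫ z in cy (1 / 16), ρ * ∫ s in Ioo 0 ρ, gsq v (z.1 + s • y, z.2) :=
    integral_mono (icy cI _) (icy (continuous_const.mul cG1) _) fun z => incr_sq_le hv hy h0 z
  refine h1.trans ?_
  rw [integral_const_mul, setIntegral_swap cG bdd_cy bb]
  have hle : ∀ s ∈ Ioo 0 ρ, ∫ z in cy (1 / 16), gsq v (z.1 + s • y, z.2) ≤ x := fun s hs =>
    (integral_translate_le (sm_gsq hv).cont (gsq_nonneg v) hy hs.1.le (hs.2.le.trans hρ)).trans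
      ((setIntegral_mono_set (icy (sm_gsq hv).cont 1)
        (Filter.Eventually.of_forall fun z => gsq_nonneg v z)
        (Filter.Eventually.of_forall (cy_mono (by norm_num)))).trans hx.grad)
  have cS : Continuous fun s : ℝ => ∫ z in cy (1 / 16), gsq v (z.1 + s • y, z.2) :=
    continuous_setIntegral_param (f := fun (s : ℝ) (z : E3 × ℝ) => gsq v (z.1 + s • y, z.2))
      ((sm_gsq hv).cont.comp (by fun_prop)) bdd_cy
  have h2 := setIntegral_mono_on (ion (μ := volume) cS bb)
    (ion (μ := volume) (continuous_const (y := x)) bb) measurableSet_Ioo hle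
  have hI : ∫ s in Ioo 0 ρ, x = ρ * x := by simp [h0]
  rw [hI] at h2
  nlinarith

theorem integral_unsum_rpow_le {v : Fin 3 → E3 × ℝ → ℝ} (hv : ∀ j, Sm (v j)) {y : E3} {ρ s : ℝ}
    (hs : 0 ≤ s) (hy : ‖y‖ < 1) (h0 : 0 ≤ ρ) (hρ : ρ ≤ 1 / 4) :
    ∫ z in cy (1 / 16), unsum v y ρ z ^ s ≤ 2 * 2 ^ s * ∫ z in cy (9 / 16), un v z ^ s := by
  have cu : Continuous fun z : E3 × ℝ => un v z ^ s :=
    (cont_un hv).rpow_const fun z => Or.inr hs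
  have cu' : Continuous fun z : E3 × ℝ => un v (z.1 + ρ • y, z.2) ^ s :=
    cu.comp (by fun_prop : Continuous fun z : E3 × ℝ => (z.1 + ρ • y, z.2))
  have u0 : ∀ z, 0 ≤ un v z ^ s := fun z => rpow_nonneg (un_nonneg _ _) _
  have h1 : ∫ z in cy (1 / 16), unsum v y ρ z ^ s ≤
      ∫ z in cy (1 / 16), 2 ^ s * (un v z ^ s + un v (z.1 + ρ • y, z.2) ^ s) :=
    integral_mono (icy ((cont_kernel hv continuous_id continuous_const continuous_const).1.rpow_const
      fun z => Or.inr hs) _) (icy (continuous_const.mul (cu.add cu')) _)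
      fun z => add_sum_rpow_le hs (un_nonneg _ _) (un_nonneg _ _)
  refine h1.trans ?_
  rw [integral_const_mul, integral_add (icy cu _) (icy cu' _)]
  have h2 := integral_translate_le cu u0 hy h0 hρ
  have h3 : ∫ z in cy (1 / 16), un v z ^ s ≤ ∫ z in cy (9 / 16), un v z ^ s :=
    setIntegral_mono_set (icy cu _) (Filter.Eventually.of_forall u0)
      (Filter.Eventually.of_forall (cy_mono (by norm_num)))
  have : (0 : ℝ) < 2 ^ s := by positivity
  nlinarith

theorem pressure_kernel_bound {a : ℝ} (ha : 0 < a) (ha1 : a ≤ 1) : ∃ C : ℝ, 0 < C ∧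
    ∀ v x, (∀ j, Sm (v j)) → EnergyLe v x → ∀ (y : E3) (ρ : ℝ), ‖y‖ < 1 → 0 < ρ → ρ ≤ 1 / 4 →
      ∫ z in cy (1 / 16), (unsum v y ρ z * incr v y ρ z) ^ (3 / 2 : ℝ) ≤
        C * ((∫ z in cy (9 / 16), un v z ^ 3) ^ (1 - a) * x ^ (3 * a / 2)) * ρ ^ (a / 2) := by
  obtain ⟨C, hC, hu⟩ := un_rpow_bound
  refine ⟨(2 * 2 ^ (3 : ℝ)) ^ (1 - a) * (2 * 2 ^ (10 / 3 : ℝ) * C) ^ (3 * a / 4), by positivity,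
    fun v x hv hx y ρ hy h0 hρ => ?_⟩
  have cs := (cont_kernel hv (z := fun z : E3 × ℝ => z) (y := fun _ => y) (ρ := fun _ => ρ)
    continuous_id continuous_const continuous_const).1
  have ci := (cont_kernel hv (z := fun z : E3 × ℝ => z) (y := fun _ => y) (ρ := fun _ => ρ)
    continuous_id continuous_const continuous_const).2
  have c3 : Continuous fun z : E3 × ℝ => unsum v y ρ z ^ (3 : ℝ) :=
    cs.rpow_const fun z => Or.inr (by norm_num)
  have c10 : Continuous fun z : E3 × ℝ => unsum v y ρ z ^ (10 / 3 : ℝ) :=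
    cs.rpow_const fun z => Or.inr (by norm_num)
  have s0 := unsum_nonneg v y ρ
  have d0 := incr_nonneg v y ρ
  have H := holder3 (icy c3 (1 / 16)) (icy c10 (1 / 16)) (icy (ci.pow 2) (1 / 16))
    (fun z => rpow_nonneg (s0 z) _) (fun z => rpow_nonneg (s0 z) _) (fun z => sq_nonneg _)
    (a := 1 - a) (b := 3 * a / 4) (c := a / 4) (by linarith) (by linarith) (by linarith) (by ring)
  have pt : ∀ z, (unsum v y ρ z * incr v y ρ z) ^ (3 / 2 : ℝ) ≤
      (unsum v y ρ z ^ (3 : ℝ)) ^ (1 - a) * (unsum v y ρ z ^ (10 / 3 : ℝ)) ^ (3 * a / 4) *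
        (incr v y ρ z ^ 2) ^ (a / 4) := by
    intro z
    set s := unsum v y ρ z with hs
    set d := incr v y ρ z with hd
    have hds : d ≤ s := incr_le_unsum v y ρ z
    have e2 : (d ^ 2) ^ (a / 4) = d ^ (a / 2) := by
      rw [← rpow_natCast, ← rpow_mul (d0 z)]; congr 1; push_cast; ring
    have e1 : d ^ (3 / 2 : ℝ) = d ^ (3 / 2 - a / 2) * d ^ (a / 2) := by
      rw [← rpow_add_of_nonneg (d0 z) (by linarith) (by linarith)]; congr 1; ring
    have e3 : (s ^ (3 : ℝ)) ^ (1 - a) * (s ^ (10 / 3 : ℝ)) ^ (3 * a / 4) =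
        s ^ (3 / 2 : ℝ) * s ^ (3 / 2 - a / 2) := by
      rw [← rpow_mul (s0 z), ← rpow_mul (s0 z), ← rpow_add_of_nonneg (s0 z) (by linarith)
        (by linarith), ← rpow_add_of_nonneg (s0 z) (by linarith) (by linarith)]
      congr 1; ring
    rw [mul_rpow (s0 z) (d0 z), e1, e2, e3, mul_assoc (s ^ (3 / 2 : ℝ))]
    exact mul_le_mul_of_nonneg_left (mul_le_mul_of_nonneg_right
      (rpow_le_rpow (d0 z) hds (by linarith)) (rpow_nonneg (d0 z) _)) (rpow_nonneg (s0 z) _)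
  have cl : Continuous fun z : E3 × ℝ => (unsum v y ρ z * incr v y ρ z) ^ (3 / 2 : ℝ) :=
    (cs.mul ci).rpow_const fun z => Or.inr (by norm_num)
  have cr : Continuous fun z : E3 × ℝ => (unsum v y ρ z ^ (3 : ℝ)) ^ (1 - a) *
      (unsum v y ρ z ^ (10 / 3 : ℝ)) ^ (3 * a / 4) * (incr v y ρ z ^ 2) ^ (a / 4) :=
    ((c3.rpow_const fun z => Or.inr (by linarith)).mul
      (c10.rpow_const fun z => Or.inr (by linarith))).mul
      ((ci.pow 2).rpow_const fun z => Or.inr (by linarith))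
  refine ((integral_mono (icy cl _) (icy cr _) pt).trans H).trans ?_
  have b1 := integral_unsum_rpow_le hv (s := 3) (by norm_num) hy h0.le hρ
  have b2 := integral_unsum_rpow_le hv (s := 10 / 3) (by norm_num) hy h0.le hρ
  have b3 := integral_incr_sq_le hv hx hy h0.le hρ
  have b4 := hu v x hv hx
  have e3 : ∀ z, un v z ^ (3 : ℝ) = un v z ^ 3 := fun z => by norm_cast
  simp only [e3] at b1
  have x0 := hx.nonneg
  have n1 : 0 ≤ ∫ z in cy (1 / 16), unsum v y ρ z ^ (3 : ℝ) :=
    integral_nonneg fun z => rpow_nonneg (s0 z) _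
  have n2 : 0 ≤ ∫ z in cy (1 / 16), unsum v y ρ z ^ (10 / 3 : ℝ) :=
    integral_nonneg fun z => rpow_nonneg (s0 z) _
  have n3 : 0 ≤ ∫ z in cy (1 / 16), incr v y ρ z ^ 2 := integral_nonneg fun z => sq_nonneg _
  have n4 : 0 ≤ ∫ z in cy (9 / 16), un v z ^ 3 :=
    integral_nonneg fun z => pow_nonneg (un_nonneg _ _) _
  have b2' : ∫ z in cy (1 / 16), unsum v y ρ z ^ (10 / 3 : ℝ) ≤
      2 * 2 ^ (10 / 3 : ℝ) * C * x ^ (5 / 3 : ℝ) := by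
    refine b2.trans ?_
    rw [mul_assoc (2 * 2 ^ (10 / 3 : ℝ))]
    gcongr
  set C3 := ∫ z in cy (9 / 16), un v z ^ 3
  have m1 := rpow_le_rpow n1 b1 (show 0 ≤ 1 - a by linarith)
  have m2 := rpow_le_rpow n2 b2' (show 0 ≤ 3 * a / 4 by linarith)
  have m3 := rpow_le_rpow n3 b3 (show 0 ≤ a / 4 by linarith)
  refine (mul_le_mul (mul_le_mul m1 m2 (by positivity) (by positivity)) m3 (by positivity)
    (by positivity)).trans_eq ?_
  have k1 : (2 * 2 ^ (3 : ℝ) * C3) ^ (1 - a) = (2 * 2 ^ (3 : ℝ)) ^ (1 - a) * C3 ^ (1 - a) :=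
    mul_rpow (by positivity) n4
  have k2 : (2 * 2 ^ (10 / 3 : ℝ) * C * x ^ (5 / 3 : ℝ)) ^ (3 * a / 4) =
      (2 * 2 ^ (10 / 3 : ℝ) * C) ^ (3 * a / 4) * x ^ (5 / 3 * (3 * a / 4)) := by
    rw [mul_rpow (by positivity) (by positivity), ← rpow_mul x0]
  have k3 : (ρ ^ 2 * x) ^ (a / 4) = ρ ^ (a / 2) * x ^ (a / 4) := by
    rw [mul_rpow (by positivity) x0, ← rpow_natCast ρ, ← rpow_mul h0.le]
    congr 2; push_cast; ring
  rw [k1, k2, k3, show 3 * a / 2 = 5 / 3 * (3 * a / 4) + a / 4 by ring,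
    rpow_add_of_nonneg x0 (by linarith) (by linarith)]
  ring

theorem integral_max_rpow_le {κ ε : ℝ} (hκ : 0 < κ) (hε : 0 < ε) (hε' : ε < 1 / 4) :
    ∫ p in Metric.ball (0 : E3) 1 ×ˢ Ioo ε (1 / 4), (max ε p.2) ^ (κ - 1) ≤
      (volume (Metric.ball (0 : E3) 1)).toReal * κ⁻¹ := by
  have c : Continuous fun p : E3 × ℝ => (max ε p.2) ^ (κ - 1) :=
    Continuous.rpow_const (by fun_prop) fun p => Or.inl (lt_of_lt_of_le hε (le_max_left _ _)).ne'
  rw [setInt_prod c]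
  dsimp only
  rw [setIntegral_const, smul_eq_mul]
  refine mul_le_mul_of_nonneg_left ?_ ENNReal.toReal_nonneg
  have e : ∫ ρ in Ioo ε (1 / 4), (max ε ρ) ^ (κ - 1) = ∫ ρ in Ioo ε (1 / 4), ρ ^ (κ - 1) :=
    setIntegral_congr_fun measurableSet_Ioo fun ρ hρ => by simp only [max_eq_right hρ.1.le]
  rw [e, ← integral_Ioc_eq_integral_Ioo, ← intervalIntegral.integral_of_le hε'.le,
    integral_rpow (Or.inl (by linarith)), sub_add_cancel, div_eq_mul_inv]
  refine mul_le_of_le_one_left (by positivity) ?_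
  have h1 : (1 / 4 : ℝ) ^ κ ≤ 1 := rpow_le_one (by norm_num) (by norm_num) hκ.le
  have h2 : 0 ≤ ε ^ κ := rpow_nonneg hε.le _
  linarith

theorem integral_inv_max_le {κ ε : ℝ} (hκ : 0 < κ) (hε : 0 < ε) (hε' : ε < 1 / 4)
    {Φ : E3 × ℝ → ℝ} (hΦ : Continuous Φ) (Φ0 : ∀ p, 0 ≤ Φ p) :
    (∫ p in Metric.ball (0 : E3) 1 ×ˢ Ioo ε (1 / 4), (max ε p.2)⁻¹ * Φ p) ^ (3 / 2 : ℝ) ≤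
      ((volume (Metric.ball (0 : E3) 1)).toReal * κ⁻¹) ^ (1 / 2 : ℝ) *
        ∫ p in Metric.ball (0 : E3) 1 ×ˢ Ioo ε (1 / 4),
          (max ε p.2) ^ (-1 - κ / 2) * Φ p ^ (3 / 2 : ℝ) := by
  have w0 : ∀ p : E3 × ℝ, 0 < max ε p.2 := fun p => lt_of_lt_of_le hε (le_max_left _ _)
  have cw : ∀ s : ℝ, Continuous fun p : E3 × ℝ => (max ε p.2) ^ s := fun s =>
    Continuous.rpow_const (by fun_prop) fun p => Or.inl (w0 p).ne'
  have cg : Continuous fun p : E3 × ℝ => (max ε p.2) ^ (-1 - κ / 2) * Φ p ^ (3 / 2 : ℝ) :=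
    (cw _).mul (hΦ.rpow_const fun p => Or.inr (by norm_num))
  have f0 : ∀ p : E3 × ℝ, 0 ≤ (max ε p.2) ^ (κ - 1) := fun p => rpow_nonneg (w0 p).le _
  have g0 : ∀ p : E3 × ℝ, 0 ≤ (max ε p.2) ^ (-1 - κ / 2) * Φ p ^ (3 / 2 : ℝ) := fun p =>
    mul_nonneg (rpow_nonneg (w0 p).le _) (rpow_nonneg (Φ0 p) _)
  have H := holder2 (ion (μ := volume) (cw (κ - 1)) (bdd_cyl 0 1 ε (1 / 4)))
    (ion (μ := volume) cg (bdd_cyl 0 1 ε (1 / 4))) f0 g0 (a := 1 / 3) (b := 2 / 3)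
    (by norm_num) (by norm_num) (by norm_num)
  have e : ∀ p : E3 × ℝ, ((max ε p.2) ^ (κ - 1)) ^ (1 / 3 : ℝ) *
      ((max ε p.2) ^ (-1 - κ / 2) * Φ p ^ (3 / 2 : ℝ)) ^ (2 / 3 : ℝ) =
      (max ε p.2)⁻¹ * Φ p := fun p => by
    rw [mul_rpow (rpow_nonneg (w0 p).le _) (rpow_nonneg (Φ0 p) _), ← rpow_mul (w0 p).le,
      ← rpow_mul (w0 p).le, ← rpow_mul (Φ0 p), ← mul_assoc, ← rpow_add (w0 p),
      show (3 / 2 * (2 / 3) : ℝ) = 1 by norm_num, rpow_one, ← rpow_neg_one]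
    congr 2; ring
  simp only [e] at H
  have I0 : 0 ≤ ∫ p in Metric.ball (0 : E3) 1 ×ˢ Ioo ε (1 / 4), (max ε p.2)⁻¹ * Φ p :=
    integral_nonneg fun p => mul_nonneg (inv_nonneg.2 (w0 p).le) (Φ0 p)
  have F0 : 0 ≤ ∫ p in Metric.ball (0 : E3) 1 ×ˢ Ioo ε (1 / 4), (max ε p.2) ^ (κ - 1) :=
    integral_nonneg f0
  have G0 : 0 ≤ ∫ p in Metric.ball (0 : E3) 1 ×ˢ Ioo ε (1 / 4),
      (max ε p.2) ^ (-1 - κ / 2) * Φ p ^ (3 / 2 : ℝ) := integral_nonneg g0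
  refine (rpow_le_rpow I0 H (by norm_num : (0 : ℝ) ≤ 3 / 2)).trans ?_
  rw [mul_rpow (rpow_nonneg F0 _) (rpow_nonneg G0 _), ← rpow_mul F0, ← rpow_mul G0,
    show (2 / 3 * (3 / 2) : ℝ) = 1 by norm_num, rpow_one,
    show (1 / 3 * (3 / 2) : ℝ) = 1 / 2 by norm_num]
  exact mul_le_mul_of_nonneg_right (rpow_le_rpow F0 (integral_max_rpow_le hκ hε hε')
    (by norm_num)) G0

theorem pressure_average_rpow {η : E3 → ℝ} {M : ℝ} (hη : Continuous η) (hM : 0 < M)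
    (hP : ∀ v P, Sol v P → ∀ (x : E3) (t ε : ℝ), ‖x‖ < 1 / 4 → -1 < t → t < 0 → 0 < ε → ε < 1 / 4 →
      |∫ y in Metric.ball (0 : E3) 1, η y * (P (x + (1 / 4 : ℝ) • y, t) - P (x + ε • y, t))| ≤
        M * ∫ p in Metric.ball (0 : E3) 1 ×ˢ Ioo ε (1 / 4), (max ε p.2)⁻¹ *
          (unsum v p.1 p.2 (x, t) * incr v p.1 p.2 (x, t)))
    {a : ℝ} (ha : 0 < a) (ha1 : a ≤ 1) : ∃ C : ℝ, 0 < C ∧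
    ∀ v P x, Sol v P → EnergyLe v x → ∀ ε : ℝ, 0 < ε → ε < 1 / 4 →
      ∫ z in cy (1 / 16), |∫ y in Metric.ball (0 : E3) 1,
        η y * (P (z.1 + (1 / 4 : ℝ) • y, z.2) - P (z.1 + ε • y, z.2))| ^ (3 / 2 : ℝ) ≤
        C * ((∫ z in cy (9 / 16), un v z ^ 3) ^ (1 - a) * x ^ (3 * a / 2)) := by
  obtain ⟨C, hC, hk⟩ := pressure_kernel_bound ha ha1
  set V := (volume (Metric.ball (0 : E3) 1)).toReal
  have hV : 0 ≤ V := ENNReal.toReal_nonneg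
  refine ⟨M ^ (3 / 2 : ℝ) * (V * (a / 2)⁻¹) ^ (1 / 2 : ℝ) * (C * (V * (a / 4)⁻¹)) + 1,
    by positivity, fun v P x hs hx ε hε hε' => ?_⟩
  have sv := hs.smv
  have cP := hs.smP.cont
  set X := (∫ z in cy (9 / 16), un v z ^ 3) ^ (1 - a) * x ^ (3 * a / 2)
  have X0 : 0 ≤ X := mul_nonneg (rpow_nonneg
    (integral_nonneg fun z => pow_nonneg (un_nonneg _ _) _) _) (rpow_nonneg hx.nonneg _)
  set B := Metric.ball (0 : E3) 1 ×ˢ Ioo ε (1 / 4)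
  have bB : Bornology.IsBounded B := bdd_cyl _ _ _ _
  have w0 : ∀ p : E3 × ℝ, 0 < max ε p.2 := fun p => lt_of_lt_of_le hε (le_max_left _ _)
  have cw : ∀ s : ℝ, Continuous fun p : E3 × ℝ => (max ε p.2) ^ s := fun s =>
    Continuous.rpow_const (by fun_prop) fun p => Or.inl (w0 p).ne'
  have ck := cont_kernel sv (z := fun q : (E3 × ℝ) × (E3 × ℝ) => q.1)
    (y := fun q => q.2.1) (ρ := fun q => q.2.2) (by fun_prop) (by fun_prop) (by fun_prop)
  have cΦ : Continuous fun q : (E3 × ℝ) × (E3 × ℝ) =>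
      unsum v q.2.1 q.2.2 q.1 * incr v q.2.1 q.2.2 q.1 := ck.1.mul ck.2
  have Φ0 : ∀ z p, 0 ≤ unsum v (p : E3 × ℝ).1 p.2 z * incr v p.1 p.2 z := fun z p =>
    mul_nonneg (unsum_nonneg _ _ _ _) (incr_nonneg _ _ _ _)
  have cK : Continuous (Function.uncurry fun (z p : E3 × ℝ) => (max ε p.2) ^ (-1 - a / 2 / 2) *
      (unsum v p.1 p.2 z * incr v p.1 p.2 z) ^ (3 / 2 : ℝ)) :=
    ((cw _).comp continuous_snd).mul (cΦ.rpow_const fun q => Or.inr (by norm_num))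
  have cJ : Continuous fun z : E3 × ℝ => ∫ y in Metric.ball (0 : E3) 1,
        η y * (P (z.1 + (1 / 4 : ℝ) • y, z.2) - P (z.1 + ε • y, z.2)) := by
    refine continuous_setIntegral_param (f := fun (z : E3 × ℝ) (y : E3) =>
      η y * (P (z.1 + (1 / 4 : ℝ) • y, z.2) - P (z.1 + ε • y, z.2))) ?_ Metric.isBounded_ball
    exact (hη.comp continuous_snd).mul ((cP.comp (by fun_prop)).sub (cP.comp (by fun_prop)))
  have step1 : ∀ z ∈ cy (1 / 16), |∫ y in Metric.ball (0 : E3) 1,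
        η y * (P (z.1 + (1 / 4 : ℝ) • y, z.2) - P (z.1 + ε • y, z.2))| ^ (3 / 2 : ℝ) ≤
      M ^ (3 / 2 : ℝ) * (V * (a / 2)⁻¹) ^ (1 / 2 : ℝ) * ∫ p in B,
        (max ε p.2) ^ (-1 - a / 2 / 2) * (unsum v p.1 p.2 z * incr v p.1 p.2 z) ^ (3 / 2 : ℝ) := by
    intro z hz
    have hz1 : ‖z.1‖ < 1 / 4 := by nlinarith [norm_nonneg z.1, hz.1]
    have h := hP v P hs z.1 z.2 ε hz1 (by linarith [hz.2.1]) hz.2.2 hε hε'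
    have h' := integral_inv_max_le (κ := a / 2) (by linarith) hε hε'
      (Φ := fun p => unsum v p.1 p.2 z * incr v p.1 p.2 z)
      (cΦ.comp (by fun_prop : Continuous fun p : E3 × ℝ => (z, p))) (Φ0 z)
    refine (rpow_le_rpow (abs_nonneg _) h (by norm_num)).trans ?_
    rw [mul_rpow hM.le (integral_nonneg fun p => mul_nonneg (inv_nonneg.2 (w0 p).le) (Φ0 _ p)),
      mul_assoc]
    exact mul_le_mul_of_nonneg_left h' (by positivity)
  have cR : Continuous fun z => M ^ (3 / 2 : ℝ) * (V * (a / 2)⁻¹) ^ (1 / 2 : ℝ) * ∫ p in B,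
        (max ε p.2) ^ (-1 - a / 2 / 2) * (unsum v p.1 p.2 z * incr v p.1 p.2 z) ^ (3 / 2 : ℝ) :=
    continuous_const.mul (continuous_setIntegral_param (μ := volume) cK bB)
  have step2 := setIntegral_mono_on (μ := volume)
    (icy (cJ.abs.rpow_const fun z => Or.inr (by norm_num : (0 : ℝ) ≤ 3 / 2)) (1 / 16))
    (icy cR (1 / 16))
    (meas_cy _) step1
  refine step2.trans ?_
  rw [integral_const_mul, setIntegral_swap cK bdd_cy bB]
  have step3 : ∀ p ∈ B, ∫ z in cy (1 / 16), (max ε p.2) ^ (-1 - a / 2 / 2) *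
      (unsum v p.1 p.2 z * incr v p.1 p.2 z) ^ (3 / 2 : ℝ) ≤
      C * X * (max ε p.2) ^ (a / 4 - 1) := by
    intro p hp
    have hy : ‖p.1‖ < 1 := by simpa using hp.1
    have hρ : 0 < p.2 := hε.trans hp.2.1
    rw [integral_const_mul]
    refine (mul_le_mul_of_nonneg_left (hk v x sv hx p.1 p.2 hy hρ hp.2.2.le)
      (rpow_nonneg (w0 p).le _)).trans_eq ?_
    rw [max_eq_right hp.2.1.le, show a / 4 - 1 = (-1 - a / 2 / 2) + a / 2 by ring,
      rpow_add hρ]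
    ring
  have cL : Continuous fun p : E3 × ℝ => ∫ z in cy (1 / 16), (max ε p.2) ^ (-1 - a / 2 / 2) *
      (unsum v p.1 p.2 z * incr v p.1 p.2 z) ^ (3 / 2 : ℝ) :=
    continuous_setIntegral_param (f := fun p z : E3 × ℝ => (max ε p.2) ^ (-1 - a / 2 / 2) *
      (unsum v p.1 p.2 z * incr v p.1 p.2 z) ^ (3 / 2 : ℝ)) (cK.comp continuous_swap) bdd_cy
  have cL' : Continuous fun p : E3 × ℝ => C * X * (max ε p.2) ^ (a / 4 - 1) :=
    continuous_const.mul (cw (a / 4 - 1))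
  have step4 := setIntegral_mono_on (μ := volume) (ion cL bB)
    (ion cL' bB)
    (measurableSet_ball.prod measurableSet_Ioo) step3
  rw [integral_const_mul] at step4
  have step5 := integral_max_rpow_le (κ := a / 4) (by linarith) hε hε'
  have step6 := step4.trans (mul_le_mul_of_nonneg_left step5 (by positivity))
  refine (mul_le_mul_of_nonneg_left step6 (by positivity)).trans ?_
  nlinarith

theorem setIntegral_translate_dilate_le {f : E3 → ℝ} (hf : Continuous f) (f0 : ∀ x, 0 ≤ f x)
    {x : E3} (hx : ‖x‖ < 3 / 4) :
    ∫ y in Metric.ball (0 : E3) 1, f (x + (1 / 4 : ℝ) • y) ≤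
      64 * ∫ y in Metric.ball (0 : E3) 1, f y := by
  have e1 := Measure.setIntegral_comp_smul_of_pos (volume : Measure E3) (fun y => f (x + y))
    (Metric.ball (0 : E3) 1) (R := 1 / 4) (by norm_num)
  rw [e1]
  have hr : Module.finrank ℝ E3 = 3 := by simp
  rw [hr, smul_ball (by norm_num : (1 / 4 : ℝ) ≠ 0), smul_zero, smul_eq_mul]
  rw [show (((1 / 4 : ℝ) ^ 3)⁻¹) = 64 by norm_num]
  refine mul_le_mul_of_nonneg_left ?_ (by norm_num)
  have e := (measurePreserving_add_left (volume : Measure E3) x).setIntegral_preimage_emb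
    (measurableEmbedding_addLeft _) f (Metric.ball x (1 / 4))
  have hp : (fun y => x + y) ⁻¹' Metric.ball x (1 / 4) = Metric.ball 0 (1 / 4) := by
    ext y; simp
  rw [hp] at e
  have hn : ‖(1 / 4 : ℝ)‖ * 1 = 1 / 4 := by norm_num
  rw [hn, e]
  refine setIntegral_mono_set (ion hf Metric.isBounded_ball) (Filter.Eventually.of_forall f0)
    (Filter.Eventually.of_forall fun y hy => ?_)
  have h1 : ‖y - x‖ < 1 / 4 := mem_ball_iff_norm.1 hy
  have h2 := norm_add_le (y - x) x
  rw [sub_add_cancel] at h2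
  exact mem_ball_zero_iff.2 (by linarith)

theorem pressure_mean_le {η : E3 → ℝ} {M : ℝ} (hM : 0 < M)
    (bη : ∀ y, |η y| ≤ M) {P : E3 × ℝ → ℝ} (hP : Continuous P) {x : E3} (hx : ‖x‖ < 3 / 4) (t : ℝ) :
    |∫ y in Metric.ball (0 : E3) 1, η y * P (x + (1 / 4 : ℝ) • y, t)| ^ (3 / 2 : ℝ) ≤
      M ^ (3 / 2 : ℝ) * (volume (Metric.ball (0 : E3) 1)).toReal ^ (1 / 2 : ℝ) * 64 *
        ∫ y in Metric.ball (0 : E3) 1, |P (y, t)| ^ (3 / 2 : ℝ) := by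
  set V := (volume (Metric.ball (0 : E3) 1)).toReal with hVd
  have bb : Bornology.IsBounded (Metric.ball (0 : E3) 1) := Metric.isBounded_ball
  have cP : Continuous fun y : E3 => |P (x + (1 / 4 : ℝ) • y, t)| :=
    (hP.comp (by fun_prop)).abs
  have cP' : Continuous fun y : E3 => |P (x + (1 / 4 : ℝ) • y, t)| ^ (3 / 2 : ℝ) :=
    cP.rpow_const fun _ => Or.inr (by norm_num)
  have cQ : Continuous fun y : E3 => |P (y, t)| ^ (3 / 2 : ℝ) :=
    (hP.comp (by fun_prop)).abs.rpow_const fun _ => Or.inr (by norm_num)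
  have p0 : ∀ y : E3, 0 ≤ |P (x + (1 / 4 : ℝ) • y, t)| ^ (3 / 2 : ℝ) := fun y =>
    rpow_nonneg (abs_nonneg _) _
  have h1 : |∫ y in Metric.ball (0 : E3) 1, η y * P (x + (1 / 4 : ℝ) • y, t)| ≤
      M * ∫ y in Metric.ball (0 : E3) 1, |P (x + (1 / 4 : ℝ) • y, t)| := by
    rw [← integral_const_mul, ← norm_eq_abs]
    refine norm_integral_le_of_norm_le ((ion cP bb).const_mul M)
      (Filter.Eventually.of_forall fun y => ?_)
    rw [norm_mul]
    exact mul_le_mul_of_nonneg_right (bη y) (abs_nonneg _)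
  have h2 := holder2 (ion (μ := volume) cP' bb)
    (ion (μ := volume) (continuous_const (y := (1 : ℝ))) bb) p0
    (fun _ => zero_le_one) (a := 2 / 3) (b := 1 / 3) (by norm_num) (by norm_num) (by norm_num)
  have e : ∀ y : E3, (|P (x + (1 / 4 : ℝ) • y, t)| ^ (3 / 2 : ℝ)) ^ (2 / 3 : ℝ) =
      |P (x + (1 / 4 : ℝ) • y, t)| := fun y => by
    rw [← rpow_mul (abs_nonneg _), show (3 / 2 * (2 / 3) : ℝ) = 1 by norm_num, rpow_one]
  have eV : ∫ y in Metric.ball (0 : E3) 1, (1 : ℝ) = V := by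
    rw [setIntegral_const, smul_eq_mul, mul_one]; rfl
  simp only [e, one_rpow, mul_one] at h2
  rw [eV] at h2
  have h3 := setIntegral_translate_dilate_le cQ (fun y => rpow_nonneg (abs_nonneg _) _) hx
  have V0 : 0 ≤ V := ENNReal.toReal_nonneg
  set I := ∫ y in Metric.ball (0 : E3) 1, |P (x + (1 / 4 : ℝ) • y, t)| ^ (3 / 2 : ℝ)
  have I0 : 0 ≤ I := integral_nonneg p0
  have h4 := h1.trans (mul_le_mul_of_nonneg_left h2 hM.le)
  refine (rpow_le_rpow (abs_nonneg _) h4 (by norm_num)).trans ?_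
  rw [mul_rpow hM.le (by positivity), mul_rpow (by positivity) (by positivity), ← rpow_mul I0,
    ← rpow_mul V0, show (2 / 3 * (3 / 2) : ℝ) = 1 by norm_num, rpow_one,
    show (1 / 3 * (3 / 2) : ℝ) = 1 / 2 by norm_num]
  have : 0 ≤ M ^ (3 / 2 : ℝ) * V ^ (1 / 2 : ℝ) := by positivity
  nlinarith [mul_le_mul_of_nonneg_left h3 this]

theorem pressure_pointwise_le {η : E3 → ℝ} {c M : ℝ} (hη : Continuous η) (hM : 0 < M) (hc : 0 < c)
    (ec : ∫ y in Metric.ball (0 : E3) 1, η y = c)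
    (bη : ∀ y, |η y| ≤ M) {P : E3 × ℝ → ℝ} (hP : Continuous P) {z : E3 × ℝ} (hz : ‖z.1‖ < 3 / 4) :
    |P z| ^ (3 / 2 : ℝ) ≤ c⁻¹ ^ (3 / 2 : ℝ) * 2 ^ (3 / 2 : ℝ) *
      (|∫ y in Metric.ball (0 : E3) 1,
        η y * (P (z.1 + (1 / 4 : ℝ) • y, z.2) - P (z.1 + (0 : ℝ) • y, z.2))| ^ (3 / 2 : ℝ) +
      M ^ (3 / 2 : ℝ) * (volume (Metric.ball (0 : E3) 1)).toReal ^ (1 / 2 : ℝ) * 64 *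
        ∫ y in Metric.ball (0 : E3) 1, |P (y, z.2)| ^ (3 / 2 : ℝ)) := by
  have bb : Bornology.IsBounded (Metric.ball (0 : E3) 1) := Metric.isBounded_ball
  have hm := pressure_mean_le hM bη hP hz z.2
  set J := ∫ y in Metric.ball (0 : E3) 1,
        η y * (P (z.1 + (1 / 4 : ℝ) • y, z.2) - P (z.1 + (0 : ℝ) • y, z.2)) with hJ
  set m := ∫ y in Metric.ball (0 : E3) 1, η y * P (z.1 + (1 / 4 : ℝ) • y, z.2) with hmd
  have i1 : IntegrableOn (fun y => η y * P (z.1 + (1 / 4 : ℝ) • y, z.2)) (Metric.ball (0 : E3) 1) :=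
    ion (hη.mul (hP.comp (by fun_prop))) bb
  have i2 : IntegrableOn (fun y => η y * P z) (Metric.ball (0 : E3) 1) :=
    ion (hη.mul continuous_const) bb
  have eJ : J = m - c * P z := by
    have : ∀ y : E3, η y * (P (z.1 + (1 / 4 : ℝ) • y, z.2) - P (z.1 + (0 : ℝ) • y, z.2)) =
        η y * P (z.1 + (1 / 4 : ℝ) • y, z.2) - η y * P z := fun y => by
      rw [zero_smul, add_zero]; ring
    simp only [hJ, this]
    rw [integral_sub i1 i2, integral_mul_const, ec]
  have e : |P z| ≤ c⁻¹ * (|J| + |m|) := by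
    have h1 : c * |P z| = |m - J| := by
      rw [eJ, ← abs_of_pos hc, ← abs_mul, abs_of_pos hc]; congr 1; ring
    rw [le_inv_mul_iff₀ hc, h1]
    have := abs_sub m J
    linarith
  refine (rpow_le_rpow (abs_nonneg _) e (by norm_num)).trans ?_
  rw [mul_rpow (by positivity) (by positivity), mul_assoc]
  refine mul_le_mul_of_nonneg_left ?_ (by positivity)
  refine (add_sum_rpow_le (by norm_num) (abs_nonneg _) (abs_nonneg _)).trans ?_
  refine mul_le_mul_of_nonneg_left ?_ (by positivity)
  linarith

theorem volume_ball_toReal {θ : ℝ} (hθ : 0 < θ) :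
    (volume (Metric.ball (0 : E3) θ)).toReal =
      θ ^ 3 * (volume (Metric.ball (0 : E3) 1)).toReal := by
  have h := Measure.addHaar_ball_of_pos (volume : Measure E3) (0 : E3) hθ
  have hr : Module.finrank ℝ E3 = 3 := by simp
  rw [h, hr, ENNReal.toReal_mul, ENNReal.toReal_ofReal (by positivity)]

/-- Decay of the pressure. -/
theorem pressure_decay : ∃ C : ℝ, 1 ≤ C ∧ ∀ a : ℝ, 0 < a → a ≤ 1 → ∃ K : ℝ, 1 ≤ K ∧
    ∀ v P x, Sol v P → EnergyLe v x → ∀ θ : ℝ, 0 < θ → θ ≤ 1 / 4 →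
      ∫ z in cy (θ ^ 2), |P z| ^ (3 / 2 : ℝ) ≤ C * θ ^ 3 * (∫ z in cy 1, |P z| ^ (3 / 2 : ℝ)) +
        K * ((∫ z in cy (9 / 16), un v z ^ 3) ^ (1 - a) * x ^ (3 * a / 2)) := by
  obtain ⟨η, c, M, cη, hc, hM, bη, ec, hP⟩ := pressure_average
  set V := (volume (Metric.ball (0 : E3) 1)).toReal with hVd
  have V0 : 0 ≤ V := ENNReal.toReal_nonneg
  set L := M ^ (3 / 2 : ℝ) * V ^ (1 / 2 : ℝ) * 64 with hL
  have L0 : 0 ≤ L := by positivity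
  set W := c⁻¹ ^ (3 / 2 : ℝ) * 2 ^ (3 / 2 : ℝ) with hW
  have W0 : 0 ≤ W := by positivity
  refine ⟨W * (L * V) + 1, by have := mul_nonneg W0 (mul_nonneg L0 V0); linarith,
    fun a ha ha1 => ?_⟩
  obtain ⟨C, hC, hJ⟩ := pressure_average_rpow cη hM hP ha ha1
  refine ⟨W * C + 1, by have := mul_nonneg W0 hC.le; linarith,
    fun v P x hs hx θ hθ hθ' => ?_⟩
  set X := (∫ z in cy (9 / 16), un v z ^ 3) ^ (1 - a) * x ^ (3 * a / 2) with hX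
  have X0 : 0 ≤ X := mul_nonneg (rpow_nonneg
    (integral_nonneg fun z => pow_nonneg (un_nonneg _ _) _) _) (rpow_nonneg hx.nonneg _)
  have cP := hs.smP.cont
  have bb : Bornology.IsBounded (Metric.ball (0 : E3) 1) := Metric.isBounded_ball
  set J : ℝ → E3 × ℝ → ℝ := fun ε z => ∫ y in Metric.ball (0 : E3) 1,
    η y * (P (z.1 + (1 / 4 : ℝ) • y, z.2) - P (z.1 + ε • y, z.2)) with hJd
  have cJ : Continuous fun q : ℝ × (E3 × ℝ) => J q.1 q.2 := by
    refine continuous_setIntegral_param (f := fun (q : ℝ × (E3 × ℝ)) (y : E3) =>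
      η y * (P (q.2.1 + (1 / 4 : ℝ) • y, q.2.2) - P (q.2.1 + q.1 • y, q.2.2))) ?_ bb
    exact (cη.comp continuous_snd).mul ((cP.comp (by fun_prop)).sub (cP.comp (by fun_prop)))
  have cJ' : Continuous (Function.uncurry fun (ε : ℝ) (z : E3 × ℝ) => |J ε z| ^ (3 / 2 : ℝ)) :=
    cJ.abs.rpow_const fun _ => Or.inr (by norm_num)
  have cI : Continuous fun ε : ℝ => ∫ z in cy (1 / 16), |J ε z| ^ (3 / 2 : ℝ) :=
    continuous_setIntegral_param cJ' bdd_cy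
  have hJ0 : ∫ z in cy (1 / 16), |J 0 z| ^ (3 / 2 : ℝ) ≤ C * X := by
    have ht : Filter.Tendsto (fun ε : ℝ => ∫ z in cy (1 / 16), |J ε z| ^ (3 / 2 : ℝ))
      (nhdsWithin 0 (Ioi 0)) (nhds (∫ z in cy (1 / 16), |J 0 z| ^ (3 / 2 : ℝ))) :=
      (cI.tendsto 0).mono_left nhdsWithin_le_nhds
    refine le_of_tendsto ht ?_
    filter_upwards [Ioo_mem_nhdsGT (show (0 : ℝ) < 1 / 4 by norm_num)] with ε hε
    exact hJ v P x hs hx ε hε.1 hε.2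
  set F : ℝ → ℝ := fun t => ∫ y in Metric.ball (0 : E3) 1, |P (y, t)| ^ (3 / 2 : ℝ) with hF
  have cPr : Continuous fun z : E3 × ℝ => |P z| ^ (3 / 2 : ℝ) :=
    cP.abs.rpow_const fun _ => Or.inr (by norm_num)
  have cF : Continuous F := continuous_setIntegral_param (f := fun t (y : E3) =>
    |P (y, t)| ^ (3 / 2 : ℝ)) (cPr.comp continuous_swap) bb
  have F0 : ∀ t, 0 ≤ F t := fun t => integral_nonneg fun y => rpow_nonneg (abs_nonneg _) _
  have pt : ∀ z ∈ cy (θ ^ 2), |P z| ^ (3 / 2 : ℝ) ≤ W * (|J 0 z| ^ (3 / 2 : ℝ) + L * F z.2) := by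
    intro z hz
    have hz1 : ‖z.1‖ < 3 / 4 := by nlinarith [norm_nonneg z.1, hz.1]
    exact pressure_pointwise_le cη hM hc ec bη cP hz1
  have c0 : Continuous fun z : E3 × ℝ => |J 0 z| ^ (3 / 2 : ℝ) :=
    cJ'.comp (by fun_prop : Continuous fun z : E3 × ℝ => ((0 : ℝ), z))
  have c1 : Continuous fun z : E3 × ℝ => L * F z.2 := continuous_const.mul (cF.comp continuous_snd)
  have c2 : Continuous fun z : E3 × ℝ => W * (|J 0 z| ^ (3 / 2 : ℝ) + L * F z.2) :=
    continuous_const.mul (c0.add c1)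
  refine (setIntegral_mono_on (icy cPr _) (icy c2 _) (meas_cy _) pt).trans ?_
  rw [integral_const_mul, integral_add (icy c0 _) (icy c1 _)]
  have b1 : ∫ z in cy (θ ^ 2), |J 0 z| ^ (3 / 2 : ℝ) ≤ C * X :=
    (setIntegral_mono_set (icy c0 _) (Filter.Eventually.of_forall fun z => rpow_nonneg (abs_nonneg _) _)
      (Filter.Eventually.of_forall (cy_mono (by nlinarith)))).trans hJ0
  have b2 : ∫ z in cy (θ ^ 2), L * F z.2 ≤
      L * V * θ ^ 3 * ∫ z in cy 1, |P z| ^ (3 / 2 : ℝ) := by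
    have e1 : ∫ z in cy (θ ^ 2), L * F z.2 =
        ∫ y in Metric.ball (0 : E3) θ, ∫ t in Ioo (-θ ^ 2) 0, L * F t := by
      rw [cy_sq hθ.le, setInt_prod c1]
    have eV := volume_ball_toReal hθ
    rw [← hVd] at eV
    have e2 : ∫ z in cy 1, |P z| ^ (3 / 2 : ℝ) = ∫ t in Ioo (-1) 0, F t := by
      rw [cy_one, setInt_prod_symm cPr]
    have b : ∫ t in Ioo (-θ ^ 2) 0, F t ≤ ∫ t in Ioo (-1) 0, F t :=
      setIntegral_mono_set (ion cF (Metric.isBounded_Ioo _ _)) (Filter.Eventually.of_forall F0)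
        (Filter.Eventually.of_forall (Ioo_subset_Ioo_left (by nlinarith)))
    rw [e1, setIntegral_const, smul_eq_mul, integral_const_mul, e2]
    have : (volume : Measure E3).real (Metric.ball (0 : E3) θ) = θ ^ 3 * V := eV
    rw [this]
    have := mul_le_mul_of_nonneg_left b (show 0 ≤ L * V * θ ^ 3 by positivity)
    linarith
  have I0 : 0 ≤ ∫ z in cy 1, |P z| ^ (3 / 2 : ℝ) :=
    integral_nonneg fun z => rpow_nonneg (abs_nonneg _) _
  have := mul_le_mul_of_nonneg_left (add_le_add b1 b2) W0
  have : 0 ≤ θ ^ 3 * ∫ z in cy 1, |P z| ^ (3 / 2 : ℝ) := by positivity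
  nlinarith

theorem eLpNorm_ne_top_of_bound {X : Type*} [MeasurableSpace X] {μ : Measure X} [IsFiniteMeasure μ]
    {g : X → ℝ} {B : ℝ} (g0 : ∀ x, 0 ≤ g x) (gB : ∀ᵐ x ∂μ, g x ≤ B) (p : ℝ≥0∞) :
    eLpNorm g p μ ≠ ∞ := by
  have h := eLpNorm_le_of_ae_bound (p := p) (μ := μ) (f := g) (C := B)
    (gB.mono fun x hx => by rwa [norm_eq_abs, abs_of_nonneg (g0 x)])
  refine ne_top_of_le_ne_top (ENNReal.mul_ne_top ?_ ENNReal.ofReal_ne_top) h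
  exact ENNReal.rpow_ne_top_of_nonneg (by positivity) (measure_ne_top _ _)

/-- Hölder's inequality with the `Lᵖ` norm of one factor, `p = ∞` included. -/
theorem integral_rpow_mul_le_eLpNorm {X : Type*} [MeasurableSpace X] {μ : Measure X}
    [IsFiniteMeasure μ] {g h : X → ℝ} {p : ℝ≥0∞} {B c : ℝ} (hc : 0 < c)
    (hp : p = ∞ ∨ c < p.toReal) (gm : AEStronglyMeasurable g μ) (g0 : ∀ x, 0 ≤ g x)
    (gB : ∀ᵐ x ∂μ, g x ≤ B) (h0 : ∀ x, 0 ≤ h x)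
    (hh : Integrable (fun x => h x ^ (1 - c / p.toReal)⁻¹) μ) :
    ∫ x, g x ^ c * h x ∂μ ≤ (eLpNorm g p μ).toReal ^ c *
      (∫ x, h x ^ (1 - c / p.toReal)⁻¹ ∂μ) ^ (1 - c / p.toReal) := by
  rcases hp with rfl | hp
  · simp only [ENNReal.toReal_top, div_zero, sub_zero, inv_one, rpow_one] at hh ⊢
    have hn := eLpNorm_ne_top_of_bound g0 gB ∞
    rw [← integral_const_mul]
    refine integral_mono_of_nonneg (.of_forall fun x => mul_nonneg (rpow_nonneg (g0 x) _) (h0 x))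
      (hh.const_mul _) ?_
    filter_upwards [ae_le_eLpNormEssSup (f := g) (μ := μ)] with x hx
    refine mul_le_mul_of_nonneg_right (rpow_le_rpow (g0 x) ?_ hc.le) (h0 x)
    rw [← eLpNorm_exponent_top] at hx
    have := ENNReal.toReal_mono hn hx
    rwa [toReal_enorm, norm_eq_abs, abs_of_nonneg (g0 x)] at this
  · set P := p.toReal with hP
    have P0 : 0 < P := hc.trans hp
    have p0 : p ≠ 0 := by rintro rfl; simp [hP] at P0
    have p1 : p ≠ ∞ := by rintro rfl; simp [hP] at P0
    have hn := eLpNorm_ne_top_of_bound g0 gB p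
    have hw : 0 < 1 - c / P := by rw [sub_pos, div_lt_one P0]; exact hp
    have hL : MemLp g p μ := ⟨gm, lt_top_iff_ne_top.2 hn⟩
    have ig : Integrable (fun x => g x ^ P) μ := by
      have := hL.integrable_norm_rpow p0 p1
      simpa only [norm_eq_abs, abs_of_nonneg (g0 _)] using this
    have e := hL.eLpNorm_eq_integral_rpow_norm p0 p1
    simp only [norm_eq_abs, abs_of_nonneg (g0 _)] at e
    have I0 : 0 ≤ ∫ x, g x ^ P ∂μ := integral_nonneg fun x => rpow_nonneg (g0 x) _
    rw [e, ENNReal.toReal_ofReal (rpow_nonneg I0 _), ← rpow_mul I0]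
    have H := holder2 ig hh (fun x => rpow_nonneg (g0 x) _) (fun x => rpow_nonneg (h0 x) _)
      (a := c / P) (b := 1 - c / P) (by positivity) hw.le (by ring)
    have e2 : ∀ x, (g x ^ P) ^ (c / P) * (h x ^ (1 - c / P)⁻¹) ^ (1 - c / P) = g x ^ c * h x :=
      fun x => by
        rw [← rpow_mul (g0 x), ← rpow_mul (h0 x), inv_mul_cancel₀ hw.ne', rpow_one,
          mul_div_cancel₀ _ P0.ne']
    simp only [e2] at H
    rwa [show P⁻¹ * c = c / P by field_simp]

/-- A version of Hölder's inequality in which the factor measured in `L^q` need not be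
measurable. -/
theorem integral_le_eLpNorm_of_le {X : Type*} [MeasurableSpace X] {μ : Measure X}
    [IsFiniteMeasure μ] {G m S : X → ℝ} {q : ℝ≥0∞} {B c : ℝ} (hc : 0 < c)
    (hq : q = ∞ ∨ c < q.toReal) (G0 : ∀ x, 0 ≤ G x) (GB : ∀ᵐ x ∂μ, G x ≤ B)
    (mm : AEStronglyMeasurable m μ) (m0 : ∀ x, 0 ≤ m x)
    (Sm : AEStronglyMeasurable S μ) (S0 : ∀ x, 0 ≤ S x) (hm : ∀ᵐ x ∂μ, m x ≤ G x ^ c * S x)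
    (hS : Integrable (fun x => S x ^ (1 - c / q.toReal)⁻¹) μ) :
    ∫ x, m x ∂μ ≤ (eLpNorm G q μ).toReal ^ c *
      (∫ x, S x ^ (1 - c / q.toReal)⁻¹ ∂μ) ^ (1 - c / q.toReal) := by
  set g : X → ℝ := fun x => (m x / S x) ^ c⁻¹ with hg
  have g0 : ∀ x, 0 ≤ g x := fun x => rpow_nonneg (div_nonneg (m0 x) (S0 x)) _
  have gG : ∀ᵐ x ∂μ, g x ≤ G x := by
    filter_upwards [hm] with x hx
    have : m x / S x ≤ G x ^ c := div_le_of_le_mul₀ (S0 x) (rpow_nonneg (G0 x) _) hx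
    refine (rpow_le_rpow (div_nonneg (m0 x) (S0 x)) this (by positivity)).trans_eq ?_
    rw [← rpow_mul (G0 x), mul_inv_cancel₀ hc.ne', rpow_one]
  have gB : ∀ᵐ x ∂μ, g x ≤ B := by filter_upwards [gG, GB] with x h1 h2 using h1.trans h2
  have gm : AEStronglyMeasurable g μ :=
    ((mm.aemeasurable.div Sm.aemeasurable).pow_const _).aestronglyMeasurable
  have H := integral_rpow_mul_le_eLpNorm hc hq gm g0 gB S0 hS
  have e : ∫ x, g x ^ c * S x ∂μ = ∫ x, m x ∂μ := by
    refine integral_congr_ae ?_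
    filter_upwards [hm] with x hx
    simp only [hg]
    rw [← rpow_mul (div_nonneg (m0 x) (S0 x)), inv_mul_cancel₀ hc.ne', rpow_one]
    rcases eq_or_lt_of_le (S0 x) with h | h
    · rw [← h, mul_zero] at hx ⊢
      exact (le_antisymm hx (m0 x)).symm
    · exact div_mul_cancel₀ _ h.ne'
  rw [e] at H
  refine H.trans (mul_le_mul_of_nonneg_right (rpow_le_rpow ENNReal.toReal_nonneg ?_ hc.le)
    (rpow_nonneg (integral_nonneg fun x => rpow_nonneg (S0 x) _) _))
  refine ENNReal.toReal_mono (eLpNorm_ne_top_of_bound G0 GB q) (eLpNorm_mono_ae ?_)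
  filter_upwards [gG] with x hx
  rwa [norm_eq_abs, norm_eq_abs, abs_of_nonneg (g0 x), abs_of_nonneg (G0 x)]

/-- The modulus of the velocity without swirl. -/
def bn (v : Fin 3 → E3 × ℝ → ℝ) (z : E3 × ℝ) : ℝ :=
  Real.sqrt (usq v z - gam v z ^ 2 / (z.1 0 ^ 2 + z.1 1 ^ 2))

theorem gam_sq_div_le (v : Fin 3 → E3 × ℝ → ℝ) (z : E3 × ℝ) :
    gam v z ^ 2 / (z.1 0 ^ 2 + z.1 1 ^ 2) ≤ usq v z := by
  refine div_le_of_le_mul₀ (by positivity) (usq_nonneg v z) ?_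
  rw [mul_comm]; exact gam_sq_le v z

theorem bn_nonneg (v : Fin 3 → E3 × ℝ → ℝ) (z) : 0 ≤ bn v z := Real.sqrt_nonneg _

theorem bn_sq (v : Fin 3 → E3 × ℝ → ℝ) (z) :
    bn v z ^ 2 = usq v z - gam v z ^ 2 / (z.1 0 ^ 2 + z.1 1 ^ 2) :=
  Real.sq_sqrt (sub_nonneg.2 (gam_sq_div_le v z))

theorem bn_le_un (v : Fin 3 → E3 × ℝ → ℝ) (z) : bn v z ≤ un v z :=
  Real.sqrt_le_sqrt (sub_le_self _ (by positivity))

theorem measurable_bn {v : Fin 3 → E3 × ℝ → ℝ} (hv : ∀ j, Sm (v j)) : Measurable (bn v) := by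
  refine Real.continuous_sqrt.measurable.comp ((sm_usq hv).cont.measurable.sub
    (((sm_gam hv).cont.pow 2).measurable.div ?_))
  exact (((sm_coord 0).cont.pow 2).add ((sm_coord 1).cont.pow 2)).measurable

theorem un_cube_le {v : Fin 3 → E3 × ℝ → ℝ} {P : E3 × ℝ → ℝ} (hs : Sol v P) {z : E3 × ℝ}
    (h1 : ‖z.1‖ < 1) (h2 : -1 < z.2) (h3 : z.2 < 0) {K : ℝ} (hK : |gam v z| ≤ K) :
    un v z ^ 3 ≤ 4 * bn v z ^ 3 + 4 * (K ^ (3 / 2 : ℝ) * gsq v z ^ (3 / 4 : ℝ)) := by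
  set ρ := z.1 0 ^ 2 + z.1 1 ^ 2 with hρ
  have ρ0 : 0 ≤ ρ := by positivity
  set d := Real.sqrt (gam v z ^ 2 / ρ) with hd
  have d0 : 0 ≤ d := Real.sqrt_nonneg _
  have dsq : d ^ 2 = gam v z ^ 2 / ρ := Real.sq_sqrt (by positivity)
  have b0 := bn_nonneg v z
  have g0 := gsq_nonneg v z
  have K0 : 0 ≤ K := (abs_nonneg _).trans hK
  have e : un v z ^ 2 = bn v z ^ 2 + d ^ 2 := by rw [bn_sq, un_sq, dsq]; ring
  have hu : un v z ≤ bn v z + d := by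
    refine abs_le_of_sq_le_sq' ?_ (by positivity) |>.2
    nlinarith [mul_nonneg b0 d0]
  have h4 : un v z ^ 3 ≤ 4 * bn v z ^ 3 + 4 * d ^ 3 := by
    refine (pow_le_pow_left₀ (un_nonneg v z) hu 3).trans ?_
    nlinarith [mul_nonneg (add_nonneg b0 d0) (sq_nonneg (bn v z - d))]
  have hd2 : d ^ 2 ≤ K * gsq v z ^ (1 / 2 : ℝ) := by
    have hg := gam_sq_le_grad hs h1 h2 h3
    rw [← hρ] at hg
    have hg' : |gam v z| ≤ ρ * Real.sqrt (gsq v z) := by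
      refine abs_le_of_sq_le_sq ?_ (by positivity)
      rw [mul_pow, Real.sq_sqrt g0]; exact hg
    rw [dsq, ← Real.sqrt_eq_rpow]
    refine div_le_of_le_mul₀ ρ0 (by positivity) ?_
    rw [← sq_abs]
    nlinarith [abs_nonneg (gam v z), mul_le_mul hK hg' (abs_nonneg _) K0]
  have hd3 : d ^ 3 ≤ K ^ (3 / 2 : ℝ) * gsq v z ^ (3 / 4 : ℝ) := by
    have := rpow_le_rpow (sq_nonneg d) hd2 (by norm_num : (0 : ℝ) ≤ 3 / 2)
    rw [mul_rpow K0 (by positivity), ← rpow_mul g0, ← rpow_natCast, ← rpow_mul d0] at this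
    rw [show (((2 : ℕ) : ℝ) * (3 / 2)) = ((3 : ℕ) : ℝ) by norm_num, rpow_natCast] at this
    rwa [show (1 / 2 * (3 / 2) : ℝ) = 3 / 4 by norm_num] at this
  linarith

/-- The `H¹` energy of a time slice. -/
def slc (v : Fin 3 → E3 × ℝ → ℝ) (t : ℝ) : ℝ :=
  ∫ y in Metric.ball (0 : E3) 1, (gsq v (y, t) + usq v (y, t))

theorem slc_nonneg (v : Fin 3 → E3 × ℝ → ℝ) (t : ℝ) : 0 ≤ slc v t :=
  integral_nonneg fun _ => add_nonneg (gsq_nonneg _ _) (usq_nonneg _ _)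

theorem cont_slc {v : Fin 3 → E3 × ℝ → ℝ} (hv : ∀ j, Sm (v j)) : Continuous (slc v) :=
  continuous_setIntegral_param (f := fun (t : ℝ) (y : E3) => gsq v (y, t) + usq v (y, t))
    (((sm_gsq hv).cont.add (sm_usq hv).cont).comp continuous_swap) Metric.isBounded_ball

theorem EnergyLe.slc_le {v : Fin 3 → E3 × ℝ → ℝ} {x : ℝ} (h : EnergyLe v x)
    (hv : ∀ j, Sm (v j)) : ∫ t in Ioo (-1) 0, slc v t ≤ 2 * x := by
  have h1 := h.usq_le hv
  have h2 := h.grad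
  have cgu : Continuous fun z => gsq v z + usq v z := (sm_gsq hv).cont.add (sm_usq hv).cont
  have e := setInt_prod_symm cgu 0 1 (-1) 0
  rw [← cy_one, integral_add (icy (sm_gsq hv).cont 1) (icy (sm_usq hv).cont 1)] at e
  change ∫ t in Ioo (-1) 0, ∫ y in Metric.ball (0 : E3) 1, (gsq v (y, t) + usq v (y, t)) ≤ _
  linarith

theorem un_six_slice : ∃ C : ℝ, 0 < C ∧ ∀ v, (∀ j, Sm (v j)) → ∀ t, -(9 / 16) < t → t < 0 →
    ∫ y in Metric.ball (0 : E3) (3 / 4), un v (y, t) ^ 6 ≤ C * slc v t ^ 3 := by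
  obtain ⟨C, hC, hsob⟩ := sobolev6_slice
  obtain ⟨K, hK, h⟩ := exists_isCut
  obtain ⟨c, hc⟩ := h (3 / 4) (9 / 16) (by norm_num) (by norm_num) (by norm_num)
  set L := K / (3 / 4 - 9 / 16) ^ 2
  refine ⟨27 * (C * (2 + 6 * L ^ 2) ^ 3), by positivity, fun v hv t t1 t2 => ?_⟩
  have sw : ∀ j, Sm fun z => v j z * c z := fun j => (hv j).mul hc.sm
  have bb : Bornology.IsBounded (Metric.ball (0 : E3) 1) := Metric.isBounded_ball
  have s0 := slc_nonneg v t
  have h1 : ∀ j, ∫ y in Metric.ball (0 : E3) 1, (v j (y, t) * c (y, t)) ^ 6 ≤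
      C * (2 + 6 * L ^ 2) ^ 3 * slc v t ^ 3 := by
    intro j
    have hD : ∫ y in Metric.ball (0 : E3) 1, ∑ i, (dX i (fun z => v j z * c z) (y, t)) ^ 2 ≤
        (2 + 6 * L ^ 2) * slc v t := by
      rw [slc, ← integral_const_mul]
      refine integral_mono (ion (slice_cont
          (continuous_finsetSum _ fun i _ => ((sw j).dX i).cont.pow 2) t) bb)
        (ion (continuous_const.mul (slice_cont ((sm_gsq hv).cont.add (sm_usq hv).cont) t)) bb)
        fun y => ?_
      simp only
      generalize hz : ((y, t) : E3 × ℝ) = z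
      have hl : v j z ^ 2 ≤ usq v z :=
        Finset.single_le_sum (f := fun j => v j z ^ 2) (fun _ _ => sq_nonneg _)
          (Finset.mem_univ j)
      have hg : ∑ i, dX i (v j) z ^ 2 ≤ gsq v z :=
        Finset.single_le_sum (f := fun j => ∑ i, dX i (v j) z ^ 2)
          (fun _ _ => Finset.sum_nonneg fun _ _ => sq_nonneg _) (Finset.mem_univ j)
      have c1 := pow_le_one₀ (n := 2) (hc.nonneg z) (hc.le_one z)
      have b0 : ∀ i, dX i (fun z => v j z * c z) z ^ 2 ≤
          2 * dX i (v j) z ^ 2 + 2 * (v j z ^ 2 * L ^ 2) := fun i => by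
        rw [dX_mul (hv j) hc.sm]
        have d := sq_le_sq' (abs_le.1 (hc.dx i z)).1 (abs_le.1 (hc.dx i z)).2
        refine (add_sq_le (a := dX i (v j) z * c z) (b := v j z * dX i c z)).trans ?_
        rw [mul_pow, mul_pow]
        nlinarith [mul_le_mul_of_nonneg_left c1 (sq_nonneg (dX i (v j) z)),
          mul_le_mul_of_nonneg_left d (sq_nonneg (v j z))]
      refine (Finset.sum_le_sum fun i _ => b0 i).trans ?_
      rw [Finset.sum_add_distrib, ← Finset.mul_sum]
      simp only [Finset.sum_const, Finset.card_univ, Fintype.card_fin, nsmul_eq_mul]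
      push_cast
      have := mul_le_mul_of_nonneg_left hl (sq_nonneg L)
      have := mul_nonneg (sq_nonneg L) (gsq_nonneg v z)
      nlinarith [usq_nonneg v z]
    have h2 := hsob (fun z => v j z * c z) t (9 / 10) (sw j) (by norm_num) (fun y hy => by
      rw [hc.out y t (Or.inl (by nlinarith)), mul_zero])
    refine h2.trans ?_
    rw [mul_assoc, ← mul_pow]
    refine mul_le_mul_of_nonneg_left (pow_le_pow_left₀ ?_ hD 3) hC.le
    exact integral_nonneg fun y => Finset.sum_nonneg fun _ _ => sq_nonneg _
  have cw : ∀ j, Continuous fun y : E3 => (v j (y, t) * c (y, t)) ^ 6 := fun j =>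
    slice_cont ((sw j).cont.pow 6) t
  have cs : Continuous fun y : E3 => 9 * ∑ j, (v j (y, t) * c (y, t)) ^ 6 :=
    continuous_const.mul (continuous_finsetSum _ fun j _ => cw j)
  have ic : ∀ j, IntegrableOn (fun y : E3 => (v j (y, t) * c (y, t)) ^ 6) (Metric.ball 0 1) :=
    fun j => ion (cw j) bb
  calc _ ≤ ∫ y in Metric.ball (0 : E3) (3 / 4), 9 * ∑ j, (v j (y, t) * c (y, t)) ^ 6 := by
        refine setIntegral_mono_on (ion (slice_cont ((cont_un hv).pow 6) t) Metric.isBounded_ball)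
          (ion cs Metric.isBounded_ball) measurableSet_ball fun y hy => ?_
        have hy' : ‖y‖ < 3 / 4 := by simpa using hy
        have hmem : ((y, t) : E3 × ℝ) ∈ cy (9 / 16) := ⟨by simp only; nlinarith [norm_nonneg y], t1, t2⟩
        simp only [hc.one _ hmem, mul_one, Fin.sum_univ_three]
        have e : un v (y, t) ^ 6 = (usq v (y, t)) ^ 3 := by rw [← un_sq]; ring
        rw [e]
        simp only [usq, Fin.sum_univ_three]
        have key : ∀ a b c : ℝ, 0 ≤ a → 0 ≤ b → 0 ≤ c → (a + b + c) ^ 3 ≤ 9 * (a ^ 3 + b ^ 3 + c ^ 3) := by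
          intro a b c ha hb hc
          nlinarith [mul_nonneg (add_nonneg ha hb) (sq_nonneg (a - b)),
            mul_nonneg (add_nonneg ha hc) (sq_nonneg (a - c)),
            mul_nonneg (add_nonneg hb hc) (sq_nonneg (b - c)), mul_nonneg ha (sq_nonneg (b - c)),
            mul_nonneg hb (sq_nonneg (a - c)), mul_nonneg hc (sq_nonneg (a - b))]
        refine (key _ _ _ (sq_nonneg _) (sq_nonneg _) (sq_nonneg _)).trans_eq (by ring)
    _ ≤ ∫ y in Metric.ball (0 : E3) 1, 9 * ∑ j, (v j (y, t) * c (y, t)) ^ 6 :=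
        setIntegral_mono_set (ion cs bb) (.of_forall fun y => mul_nonneg (by norm_num)
          (Finset.sum_nonneg fun j _ => Even.pow_nonneg (by decide) _))
          (.of_forall (Metric.ball_subset_ball (by norm_num)))
    _ = 9 * ∑ j, ∫ y in Metric.ball (0 : E3) 1, (v j (y, t) * c (y, t)) ^ 6 := by
        rw [integral_const_mul, integral_finsetSum _ fun j _ => ic j]
    _ ≤ 9 * ∑ _j : Fin 3, C * (2 + 6 * L ^ 2) ^ 3 * slc v t ^ 3 :=
        mul_le_mul_of_nonneg_left (Finset.sum_le_sum fun j _ => h1 j) (by norm_num)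
    _ = _ := by simp; ring

theorem exists_interpolation_exponents {γ A B : ℝ} (h0 : 0 < γ) (h1 : γ < 1) (hA : 0 ≤ A)
    (hB : 0 ≤ B) (h : 3 * A + 2 * B = 2 - γ ^ 2 / 2) :
    ∃ μ w : ℝ, 0 ≤ μ ∧ μ ≤ 1 - B ∧ 0 ≤ w ∧ w + μ = 1 - γ / 4 ∧ A + w + μ / 3 ≤ 1 := by
  rcases le_total (1 - B) (1 - γ / 4) with h2 | h2
  · exact ⟨1 - B, 1 - γ / 4 - (1 - B), by nlinarith, le_rfl, by linarith, by ring, by nlinarith⟩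
  · exact ⟨1 - γ / 4, 0, by linarith, h2, le_rfl, by ring, by nlinarith⟩

theorem exists_un_bound {v : Fin 3 → E3 × ℝ → ℝ} (hv : ∀ j, Sm (v j)) :
    ∃ B, ∀ z ∈ cy 1, un v z ≤ B := by
  obtain ⟨B, hB⟩ := (bdd_cy (a := 1)).isCompact_closure.bddAbove_image (cont_un hv).continuousOn
  exact ⟨B, fun z hz => hB (mem_image_of_mem _ (subset_closure hz))⟩

theorem mk_mem_cy_one {y : E3} (hy : y ∈ Metric.ball (0 : E3) 1) {t : ℝ} (h1 : -1 < t)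
    (h2 : t < 0) : ((y, t) : E3 × ℝ) ∈ cy 1 := by
  rw [cy_one]; exact ⟨hy, h1, h2⟩

/-- The `Lᵖ` norm of the swirl-free part of the velocity at time `t`. -/
def bslice (v : Fin 3 → E3 × ℝ → ℝ) (p : ℝ≥0∞) (t : ℝ) : ℝ :=
  (eLpNorm (fun y => bn v (y, t)) p (volume.restrict (Metric.ball (0 : E3) 1))).toReal

theorem slice_bound {p : ℝ≥0∞} {c w μ : ℝ} (hc : 0 < c) (hp : p = ∞ ∨ c < p.toReal)
    (hw : 0 ≤ w) (hμ : 0 ≤ μ) (h : c / p.toReal + w + μ / 3 ≤ 1) :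
    ∃ C, 0 ≤ C ∧ ∀ v x, (∀ j, Sm (v j)) → EnergyLe v x → ∀ t, -(9 / 16) < t → t < 0 →
      ∫ y in Metric.ball (0 : E3) (3 / 4), bn v (y, t) ^ c * un v (y, t) ^ (2 * w + 2 * μ) ≤
        bslice v p t ^ c * (C * x ^ w * slc v t ^ μ) := by
  obtain ⟨C, hC, H6⟩ := un_six_slice
  set W := 1 - c / p.toReal with hW
  have W0 : 0 < W := by
    rcases hp with rfl | hp
    · simp [hW]
    · rw [hW, sub_pos, div_lt_one (hc.trans hp)]; exact hp
  set V := ∫ _ in Metric.ball (0 : E3) (3 / 4), (1 : ℝ)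
  have V0 : 0 ≤ V := integral_nonneg fun _ => zero_le_one
  refine ⟨C ^ (μ / 3) * V ^ (W - w - μ / 3), by positivity, fun v x hv hE t t1 t2 => ?_⟩
  obtain ⟨B, hB⟩ := exists_un_bound hv
  have hBt : ∀ y ∈ Metric.ball (0 : E3) 1, bn v (y, t) ≤ B := fun y hy =>
    (bn_le_un v _).trans (hB _ (mk_mem_cy_one hy (by linarith) t2))
  have mt : Measurable fun y : E3 => bn v (y, t) :=
    (measurable_bn hv).comp (measurable_id.prodMk measurable_const)
  have cu : Continuous fun y : E3 => un v (y, t) := slice_cont (cont_un hv) t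
  have s0 := slc_nonneg v t
  have x0 := hE.nonneg
  have u0 := fun y : E3 => un_nonneg v (y, t)
  have bb : Bornology.IsBounded (Metric.ball (0 : E3) (3 / 4)) := Metric.isBounded_ball
  have fin : ∀ r, IsFiniteMeasure (volume.restrict (Metric.ball (0 : E3) r)) := fun r =>
    isFiniteMeasure_restrict.2 measure_ball_lt_top.ne
  have i2 : IntegrableOn (fun y : E3 => un v (y, t) ^ 2) (Metric.ball 0 (3 / 4)) :=
    ion (cu.pow 2) bb
  have i6 : IntegrableOn (fun y : E3 => un v (y, t) ^ 6) (Metric.ball 0 (3 / 4)) :=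
    ion (cu.pow 6) bb
  have i1 : IntegrableOn (fun _ : E3 => (1 : ℝ)) (Metric.ball 0 (3 / 4)) :=
    ion continuous_const bb
  have sub : Metric.ball (0 : E3) (3 / 4) ⊆ Metric.ball 0 1 :=
    Metric.ball_subset_ball (by norm_num)
  have H := integral_rpow_mul_le_eLpNorm (μ := volume.restrict (Metric.ball (0 : E3) (3 / 4)))
    (h := fun y => un v (y, t) ^ (2 * w + 2 * μ)) hc hp mt.aestronglyMeasurable
    (fun y => bn_nonneg v (y, t)) (B := B)
    (ae_restrict_of_forall_mem measurableSet_ball fun y hy => hBt y (sub hy))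
    (fun y => rpow_nonneg (u0 y) _)
    (ion ((cu.rpow_const fun y => Or.inr (by positivity)).rpow_const
      fun y => Or.inr (by positivity)) bb)
  refine H.trans (mul_le_mul (rpow_le_rpow ENNReal.toReal_nonneg ?_ hc.le) ?_
    (rpow_nonneg (integral_nonneg fun y => rpow_nonneg (rpow_nonneg (u0 y) _) _) _)
    (rpow_nonneg ENNReal.toReal_nonneg _))
  · exact ENNReal.toReal_mono (eLpNorm_ne_top_of_bound (fun y => bn_nonneg v (y, t))
      (ae_restrict_of_forall_mem measurableSet_ball hBt) p)
      (eLpNorm_mono_measure _ (Measure.restrict_mono sub le_rfl))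
  · have H3 := holder3 (μ := volume.restrict (Metric.ball (0 : E3) (3 / 4)))
      (f := fun y => un v (y, t) ^ 2) (g := fun y => un v (y, t) ^ 6) (h := fun _ => 1)
      i2 i6 i1
      (fun y => by positivity) (fun y => pow_nonneg (u0 y) 6) (fun _ => zero_le_one)
      (a := w / W) (b := μ / 3 / W) (c := (W - w - μ / 3) / W) (by positivity) (by positivity)
      (div_nonneg (by linarith) W0.le) (by field_simp; ring)
    have e : ∀ y, (un v (y, t) ^ 2) ^ (w / W) * (un v (y, t) ^ 6) ^ (μ / 3 / W) *
        (1 : ℝ) ^ ((W - w - μ / 3) / W) = (un v (y, t) ^ (2 * w + 2 * μ)) ^ W⁻¹ := fun y => by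
      rw [one_rpow, mul_one, ← rpow_natCast, ← rpow_natCast, ← rpow_mul (u0 y),
        ← rpow_mul (u0 y), ← rpow_mul (u0 y), ← rpow_add_of_nonneg (u0 y) (by positivity)
          (by positivity)]
      congr 1; push_cast; field_simp; ring
    simp only [e] at H3
    have b2 : ∫ y in Metric.ball (0 : E3) (3 / 4), un v (y, t) ^ 2 ≤ x := by
      simp only [un_sq]
      exact (setIntegral_mono_set (ion (slice_cont (sm_usq hv).cont t) Metric.isBounded_ball)
        (.of_forall fun y => usq_nonneg _ _) (.of_forall sub)).trans
        (hE.slice t (by linarith) t2)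
    have b6 := H6 v hv t t1 t2
    have n2 : 0 ≤ ∫ y in Metric.ball (0 : E3) (3 / 4), un v (y, t) ^ 2 :=
      integral_nonneg fun y => sq_nonneg _
    have n6 : 0 ≤ ∫ y in Metric.ball (0 : E3) (3 / 4), un v (y, t) ^ 6 :=
      integral_nonneg fun y => pow_nonneg (u0 y) 6
    calc _ ≤ (x ^ (w / W) * (C * slc v t ^ 3) ^ (μ / 3 / W) * V ^ ((W - w - μ / 3) / W)) ^ W := by
          refine rpow_le_rpow (integral_nonneg fun y => rpow_nonneg (rpow_nonneg (u0 y) _) _)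
            (H3.trans ?_) W0.le
          refine mul_le_mul_of_nonneg_right (mul_le_mul (rpow_le_rpow n2 b2 (by positivity))
            (rpow_le_rpow n6 b6 (by positivity)) (rpow_nonneg n6 _) (by positivity))
            (by positivity)
      _ = _ := by
          rw [mul_rpow (by positivity) (by positivity), mul_rpow (by positivity) (by positivity),
            ← rpow_mul x0, ← rpow_mul (by positivity), ← rpow_mul V0, div_mul_cancel₀ _ W0.ne',
            div_mul_cancel₀ _ W0.ne', div_mul_cancel₀ _ W0.ne', mul_rpow hC.le (by positivity),
            ← rpow_natCast, ← rpow_mul s0]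
          rw [show ((3 : ℕ) : ℝ) * (μ / 3) = μ by push_cast; ring]
          ring

/-- The space-time norm of the swirl-free part of the velocity on the unit cylinder. -/
def bmix (v : Fin 3 → E3 × ℝ → ℝ) (p q : ℝ≥0∞) : ℝ :=
  (eLpNorm (bslice v p) q (volume.restrict (Ioo (-1 : ℝ) 0))).toReal

theorem bslice_nonneg (v : Fin 3 → E3 × ℝ → ℝ) (p : ℝ≥0∞) (t : ℝ) : 0 ≤ bslice v p t :=
  ENNReal.toReal_nonneg

theorem bmix_nonneg (v : Fin 3 → E3 × ℝ → ℝ) (p q : ℝ≥0∞) : 0 ≤ bmix v p q :=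
  ENNReal.toReal_nonneg

theorem exists_bslice_bound {v : Fin 3 → E3 × ℝ → ℝ} (hv : ∀ j, Sm (v j)) (p : ℝ≥0∞) :
    ∃ B, ∀ t, -1 < t → t < 0 → bslice v p t ≤ B := by
  obtain ⟨B, hB⟩ := exists_un_bound hv
  have : IsFiniteMeasure (volume.restrict (Metric.ball (0 : E3) 1)) :=
    isFiniteMeasure_restrict.2 measure_ball_lt_top.ne
  refine ⟨_, fun t t1 t2 => ENNReal.toReal_mono (ENNReal.mul_ne_top ?_ ENNReal.ofReal_ne_top)
    (eLpNorm_le_of_ae_bound (p := p) (C := B) (ae_restrict_of_forall_mem measurableSet_ball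
      fun y hy => ?_))⟩
  · exact ENNReal.rpow_ne_top_of_nonneg (by positivity) (measure_ne_top _ _)
  · rw [norm_eq_abs, abs_of_nonneg (bn_nonneg _ _)]
    exact (bn_le_un v _).trans (hB _ (mk_mem_cy_one hy t1 t2))

theorem integral_slc_rpow_le {v : Fin 3 → E3 × ℝ → ℝ} {x : ℝ} (h : EnergyLe v x)
    (hv : ∀ j, Sm (v j)) {e : ℝ} (e0 : 0 ≤ e) (e1 : e ≤ 1) :
    ∫ t in Ioo (-(9 / 16)) 0, slc v t ^ e ≤ (2 * x) ^ e := by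
  have bI : Bornology.IsBounded (Ioo (-1 : ℝ) 0) := Metric.isBounded_Ioo _ _
  have s0 := slc_nonneg v
  have H := holder2 (μ := volume.restrict (Ioo (-1 : ℝ) 0)) (f := slc v) (g := fun _ => 1)
    (ion (cont_slc hv) bI) (ion continuous_const bI) s0 (fun _ => zero_le_one) e0
    (b := 1 - e) (by linarith) (by ring)
  have e3 : ∫ _ in Ioo (-1 : ℝ) 0, (1 : ℝ) = 1 := by simp
  simp only [one_rpow, mul_one, e3] at H
  refine le_trans (setIntegral_mono_set (ion ((cont_slc hv).rpow_const fun _ => Or.inr e0) bI)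
    (.of_forall fun t => rpow_nonneg (s0 t) _)
    (.of_forall (Ioo_subset_Ioo (by norm_num) le_rfl))) (H.trans ?_)
  exact rpow_le_rpow (integral_nonneg s0) (h.slc_le hv) e0

theorem bn_cube_bound {p q : ℝ≥0∞} {γ : ℝ} (hp : 1 < p) (hq : 1 < q) (h0 : 0 < γ) (h1 : γ < 1)
    (h : 3 / p.toReal + 2 / q.toReal = 2 - γ) :
    ∃ C, 0 ≤ C ∧ ∀ v x, (∀ j, Sm (v j)) → EnergyLe v x →
      ∫ z in cy (9 / 16), bn v z ^ 3 ≤ C * (bmix v p q ^ (1 + γ / 2) * x ^ (1 - γ / 4)) := by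
  set c := 1 + γ / 2 with hcdef
  have c0 : 0 < c := by positivity
  have P0 : 0 ≤ p.toReal := ENNReal.toReal_nonneg
  have Q0 : 0 ≤ q.toReal := ENNReal.toReal_nonneg
  have hp' : p = ∞ ∨ c < p.toReal := by
    refine or_iff_not_imp_left.2 fun hp' => ?_
    have p1 : 1 < p.toReal := by
      have := (ENNReal.toReal_lt_toReal (by simp) hp').2 hp
      simpa using this
    have : 3 / p.toReal ≤ 2 - γ := by
      have : 0 ≤ 2 / q.toReal := by positivity
      linarith
    rw [div_le_iff₀ (by linarith)] at this
    nlinarith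
  have hq' : q = ∞ ∨ c < q.toReal := by
    refine or_iff_not_imp_left.2 fun hq' => ?_
    have q1 : 1 < q.toReal := by
      have := (ENNReal.toReal_lt_toReal (by simp) hq').2 hq
      simpa using this
    have : 2 / q.toReal ≤ 2 - γ := by
      have : 0 ≤ 3 / p.toReal := by positivity
      linarith
    rw [div_le_iff₀ (by linarith)] at this
    nlinarith
  obtain ⟨μ, w, μ0, μ1, w0, hwμ, hA⟩ := exists_interpolation_exponents (A := c / p.toReal)
    (B := c / q.toReal) h0 h1 (by positivity) (by positivity) (by
      have : 3 * (c / p.toReal) + 2 * (c / q.toReal) =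
        c * (3 / p.toReal + 2 / q.toReal) := by ring
      rw [this, h, hcdef]; ring)
  obtain ⟨C, C0, H⟩ := slice_bound c0 hp' w0 μ0 hA
  set W := 1 - c / q.toReal with hW
  have W0 : 0 < W := by
    rcases hq' with rfl | hq'
    · simp [hW]
    · rw [hW, sub_pos, div_lt_one (c0.trans hq')]; exact hq'
  refine ⟨C * 2 ^ μ, by positivity, fun v x hv hE => ?_⟩
  have x0 := hE.nonneg
  obtain ⟨B, hB⟩ := exists_un_bound hv
  obtain ⟨B', hB'⟩ := exists_bslice_bound hv p
  have s0 := slc_nonneg v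
  have fI : ∀ a : ℝ, IsFiniteMeasure (volume.restrict (Ioo a 0)) := fun a =>
    isFiniteMeasure_restrict.2 (by simp)
  set f : E3 × ℝ → ℝ := fun z => bn v z ^ c * un v z ^ (2 * w + 2 * μ) with hf
  have mf : Measurable f := ((measurable_bn hv).pow_const _).mul
    ((cont_un hv).measurable.pow_const _)
  have f0 : ∀ z, 0 ≤ f z := fun z =>
    mul_nonneg (rpow_nonneg (bn_nonneg _ _) _) (rpow_nonneg (un_nonneg _ _) _)
  have b3 : ∀ z, bn v z ^ 3 ≤ f z := fun z => by
    have : bn v z ^ 3 = bn v z ^ c * bn v z ^ (2 * w + 2 * μ) := by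
      rw [← rpow_add_of_nonneg (bn_nonneg _ _) c0.le (by positivity), ← rpow_natCast]
      congr 1; push_cast; linarith
    rw [this]
    exact mul_le_mul_of_nonneg_left (rpow_le_rpow (bn_nonneg _ _) (bn_le_un _ _) (by positivity))
      (rpow_nonneg (bn_nonneg _ _) _)
  have fu : ∀ z, f z ≤ un v z ^ 3 := fun z => by
    have : un v z ^ 3 = un v z ^ c * un v z ^ (2 * w + 2 * μ) := by
      rw [← rpow_add_of_nonneg (un_nonneg _ _) c0.le (by positivity), ← rpow_natCast]
      congr 1; push_cast; linarith
    rw [this]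
    exact mul_le_mul_of_nonneg_right (rpow_le_rpow (bn_nonneg _ _) (bn_le_un _ _) (by positivity))
      (rpow_nonneg (un_nonneg _ _) _)
  have iu : IntegrableOn (fun z => un v z ^ 3) (cy (9 / 16)) := icy ((cont_un hv).pow 3) _
  have iF : IntegrableOn f (cy (9 / 16)) := iu.mono' mf.aestronglyMeasurable
    (.of_forall fun z => by rw [norm_eq_abs, abs_of_nonneg (f0 z)]; exact fu z)
  have ib : IntegrableOn (fun z => bn v z ^ 3) (cy (9 / 16)) :=
    iu.mono' ((measurable_bn hv).pow_const 3).aestronglyMeasurable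
      (.of_forall fun z => by
        rw [norm_eq_abs, abs_of_nonneg (pow_nonneg (bn_nonneg _ _) 3)]
        exact (b3 z).trans (fu z))
  have ecy : cy (9 / 16) = Metric.ball 0 (3 / 4) ×ˢ Ioo (-(9 / 16)) 0 := by
    have := cy_sq (r := 3 / 4) (by norm_num)
    norm_num at this ⊢
    exact this
  have eF : ∫ z in cy (9 / 16), f z =
      ∫ t in Ioo (-(9 / 16)) 0, ∫ y in Metric.ball (0 : E3) (3 / 4), f (y, t) := by
    rw [ecy] at iF ⊢
    rw [Measure.volume_eq_prod, ← Measure.prod_restrict, integral_prod_symm]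
    rw [Measure.prod_restrict]
    exact iF
  have hI := integral_le_eLpNorm_of_le (μ := volume.restrict (Ioo (-(9 / 16) : ℝ) 0)) (q := q)
    (G := bslice v p) (m := fun t => ∫ y in Metric.ball (0 : E3) (3 / 4), f (y, t))
    (S := fun t => C * x ^ w * slc v t ^ μ) (B := B') c0 hq' (bslice_nonneg v p)
    (ae_restrict_of_forall_mem measurableSet_Ioo fun t ht => hB' t (by linarith [ht.1]) ht.2)
    (mf.stronglyMeasurable.integral_prod_left'
      (μ := volume.restrict (Metric.ball (0 : E3) (3 / 4)))).aestronglyMeasurable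
    (fun t => integral_nonneg fun y => f0 _)
    ((continuous_const.mul ((cont_slc hv).rpow_const fun _ => Or.inr μ0)).aestronglyMeasurable)
    (fun t => mul_nonneg (by positivity) (rpow_nonneg (s0 t) _))
    (ae_restrict_of_forall_mem measurableSet_Ioo fun t ht => H v x hv hE t ht.1 ht.2)
    (ion ((continuous_const.mul ((cont_slc hv).rpow_const fun _ => Or.inr μ0)).rpow_const
      fun _ => Or.inr (by positivity)) (Metric.isBounded_Ioo _ _))
  calc ∫ z in cy (9 / 16), bn v z ^ 3 ≤ ∫ z in cy (9 / 16), f z := integral_mono ib iF b3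
    _ ≤ _ := eF.le.trans hI
    _ ≤ bmix v p q ^ c * ((C * x ^ w) * (2 * x) ^ μ) := by
        refine mul_le_mul (rpow_le_rpow ENNReal.toReal_nonneg ?_ c0.le) ?_
          (rpow_nonneg (integral_nonneg fun t => rpow_nonneg
            (mul_nonneg (by positivity) (rpow_nonneg (s0 t) _)) _) _)
          (rpow_nonneg (bmix_nonneg _ _ _) _)
        · exact ENNReal.toReal_mono (eLpNorm_ne_top_of_bound (bslice_nonneg v p)
            (ae_restrict_of_forall_mem measurableSet_Ioo fun t ht => hB' t ht.1 ht.2) q)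
            (eLpNorm_mono_measure _ (Measure.restrict_mono
              (Ioo_subset_Ioo (by norm_num) le_rfl) le_rfl))
        · have e : ∀ t, (C * x ^ w * slc v t ^ μ) ^ W⁻¹ =
              (C * x ^ w) ^ W⁻¹ * slc v t ^ (μ / W) := fun t => by
            rw [mul_rpow (by positivity) (rpow_nonneg (s0 t) _), ← rpow_mul (s0 t)]
            rfl
          change (∫ t in Ioo (-(9 / 16) : ℝ) 0, (C * x ^ w * slc v t ^ μ) ^ W⁻¹) ^ W ≤ _
          simp only [e, integral_const_mul]
          have hs := integral_slc_rpow_le hE hv (e := μ / W) (by positivity)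
            ((div_le_one W0).2 μ1)
          have n0 : 0 ≤ ∫ t in Ioo (-(9 / 16) : ℝ) 0, slc v t ^ (μ / W) :=
            integral_nonneg fun t => rpow_nonneg (s0 t) _
          rw [mul_rpow (by positivity) n0, ← rpow_mul (by positivity),
            inv_mul_cancel₀ W0.ne', rpow_one]
          refine mul_le_mul_of_nonneg_left ((rpow_le_rpow n0 hs W0.le).trans_eq ?_)
            (by positivity)
          rw [← rpow_mul (by positivity), div_mul_cancel₀ _ W0.ne']
    _ = _ := by
        rw [mul_rpow (by norm_num) x0, ← hwμ, rpow_add_of_nonneg x0 w0 μ0]; ring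

theorem un_cube_bound {p q : ℝ≥0∞} {γ : ℝ} (hp : 1 < p) (hq : 1 < q) (h0 : 0 < γ) (h1 : γ < 1)
    (h : 3 / p.toReal + 2 / q.toReal = 2 - γ) :
    ∃ C, 0 ≤ C ∧ ∀ v P x K, Sol v P → EnergyLe v x → (∀ z ∈ cy (9 / 16), |gam v z| ≤ K) →
      0 ≤ K → ∫ z in cy (9 / 16), un v z ^ 3 ≤
        C * (bmix v p q ^ (1 + γ / 2) * x ^ (1 - γ / 4) + K ^ (3 / 2 : ℝ) * x ^ (3 / 4 : ℝ)) := by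
  obtain ⟨C, C0, H⟩ := bn_cube_bound hp hq h0 h1 h
  set V := ∫ _ in cy 1, (1 : ℝ)
  have V0 : 0 ≤ V := integral_nonneg fun _ => zero_le_one
  refine ⟨4 * C + 4 * V ^ (1 / 4 : ℝ), by positivity, fun v P x K hs hE hK K0 => ?_⟩
  have x0 := hE.nonneg
  have hv := hs.smv
  have hb := H v x hv hE
  have cg : Continuous fun z => gsq v z ^ (3 / 4 : ℝ) :=
    (sm_gsq hv).cont.rpow_const fun _ => Or.inr (by norm_num)
  have hg : ∫ z in cy (9 / 16), gsq v z ^ (3 / 4 : ℝ) ≤ x ^ (3 / 4 : ℝ) * V ^ (1 / 4 : ℝ) := by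
    have h2 := holder2 (icy (sm_gsq hv).cont 1) (icy (continuous_const (y := (1 : ℝ))) 1)
      (gsq_nonneg v) (fun _ => zero_le_one) (a := 3 / 4) (b := 1 / 4) (by norm_num) (by norm_num)
      (by norm_num)
    simp only [one_rpow, mul_one] at h2
    refine (setIntegral_mono_set (icy cg 1) (.of_forall fun z => rpow_nonneg (gsq_nonneg _ _) _)
      (.of_forall (cy_mono (by norm_num)))).trans (h2.trans ?_)
    exact mul_le_mul_of_nonneg_right (rpow_le_rpow (integral_nonneg (gsq_nonneg v)) hE.grad
      (by norm_num)) (by positivity)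
  have ig : IntegrableOn (fun z => 4 * (K ^ (3 / 2 : ℝ) * gsq v z ^ (3 / 4 : ℝ))) (cy (9 / 16)) :=
    icy (continuous_const.mul (continuous_const.mul cg)) _
  have iu : IntegrableOn (fun z => un v z ^ 3) (cy (9 / 16)) := icy ((cont_un hv).pow 3) _
  have ib : IntegrableOn (fun z => 4 * bn v z ^ 3) (cy (9 / 16)) := by
    refine Integrable.const_mul (iu.mono' ((measurable_bn hv).pow_const 3).aestronglyMeasurable
      (.of_forall fun z => ?_)) 4
    rw [norm_eq_abs, abs_of_nonneg (pow_nonneg (bn_nonneg _ _) 3)]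
    exact pow_le_pow_left₀ (bn_nonneg _ _) (bn_le_un _ _) 3
  have key : ∫ z in cy (9 / 16), un v z ^ 3 ≤
      ∫ z in cy (9 / 16), (4 * bn v z ^ 3 + 4 * (K ^ (3 / 2 : ℝ) * gsq v z ^ (3 / 4 : ℝ))) := by
    refine setIntegral_mono_on iu (ib.add ig) (meas_cy _) fun z hz => ?_
    obtain ⟨z1, z2, z3⟩ := cy_sub_one (by norm_num) hz
    exact un_cube_le hs z1 z2 z3 (hK z hz)
  rw [integral_add ib ig, integral_const_mul, integral_const_mul, integral_const_mul] at key
  have e1 := mul_le_mul_of_nonneg_left hg (by positivity : 0 ≤ K ^ (3 / 2 : ℝ))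
  have n1 : 0 ≤ V ^ (1 / 4 : ℝ) * (bmix v p q ^ (1 + γ / 2) * x ^ (1 - γ / 4)) :=
    mul_nonneg (by positivity)
      (mul_nonneg (rpow_nonneg (bmix_nonneg _ _ _) _) (by positivity))
  have n2 : 0 ≤ C * (K ^ (3 / 2 : ℝ) * x ^ (3 / 4 : ℝ)) := by positivity
  nlinarith

theorem mul_rpow_le_add {ν M : ℝ} (hν : 0 < ν) (hM : 0 ≤ M) :
    ∃ N, 0 ≤ N ∧ ∀ m, 1 ≤ m → M * m ^ (1 - ν) ≤ m / 4 + N := by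
  refine ⟨M * (4 * M + 1) ^ ν⁻¹, by positivity, fun m hm => ?_⟩
  have m0 : 0 < m := by linarith
  rcases le_total ((4 * M + 1) ^ ν⁻¹) m with h | h
  · have h1 : 4 * M + 1 ≤ m ^ ν := by
      have := rpow_le_rpow (by positivity) h hν.le
      rwa [← rpow_mul (by positivity), inv_mul_cancel₀ hν.ne', rpow_one] at this
    have h2 : m ^ (1 - ν) * m ^ ν = m := by rw [← rpow_add m0]; simp
    have h3 : 0 < m ^ (1 - ν) := by positivity
    have : 0 ≤ M * (4 * M + 1) ^ ν⁻¹ := by positivity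
    nlinarith
  · have h1 : m ^ (1 - ν) ≤ m := by
      simpa using rpow_le_rpow_of_exponent_le hm (by linarith : 1 - ν ≤ 1)
    have := mul_le_mul_of_nonneg_left (h1.trans h) hM
    linarith

theorem mul_le_mul_rpow_add {a b ε : ℝ} (ha : 0 ≤ a) (hb : 0 ≤ b) (hε : 0 < ε) :
    a * b ≤ ε * a ^ (3 / 2 : ℝ) + (ε ^ 2)⁻¹ * b ^ 3 := by
  set s := Real.sqrt a with hs
  have s0 : 0 ≤ s := Real.sqrt_nonneg a
  have e1 : a = s ^ 2 := (Real.sq_sqrt ha).symm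
  have e2 : a ^ (3 / 2 : ℝ) = s ^ 3 := by
    rw [e1, ← rpow_natCast, ← rpow_mul s0, ← rpow_natCast]; norm_num
  rw [e2, e1]
  rcases le_total b (ε * s) with h | h
  · have := mul_le_mul_of_nonneg_left h (sq_nonneg s)
    have : 0 ≤ (ε ^ 2)⁻¹ * b ^ 3 := by positivity
    nlinarith
  · have h1 : s ^ 2 ≤ (ε ^ 2)⁻¹ * b ^ 2 := by
      rw [inv_mul_eq_div, le_div_iff₀ (by positivity), ← mul_pow, mul_comm]
      exact pow_le_pow_left₀ (by positivity) h 2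
    have := mul_le_mul_of_nonneg_right h1 hb
    have : 0 ≤ ε * s ^ 3 := by positivity
    nlinarith

theorem un_cube_absorb {γ C : ℝ} (h0 : 0 < γ) (h1 : γ < 1) (hC : 0 ≤ C) (L : ℝ) (hL : 0 ≤ L) :
    ∃ a : ℝ, 0 < a ∧ a ≤ 1 ∧ ∀ M : ℝ, 0 ≤ M → ∃ N : ℝ, 0 ≤ N ∧ ∀ x K G I : ℝ, 0 ≤ x → 0 ≤ K → 0 ≤ G → 0 ≤ I →
      I ≤ C * (G ^ (1 + γ / 2) * x ^ (1 - γ / 4) + K ^ (3 / 2 : ℝ) * x ^ (3 / 4 : ℝ)) →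
      L * I + M * (I ^ (1 - a) * x ^ (3 * a / 2)) ≤
        x / 4 + N * (1 + K ^ 9 + G ^ ((6 + 2 * γ) / γ)) := by
  set r := (6 + 2 * γ) / γ with hr
  have r0 : 0 < r := by positivity
  set ν := min (γ / 4 - (1 + γ / 2) / r) (1 / 12) with hν
  have ν0 : 0 < ν := by
    refine lt_min ?_ (by norm_num)
    rw [sub_pos, hr, div_div_eq_mul_div, div_lt_div_iff₀ (by positivity) (by norm_num)]
    nlinarith
  have ν1 : ν ≤ γ / 4 - (1 + γ / 2) / r := min_le_left _ _
  have ν2 : ν ≤ 1 / 12 := min_le_right _ _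
  refine ⟨ν / 2, by positivity, by linarith, fun M hM => ?_⟩
  obtain ⟨N, hN, H⟩ := mul_rpow_le_add (ν := ν / 2) (by positivity)
    (by positivity : 0 ≤ L * (2 * C) + M * (2 * C) ^ (1 - ν / 2))
  refine ⟨1 / 4 + N, by positivity, fun x K G I x0 K0 G0 I0 hI => ?_⟩
  set S := 1 + K ^ 9 + G ^ r with hS
  have S1 : 1 ≤ S := by have := rpow_nonneg G0 r; have := pow_nonneg K0 9; linarith
  set m := max x S with hm
  have m1 : 1 ≤ m := S1.trans (le_max_right _ _)
  have m0 : 0 < m := by linarith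
  have xm : x ≤ m := le_max_left _ _
  have Sm : S ≤ m := le_max_right _ _
  have hK : K ≤ m ^ (1 / 9 : ℝ) := by
    have h9 : K ^ 9 ≤ m := by have := rpow_nonneg G0 r; linarith
    calc K = (K ^ 9) ^ (1 / 9 : ℝ) := by
          rw [← rpow_natCast, ← rpow_mul K0]; norm_num
      _ ≤ _ := rpow_le_rpow (by positivity) h9 (by norm_num)
  have hG : G ≤ m ^ r⁻¹ := by
    have h9 : G ^ r ≤ m := by have := pow_nonneg K0 9; linarith
    calc G = (G ^ r) ^ r⁻¹ := by rw [← rpow_mul G0, mul_inv_cancel₀ r0.ne', rpow_one]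
      _ ≤ _ := rpow_le_rpow (by positivity) h9 (by positivity)
  have b1 : G ^ (1 + γ / 2) * x ^ (1 - γ / 4) ≤ m ^ (1 - ν) := by
    calc _ ≤ (m ^ r⁻¹) ^ (1 + γ / 2) * m ^ (1 - γ / 4) :=
          mul_le_mul (rpow_le_rpow G0 hG (by positivity)) (rpow_le_rpow x0 xm (by linarith))
            (by positivity) (by positivity)
      _ = m ^ (r⁻¹ * (1 + γ / 2) + (1 - γ / 4)) := by
          rw [← rpow_mul m0.le, ← rpow_add m0]
      _ ≤ _ := rpow_le_rpow_of_exponent_le m1 (by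
          rw [inv_mul_eq_div]; linarith)
  have b2 : K ^ (3 / 2 : ℝ) * x ^ (3 / 4 : ℝ) ≤ m ^ (1 - ν) := by
    calc _ ≤ (m ^ (1 / 9 : ℝ)) ^ (3 / 2 : ℝ) * m ^ (3 / 4 : ℝ) :=
          mul_le_mul (rpow_le_rpow K0 hK (by positivity)) (rpow_le_rpow x0 xm (by norm_num))
            (by positivity) (by positivity)
      _ = m ^ ((1 / 9) * (3 / 2) + 3 / 4 : ℝ) := by
          rw [← rpow_mul m0.le, ← rpow_add m0]
      _ ≤ _ := rpow_le_rpow_of_exponent_le m1 (by linarith)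
  have hI2 : I ≤ 2 * C * m ^ (1 - ν) :=
    hI.trans ((mul_le_mul_of_nonneg_left (add_le_add b1 b2) hC).trans_eq (by ring))
  have c1 : L * I ≤ L * (2 * C) * m ^ (1 - ν / 2) := by
    have h2 : m ^ (1 - ν) ≤ m ^ (1 - ν / 2) := rpow_le_rpow_of_exponent_le m1 (by linarith)
    calc L * I ≤ L * (2 * C * m ^ (1 - ν / 2)) := mul_le_mul_of_nonneg_left
          (hI2.trans (mul_le_mul_of_nonneg_left h2 (by positivity))) hL
      _ = _ := by ring
  have c2 : I ^ (1 - ν / 2) * x ^ (3 * (ν / 2) / 2) ≤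
      (2 * C) ^ (1 - ν / 2) * m ^ (1 - ν / 2) := by
    calc _ ≤ (2 * C * m ^ (1 - ν)) ^ (1 - ν / 2) * m ^ (3 * (ν / 2) / 2) :=
          mul_le_mul (rpow_le_rpow I0 hI2 (by linarith)) (rpow_le_rpow x0 xm (by positivity))
            (by positivity) (by positivity)
      _ = (2 * C) ^ (1 - ν / 2) * m ^ ((1 - ν) * (1 - ν / 2) + 3 * (ν / 2) / 2) := by
          rw [mul_rpow (by positivity) (by positivity), ← rpow_mul m0.le, mul_assoc,
            ← rpow_add m0]
      _ ≤ _ := mul_le_mul_of_nonneg_left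
          (rpow_le_rpow_of_exponent_le m1 (by nlinarith)) (by positivity)
  have c3 := mul_le_mul_of_nonneg_left c2 hM
  have hH := H m m1
  have hmx : m ≤ x + S := max_le (by linarith) (by linarith)
  have hNS : N ≤ N * S := le_mul_of_one_le_right hN S1
  have e : (L * (2 * C) + M * (2 * C) ^ (1 - ν / 2)) * m ^ (1 - ν / 2) =
    L * (2 * C) * m ^ (1 - ν / 2) + M * ((2 * C) ^ (1 - ν / 2) * m ^ (1 - ν / 2)) := by ring
  linarith

theorem energy_decay {p q : ℝ≥0∞} {γ : ℝ} (hp : 1 < p) (hq : 1 < q) (h0 : 0 < γ) (h1 : γ < 1)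
    (h : 3 / p.toReal + 2 / q.toReal = 2 - γ) :
    ∃ θ : ℝ, 0 < θ ∧ θ ≤ 1 / 4 ∧ ∃ N : ℝ, 0 ≤ N ∧ ∀ v P x K, Sol v P → EnergyLe v x →
      ∫ z in cy 1, |P z| ^ (3 / 2 : ℝ) ≤ x → (∀ z ∈ cy (9 / 16), |gam v z| ≤ K) → 0 ≤ K →
      ∃ a, 0 ≤ a ∧
        (∀ t, -θ ^ 2 < t → t < 0 →
          θ⁻¹ * ∫ y in Metric.ball (0 : E3) θ, usq v (y, t) ≤ a) ∧
        a + θ⁻¹ * (∫ z in cy (θ ^ 2), gsq v z) +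
          (θ ^ 2)⁻¹ * (∫ z in cy (θ ^ 2), |P z| ^ (3 / 2 : ℝ)) ≤
          x / 2 + N * (1 + K ^ 9 + bmix v p q ^ ((6 + 2 * γ) / γ)) := by
  obtain ⟨C, hC, hpd⟩ := pressure_decay
  obtain ⟨Ce, hCe, hen⟩ := energy_est
  obtain ⟨C3, hC3, hun⟩ := un_cube_bound hp hq h0 h1 h
  have C0 : 0 < C := by linarith
  have Ce0 : 0 < Ce := by linarith
  set θ := (8 * C)⁻¹ with hθ
  have θ0 : 0 < θ := by positivity
  have θ4 : θ ≤ 1 / 4 := by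
    rw [hθ, inv_le_comm₀ (by positivity) (by norm_num)]; linarith
  have hCθ : C * θ = 1 / 8 := by rw [hθ]; field_simp
  set T := 2 * θ⁻¹ * Ce with hT
  have T0 : 0 < T := by positivity
  set ε := (8 * T)⁻¹ with hε
  have ε0 : 0 < ε := by positivity
  have hTε : T * ε = 1 / 8 := by rw [hε]; field_simp
  set V := ∫ _ in cy (9 / 16), (1 : ℝ)
  have V0 : 0 ≤ V := integral_nonneg fun _ => zero_le_one
  obtain ⟨a, a0, a1, habs⟩ := un_cube_absorb h0 h1 hC3 (T * (2 + (ε ^ 2)⁻¹)) (by positivity)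
  obtain ⟨Kp, hKp, hpd⟩ := hpd a a0 a1
  obtain ⟨N, hN, habs⟩ := habs ((θ ^ 2)⁻¹ * Kp) (by positivity)
  refine ⟨θ, θ0, θ4, N + T * V, by positivity, fun v P x K hs hE hPx hK K0 => ?_⟩
  have x0 := hE.nonneg
  have hv := hs.smv
  set I := ∫ z in cy (9 / 16), un v z ^ 3 with hI
  have I0 : 0 ≤ I := integral_nonneg fun z => pow_nonneg (un_nonneg _ _) 3
  have ha := habs x K (bmix v p q) I x0 K0 (bmix_nonneg _ _ _) I0 (hun v P x K hs hE hK K0)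
  have hp := hpd v P x hs hE θ θ0 θ4
  have he := hen v P hs
  set J := ∫ z in cy (9 / 16), (usq v z + un v z ^ 3 + |P z| * un v z) with hJ
  have cP : Continuous fun z => |P z| ^ (3 / 2 : ℝ) :=
    hs.smP.cont.abs.rpow_const fun _ => Or.inr (by norm_num)
  have i1 : IntegrableOn (fun _ : E3 × ℝ => (1 : ℝ)) (cy (9 / 16)) := icy continuous_const _
  have i2 : IntegrableOn (fun z => (2 + (ε ^ 2)⁻¹) * un v z ^ 3) (cy (9 / 16)) :=
    icy (continuous_const.mul ((cont_un hv).pow 3)) _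
  have i3 : IntegrableOn (fun z => ε * |P z| ^ (3 / 2 : ℝ)) (cy (9 / 16)) :=
    icy (continuous_const.mul cP) _
  have hJle : J ≤ V + (2 + (ε ^ 2)⁻¹) * I + ε * x := by
    have h1 : J ≤ ∫ z in cy (9 / 16),
        (1 + (2 + (ε ^ 2)⁻¹) * un v z ^ 3 + ε * |P z| ^ (3 / 2 : ℝ)) := by
      refine integral_mono (icy (((sm_usq hv).cont.add ((cont_un hv).pow 3)).add
        (hs.smP.cont.abs.mul (cont_un hv))) _) ((i1.add i2).add i3) fun z => ?_
      have u0 := un_nonneg v z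
      have y1 := mul_le_mul_rpow_add (abs_nonneg (P z)) u0 ε0
      have y2 : un v z ^ 2 ≤ 1 + un v z ^ 3 := by
        nlinarith [mul_nonneg u0 (sq_nonneg (un v z - 1)), sq_nonneg (un v z - 1)]
      rw [un_sq] at y2
      simp only
      linarith
    have i12 : IntegrableOn (fun z => 1 + (2 + (ε ^ 2)⁻¹) * un v z ^ 3) (cy (9 / 16)) := i1.add i2
    rw [integral_add i12 i3, integral_add i1 i2, integral_const_mul,
      integral_const_mul] at h1
    have h2 : ∫ z in cy (9 / 16), |P z| ^ (3 / 2 : ℝ) ≤ x :=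
      (setIntegral_mono_set (icy cP 1) (.of_forall fun z => by positivity)
        (.of_forall (cy_mono (by norm_num)))).trans hPx
    have := mul_le_mul_of_nonneg_left h2 ε0.le
    linarith
  have J0 : 0 ≤ J := integral_nonneg fun z => by
    have := usq_nonneg v z
    have := un_nonneg v z
    positivity
  have sub : θ ^ 2 ≤ 1 / 4 := by nlinarith
  have eg : ∫ z in cy (θ ^ 2), gsq v z ≤ Ce * J :=
    (setIntegral_mono_set (icy (sm_gsq hv).cont _) (.of_forall fun z => gsq_nonneg _ _)
      (.of_forall (cy_mono sub))).trans he.2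
  refine ⟨θ⁻¹ * (Ce * J), by positivity, fun t t1 t2 => ?_, ?_⟩
  · refine mul_le_mul_of_nonneg_left ((setIntegral_mono_set (ion (slice_cont (sm_usq hv).cont t)
      Metric.isBounded_ball) (.of_forall fun y => usq_nonneg _ _)
      (.of_forall (Metric.ball_subset_ball (by linarith)))).trans
      (he.1 t (by linarith) t2)) (by positivity)
  · have e1 : θ⁻¹ * (∫ z in cy (θ ^ 2), gsq v z) ≤ θ⁻¹ * (Ce * J) :=
      mul_le_mul_of_nonneg_left eg (by positivity)
    have e2 : (θ ^ 2)⁻¹ * (∫ z in cy (θ ^ 2), |P z| ^ (3 / 2 : ℝ)) ≤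
        (θ ^ 2)⁻¹ * (C * θ ^ 3 * x + Kp * (I ^ (1 - a) * x ^ (3 * a / 2))) := by
      refine mul_le_mul_of_nonneg_left (hp.trans ?_) (by positivity)
      have := mul_le_mul_of_nonneg_left hPx (by positivity : 0 ≤ C * θ ^ 3)
      linarith
    have e3 : (θ ^ 2)⁻¹ * (C * θ ^ 3 * x + Kp * (I ^ (1 - a) * x ^ (3 * a / 2))) =
        (C * θ) * x + (θ ^ 2)⁻¹ * Kp * (I ^ (1 - a) * x ^ (3 * a / 2)) := by
      field_simp
    have e4 : T * J ≤ T * V + T * (2 + (ε ^ 2)⁻¹) * I + (T * ε) * x :=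
      (mul_le_mul_of_nonneg_left hJle T0.le).trans_eq (by ring)
    rw [hCθ] at e3
    rw [hTε] at e4
    have e5 : T * J = θ⁻¹ * (Ce * J) + θ⁻¹ * (Ce * J) := by rw [hT]; ring
    have e6 : T * V ≤ T * V * (1 + K ^ 9 + bmix v p q ^ ((6 + 2 * γ) / γ)) := by
      refine le_mul_of_one_le_right (by positivity) ?_
      have := rpow_nonneg (bmix_nonneg v p q) ((6 + 2 * γ) / γ)
      have := pow_nonneg K0 9
      linarith
    set Y := 1 + K ^ 9 + bmix v p q ^ ((6 + 2 * γ) / γ)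
    rw [add_mul]
    linarith

theorem exists_smooth_extension {U S : Set (E3 × ℝ)} (hU : IsOpen U) (hS : IsClosed S)
    (h : S ⊆ U) : ∃ χ : E3 × ℝ → ℝ, (∀ z ∈ S, χ z = 1) ∧
      ∀ f : E3 × ℝ → ℝ, ContDiffOn ℝ (⊤ : ℕ∞) f U → Sm fun z => χ z * f z := by
  obtain ⟨χ, h0, h1, -⟩ := exists_contMDiffMap_zero_one_nhds_of_isClosed
    (modelWithCornersSelf ℝ (E3 × ℝ)) (n := (⊤ : ℕ∞)) hU.isClosed_compl hS
    (disjoint_compl_left_iff_subset.2 h)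
  refine ⟨χ, fun z hz => h1.self_of_nhdsSet z hz, fun f hf => contDiff_iff_contDiffAt.2 fun z => ?_⟩
  by_cases hz : z ∈ U
  · exact χ.contMDiff.contDiff.contDiffAt.mul (hf.contDiffAt (hU.mem_nhds hz))
  · have h2 : ∀ᶠ y in nhds z, χ y = 0 := eventually_nhdsSet_iff_forall.1 h0 z hz
    exact (contDiffAt_const (c := (0 : ℝ))).congr_of_eventuallyEq
      (h2.mono fun y hy => by simp only [hy, zero_mul])

theorem pd_congr {f g : E3 → ℝ} {x : E3} (h : f =ᶠ[nhds x] g) (i : Fin 3) :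
    pd f i x = pd g i x := by
  rw [pd, pd, h.fderiv_eq]

theorem lap_eq {f : E3 × ℝ → ℝ} (hf : Sm f) (x : E3) (t : ℝ) :
    lap (fun y => f (y, t)) x = ∑ i, dX i (dX i f) (x, t) := by
  simp only [lap, pd_eq hf]
  exact Finset.sum_congr rfl fun i _ => pd_eq (hf.dX i) i x t

theorem lap_congr {f g : E3 → ℝ} {x : E3} (h : f =ᶠ[nhds x] g) : lap f x = lap g x :=
  Finset.sum_congr rfl fun i _ => pd_congr
    (h.eventuallyEq_nhds.mono fun _ hy => pd_congr hy i) i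

/-- The rotation about the vertical axis. -/
def rotz (x : E3) (s : ℝ) : E3 :=
  (x 0 * cos s - x 1 * sin s) • ee 0 + (x 0 * sin s + x 1 * cos s) • ee 1 + x 2 • ee 2

theorem rotz_apply (x : E3) (s : ℝ) : rotz x s 0 = x 0 * cos s - x 1 * sin s ∧
    rotz x s 1 = x 0 * sin s + x 1 * cos s ∧ rotz x s 2 = x 2 := by
  simp [rotz, ee]

theorem norm_rotz (x : E3) (s : ℝ) : ‖rotz x s‖ = ‖x‖ := by
  rw [EuclideanSpace.norm_eq, EuclideanSpace.norm_eq]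
  congr 1
  obtain ⟨h0, h1, h2⟩ := rotz_apply x s
  simp only [Fin.sum_univ_three, norm_eq_abs, sq_abs, h0, h1, h2]
  nlinarith [sin_sq_add_cos_sq s]

theorem hasDerivAt_rotz {f : E3 × ℝ → ℝ} (hf : Sm f) (z : E3 × ℝ) :
    HasDerivAt (fun s => f (rotz z.1 s, z.2)) (z.1 0 * dX 1 f z - z.1 1 * dX 0 f z) 0 := by
  have hd : HasDerivAt (rotz z.1) (z.1 0 • ee 1 - z.1 1 • ee 0) 0 := by
    have h0 : HasDerivAt (fun s => z.1 0 * cos s - z.1 1 * sin s) (-z.1 1) 0 := by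
      refine HasDerivAt.congr_deriv (f := fun s => z.1 0 * cos s - z.1 1 * sin s)
        (((hasDerivAt_cos 0).const_mul (z.1 0)).sub ((hasDerivAt_sin 0).const_mul (z.1 1))) ?_
      simp
    have h1 : HasDerivAt (fun s => z.1 0 * sin s + z.1 1 * cos s) (z.1 0) 0 := by
      refine HasDerivAt.congr_deriv (f := fun s => z.1 0 * sin s + z.1 1 * cos s)
        (((hasDerivAt_sin 0).const_mul (z.1 0)).add ((hasDerivAt_cos 0).const_mul (z.1 1))) ?_
      simp
    refine HasDerivAt.congr_deriv (f := rotz z.1)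
      (((h0.smul_const (ee 0)).add (h1.smul_const (ee 1))).add_const (z.1 2 • ee 2)) ?_
    rw [neg_smul]; abel
  have e : rotz z.1 0 = z.1 := by ext i; fin_cases i <;> simp [rotz, ee]
  have hz : ((rotz z.1 0, z.2) : E3 × ℝ) = z := by rw [e]
  have h := (hf.diff (rotz z.1 0, z.2)).hasFDerivAt.comp_hasDerivAt (0 : ℝ)
    (hd.prodMk (hasDerivAt_const (0 : ℝ) z.2))
  rw [hz] at h
  refine HasDerivAt.congr_deriv (f := fun s => f (rotz z.1 s, z.2)) h ?_
  have : ((z.1 0 • ee 1 - z.1 1 • ee 0, 0) : E3 × ℝ) =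
      z.1 0 • (ee 1, (0 : ℝ)) - z.1 1 • (ee 0, (0 : ℝ)) := by ext <;> simp
  rw [this, map_sub, map_smul, map_smul]
  rfl

/-- A continuous function vanishing off the axis vanishes on the axis. -/
theorem eq_zero_of_off_axis {F : E3 × ℝ → ℝ} (hF : Continuous F)
    (h : ∀ z ∈ cy 1, z.1 0 ^ 2 + z.1 1 ^ 2 ≠ 0 → F z = 0) : ∀ z ∈ cy 1, F z = 0 := by
  intro z hz
  by_cases h0 : z.1 0 ^ 2 + z.1 1 ^ 2 = 0
  · have z0 : z.1 0 = 0 := by nlinarith [sq_nonneg (z.1 0), sq_nonneg (z.1 1)]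
    set c : ℝ → E3 × ℝ := fun s => (z.1 + s • ee 0, z.2) with hc
    have cc : Continuous c := by fun_prop
    have c0 : c 0 = z := by simp [hc]
    have hmem : ∀ᶠ s in nhdsWithin (0 : ℝ) {0}ᶜ, F (c s) = 0 := by
      have h1 : ∀ᶠ s in nhds (0 : ℝ), c s ∈ cy 1 :=
        cc.continuousAt.eventually ((isOpen_cy 1).mem_nhds (by rwa [c0]))
      filter_upwards [h1.filter_mono nhdsWithin_le_nhds, self_mem_nhdsWithin] with s hs hs0
      refine h _ hs ?_
      have e0 : (c s).1 0 = s := by simp [hc, ee, z0]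
      rw [e0]
      have : 0 < s ^ 2 := by
        have : s ≠ 0 := hs0
        positivity
      nlinarith [sq_nonneg ((c s).1 1)]
    have t1 : Filter.Tendsto (fun s => F (c s)) (nhdsWithin (0 : ℝ) {0}ᶜ) (nhds (F z)) := by
      have := (hF.comp cc).tendsto 0
      simp only [Function.comp_apply, c0] at this
      exact this.mono_left nhdsWithin_le_nhds
    exact tendsto_nhds_unique (t1.congr' hmem) tendsto_const_nhds
  · exact h z hz h0

theorem mem_cy_one {z : E3 × ℝ} : z ∈ cy 1 ↔ ‖z.1‖ < 1 ∧ -1 < z.2 ∧ z.2 < 0 := by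
  rw [cy_one]; simp

theorem rotz_mem_cy_one {z : E3 × ℝ} (hz : z ∈ cy 1) (s : ℝ) : (rotz z.1 s, z.2) ∈ cy 1 := by
  rw [mem_cy_one] at hz ⊢
  rwa [norm_rotz]

theorem rot_identity {f F : E3 × ℝ → ℝ} (hf : Sm f) (hF : Continuous F) (A : E3 × ℝ → ℝ)
    (h : ∀ z ∈ cy 1, z.1 0 ^ 2 + z.1 1 ^ 2 ≠ 0 →
      ∀ s, f (rotz z.1 s, z.2) = A z * cos s + F z * sin s) :
    ∀ z ∈ cy 1, z.1 0 * dX 1 f z - z.1 1 * dX 0 f z = F z := by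
  intro z hz
  have key := eq_zero_of_off_axis (F := fun z => z.1 0 * dX 1 f z - z.1 1 * dX 0 f z - F z)
    ((((sm_coord 0).cont.mul (hf.dX 1).cont).sub ((sm_coord 1).cont.mul (hf.dX 0).cont)).sub hF)
    (fun z hz hr => ?_) z hz
  · linarith
  · have h1 := hasDerivAt_rotz hf z
    have h2 : HasDerivAt (fun s => A z * cos s + F z * sin s) (F z) 0 := by
      refine HasDerivAt.congr_deriv (f := fun s => A z * cos s + F z * sin s)
        (((hasDerivAt_cos 0).const_mul (A z)).add ((hasDerivAt_sin 0).const_mul (F z))) ?_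
      simp
    rw [show (fun s => f (rotz z.1 s, z.2)) = fun s => A z * cos s + F z * sin s from
      funext (h z hz hr)] at h1
    rw [h1.unique h2, sub_self]

theorem exists_sol {u : E3 → ℝ → E3} {P : E3 → ℝ → ℝ} {U : Set (E3 × ℝ)} (h : IsNSQ1 u P U)
    (hax : IsAxisym u P U) : ∃ v p, Sol v p ∧ ∀ z ∈ cy 1,
      (∀ j, u z.1 z.2 j = v j z) ∧ P z.1 z.2 = p z := by
  obtain ⟨χ, h1, hχ⟩ := exists_smooth_extension h.open_U isClosed_closure h.subset_U
  have eQ : Qyl (0, 0) 1 = cy 1 := by rw [cy_one]; simp [Qyl]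
  rw [eQ] at h1
  have hU : cy 1 ⊆ U := fun z hz => h.subset_U (by rw [eQ]; exact subset_closure hz)
  have c1 : ∀ z ∈ cy 1, χ z = 1 := fun z hz => h1 z (subset_closure hz)
  set v : Fin 3 → E3 × ℝ → ℝ := fun j z => χ z * u z.1 z.2 j with hvd
  set p : E3 × ℝ → ℝ := fun z => χ z * P z.1 z.2 with hpd
  have hv : ∀ j, Sm (v j) := fun j => hχ _ (contDiffOn_euclidean.1 h.smooth_u j)
  have hp : Sm p := hχ _ h.smooth_P
  have ev : ∀ z ∈ cy 1, ∀ j, u z.1 z.2 j = v j z := fun z hz j => by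
    simp only [hvd, c1 z hz, one_mul]
  have ep : ∀ z ∈ cy 1, P z.1 z.2 = p z := fun z hz => by
    simp only [hpd, c1 z hz, one_mul]
  have nx : ∀ x t, ((x, t) : E3 × ℝ) ∈ cy 1 → ∀ᶠ y in nhds x, ((y, t) : E3 × ℝ) ∈ cy 1 :=
    fun x t hz => (by fun_prop : Continuous fun y : E3 => (y, t)).continuousAt.eventually
      ((isOpen_cy 1).mem_nhds hz)
  have nt : ∀ x t, ((x, t) : E3 × ℝ) ∈ cy 1 → ∀ᶠ s in nhds t, ((x, s) : E3 × ℝ) ∈ cy 1 :=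
    fun x t hz => (by fun_prop : Continuous fun s : ℝ => (x, s)).continuousAt.eventually
      ((isOpen_cy 1).mem_nhds hz)
  have ex : ∀ x t, ((x, t) : E3 × ℝ) ∈ cy 1 → ∀ j,
      (fun y => u y t j) =ᶠ[nhds x] fun y => v j (y, t) := fun x t hz j =>
    (nx x t hz).mono fun y hy => ev _ hy j
  obtain ⟨ur, uθ, u3, pp, hcyl⟩ := hax
  have hrot : ∀ z ∈ cy 1, z.1 0 ^ 2 + z.1 1 ^ 2 ≠ 0 → ∀ s,
      v 0 (rotz z.1 s, z.2) = v 0 z * cos s + -v 1 z * sin s ∧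
      v 1 (rotz z.1 s, z.2) = v 1 z * cos s + v 0 z * sin s ∧
      p (rotz z.1 s, z.2) = p z := by
    intro z hz hr s
    obtain ⟨r0, r1, r2⟩ := rotz_apply z.1 s
    have hz' := rotz_mem_cy_one hz s
    have er : (rotz z.1 s) 0 ^ 2 + (rotz z.1 s) 1 ^ 2 = z.1 0 ^ 2 + z.1 1 ^ 2 := by
      rw [r0, r1]; nlinarith [sin_sq_add_cos_sq s]
    obtain ⟨a0, a1, -, a3⟩ := hcyl z.1 z.2 (hU hz) hr
    obtain ⟨b0, b1, -, b3⟩ := hcyl (rotz z.1 s) z.2 (hU hz') (by rwa [er])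
    rw [er, r2] at b0 b1 b3
    rw [r0, r1] at b0 b1
    have f0 := ev _ hz' 0
    have f1 := ev _ hz' 1
    have f3 := ep _ hz'
    simp only at f0 f1 f3
    rw [← f0, ← f1, ← f3, ← ev z hz 0, ← ev z hz 1, ← ep z hz, a0, a1, a3, b0, b1, b3]
    exact ⟨by ring, by ring, rfl⟩
  refine ⟨v, p, ⟨hv, hp, fun z z1 z2 z3 j => ?_, fun z z1 z2 z3 => ?_, fun z z1 z2 z3 => ?_,
    fun z z1 z2 z3 => ?_, fun z z1 z2 z3 => ?_⟩, fun z hz => ⟨ev z hz, ep z hz⟩⟩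
  · have hz : (z.1, z.2) ∈ cy 1 := mem_cy_one.2 ⟨z1, z2, z3⟩
    have hm := h.momentum z.1 z.2 (hU hz) j
    have et : (fun s => u z.1 s j) =ᶠ[nhds z.2] fun s => v j (z.1, s) :=
      (nt _ _ hz).mono fun s hs => ev _ hs j
    have epx : (fun y => P y z.2) =ᶠ[nhds z.1] fun y => p (y, z.2) :=
      (nx _ _ hz).mono fun y hy => ep _ hy
    rw [et.deriv_eq, (hasDerivAt_time (hv j) z.1 z.2).deriv, lap_congr (ex _ _ hz j),
      lap_eq (hv j), pd_congr epx, pd_eq hp] at hm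
    simp only [pd_congr (ex _ _ hz j), pd_eq (hv j), ev z hz] at hm
    exact hm
  · have hz : (z.1, z.2) ∈ cy 1 := mem_cy_one.2 ⟨z1, z2, z3⟩
    have hm := h.divfree z.1 z.2 (hU hz)
    simp only [pd_congr (ex _ _ hz _), pd_eq (hv _)] at hm
    exact hm
  · exact rot_identity (hv 0) (F := fun z => -v 1 z) (hv 1).cont.neg (v 0)
      (fun z hz hr s => (hrot z hz hr s).1) z (mem_cy_one.2 ⟨z1, z2, z3⟩)
  · exact rot_identity (hv 1) (F := v 0) (hv 0).cont (v 1)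
      (fun z hz hr s => (hrot z hz hr s).2.1) z (mem_cy_one.2 ⟨z1, z2, z3⟩)
  · have hz : z ∈ cy 1 := mem_cy_one.2 ⟨z1, z2, z3⟩
    have key := eq_zero_of_off_axis (F := fun z => z.1 0 * dX 1 p z - z.1 1 * dX 0 p z)
      (((sm_coord 0).cont.mul (hp.dX 1).cont).sub ((sm_coord 1).cont.mul (hp.dX 0).cont))
      (fun z hz hr => ?_) z hz
    · exact key
    · have h1 := hasDerivAt_rotz hp z
      rw [show (fun s => p (rotz z.1 s, z.2)) = fun _ => p z from
        funext fun s => (hrot z hz hr s).2.2] at h1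
      exact h1.unique (hasDerivAt_const _ _)

section Affine

variable {E : Type*} [NormedAddCommGroup E] [NormedSpace ℝ E] [MeasurableSpace E] [BorelSpace E]

theorem measurableEmbedding_affine (a : E) {R : ℝ} (hR : 0 < R) :
    MeasurableEmbedding (fun y : E => a + R • y) :=
  ((Homeomorph.smulOfNeZero R hR.ne').trans (Homeomorph.addLeft a)).measurableEmbedding

theorem map_affine_restrict [FiniteDimensional ℝ E] (μ : Measure E) [μ.IsAddHaarMeasure] (a : E)
    {R : ℝ} (hR : 0 < R) (T : Set E) :
    Measure.map (fun y : E => a + R • y) (μ.restrict ((fun y : E => a + R • y) ⁻¹' T)) =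
      ENNReal.ofReal ((R ^ Module.finrank ℝ E)⁻¹) • μ.restrict T := by
  have h : Measure.map (fun y : E => a + R • y) μ =
      ENNReal.ofReal ((R ^ Module.finrank ℝ E)⁻¹) • μ := by
    have e : (fun y : E => a + R • y) = (fun y => a + y) ∘ (fun y => R • y) := rfl
    rw [e, ← Measure.map_map (measurable_const_add a) (measurable_const_smul R),
      Measure.map_addHaar_smul μ hR.ne', Measure.map_smul, map_add_left_eq_self,
      abs_of_pos (by positivity)]
  rw [← (measurableEmbedding_affine a hR).restrict_map, h, Measure.restrict_smul]

theorem setIntegral_affine [FiniteDimensional ℝ E] (μ : Measure E) [μ.IsAddHaarMeasure] (a : E)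
    {R : ℝ} (hR : 0 < R) (T : Set E) (f : E → ℝ) :
    ∫ y in (fun y : E => a + R • y) ⁻¹' T, f (a + R • y) ∂μ =
      (R ^ Module.finrank ℝ E)⁻¹ * ∫ x in T, f x ∂μ := by
  rw [← (measurableEmbedding_affine a hR).integral_map f, map_affine_restrict μ a hR,
    integral_smul_measure, ENNReal.toReal_ofReal (by positivity), smul_eq_mul]

theorem eLpNorm_affine [FiniteDimensional ℝ E] (μ : Measure E) [μ.IsAddHaarMeasure] (a : E)
    {R : ℝ} (hR : 0 < R) (T : Set E) (f : E → ℝ) (p : ℝ≥0∞) :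
    (eLpNorm (fun y => f (a + R • y)) p
        (μ.restrict ((fun y : E => a + R • y) ⁻¹' T))).toReal =
      R ^ (-(Module.finrank ℝ E / p.toReal)) * (eLpNorm f p (μ.restrict T)).toReal := by
  have h := (measurableEmbedding_affine a hR).eLpNorm_map_measure (g := f) (p := p)
    (μ := μ.restrict ((fun y : E => a + R • y) ⁻¹' T))
  rw [show (fun y => f (a + R • y)) = f ∘ (fun y : E => a + R • y) from rfl, ← h,
    map_affine_restrict μ a hR, eLpNorm_smul_measure_of_ne_zero
      (by rw [ne_eq, ENNReal.ofReal_eq_zero, not_le]; positivity), smul_eq_mul,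
    ENNReal.toReal_mul, ← ENNReal.toReal_rpow, ENNReal.toReal_ofReal (by positivity)]
  congr 1
  rw [← Real.rpow_natCast, ← Real.rpow_neg hR.le, ← Real.rpow_mul hR.le, one_div,
    ENNReal.toReal_inv]
  congr 1
  ring

end Affine

theorem preimage_affine_ball (a : E3) {R : ℝ} (hR : 0 < R) (ρ : ℝ) :
    (fun y : E3 => a + R • y) ⁻¹' Metric.ball a (R * ρ) = Metric.ball 0 ρ := by
  ext y
  simp only [mem_preimage, Metric.mem_ball, dist_self_add_left, norm_smul, norm_eq_abs,
    abs_of_pos hR, dist_zero_right]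
  exact mul_lt_mul_iff_right₀ hR

theorem preimage_affine_Ioo (a : ℝ) {R : ℝ} (hR : 0 < R) (ρ : ℝ) :
    (fun s : ℝ => a + R ^ 2 • s) ⁻¹' Ioo (a - (R * ρ) ^ 2) a = Ioo (-ρ ^ 2) 0 := by
  ext s
  simp only [mem_preimage, mem_Ioo, smul_eq_mul]
  have h : 0 < R ^ 2 := by positivity
  constructor
  · rintro ⟨h1, h2⟩
    exact ⟨by by_contra! h3; nlinarith, by by_contra! h3; nlinarith⟩
  · rintro ⟨h1, h2⟩
    exact ⟨by nlinarith, by nlinarith⟩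

theorem ball_integral_affine (a : E3) {R : ℝ} (hR : 0 < R) (ρ : ℝ) (f : E3 → ℝ) :
    ∫ y in Metric.ball 0 ρ, f (a + R • y) =
      (R ^ 3)⁻¹ * ∫ x in Metric.ball a (R * ρ), f x := by
  rw [← preimage_affine_ball a hR, setIntegral_affine volume a hR]
  simp

theorem Ioo_integral_affine (a : ℝ) {R : ℝ} (hR : 0 < R) (ρ : ℝ) (f : ℝ → ℝ) :
    ∫ s in Ioo (-ρ ^ 2) 0, f (a + R ^ 2 * s) =
      (R ^ 2)⁻¹ * ∫ t in Ioo (a - (R * ρ) ^ 2) a, f t := by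
  have h := setIntegral_affine volume a (pow_pos hR 2) (Ioo (a - (R * ρ) ^ 2) a) f
  rw [preimage_affine_Ioo a hR] at h
  simpa using h

theorem cylinder_integral_affine (a : E3) (b : ℝ) {R : ℝ} (hR : 0 < R) (ρ : ℝ)
    (f : E3 → ℝ → ℝ) :
    ∫ s in Ioo (-ρ ^ 2) 0, ∫ y in Metric.ball 0 ρ, f (a + R • y) (b + R ^ 2 * s) =
      (R ^ 5)⁻¹ * ∫ t in Ioo (b - (R * ρ) ^ 2) b, ∫ x in Metric.ball a (R * ρ), f x t := by
  simp_rw [fun t => ball_integral_affine a hR ρ (fun x => f x t)]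
  rw [integral_const_mul, Ioo_integral_affine b hR ρ
    (fun t => ∫ x in Metric.ball a (R * ρ), f x t), ← mul_assoc, ← mul_inv]
  ring_nf

theorem eLpNorm_ball_affine (a : E3) {R : ℝ} (hR : 0 < R) (f : E3 → ℝ) (p : ℝ≥0∞) :
    (eLpNorm (fun y => f (a + R • y)) p (volume.restrict (Metric.ball 0 1))).toReal =
      R ^ (-(3 / p.toReal)) * (eLpNorm f p (volume.restrict (Metric.ball a R))).toReal := by
  have h := eLpNorm_affine volume a hR (Metric.ball a (R * 1)) f p
  rw [preimage_affine_ball a hR] at h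
  simpa using h

theorem eLpNorm_Ioo_affine (a : ℝ) {R : ℝ} (hR : 0 < R) (f : ℝ → ℝ) (q : ℝ≥0∞) :
    (eLpNorm (fun s => f (a + R ^ 2 * s)) q (volume.restrict (Ioo (-1) 0))).toReal =
      R ^ (-(2 / q.toReal)) * (eLpNorm f q (volume.restrict (Ioo (a - R ^ 2) a))).toReal := by
  have h := eLpNorm_affine volume a (pow_pos hR 2) (Ioo (a - (R * 1) ^ 2) a) f q
  rw [preimage_affine_Ioo a hR, ← Real.rpow_natCast, ← Real.rpow_mul hR.le] at h
  simp only [Module.finrank_self, Nat.cast_one, Nat.cast_ofNat, one_pow, mul_one, smul_eq_mul,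
    Real.rpow_ofNat] at h
  rw [h]
  congr 2
  ring

/-- The parabolic rescaling of a function around a point. -/
def resc (a : E3) (b R : ℝ) (f : E3 × ℝ → ℝ) (z : E3 × ℝ) : ℝ := f (a + R • z.1, b + R ^ 2 * z.2)

theorem sm_resc {f : E3 × ℝ → ℝ} (hf : Sm f) (a : E3) (b R : ℝ) : Sm (resc a b R f) :=
  hf.comp (by fun_prop : ContDiff ℝ _ fun z : E3 × ℝ => (a + R • z.1, b + R ^ 2 * z.2))

theorem dX_resc {f : E3 × ℝ → ℝ} (hf : Sm f) (a : E3) (b R : ℝ) (i : Fin 3) (z : E3 × ℝ) :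
    dX i (resc a b R f) z = R * resc a b R (dX i f) z := by
  have h1 : HasFDerivAt (fun z : E3 × ℝ => (a + R • z.1, b + R ^ 2 * z.2))
      ((R • ContinuousLinearMap.fst ℝ E3 ℝ).prod (R ^ 2 • ContinuousLinearMap.snd ℝ E3 ℝ)) z :=
    ((hasFDerivAt_fst.const_smul R).const_add a).prodMk
      ((hasFDerivAt_snd.const_mul (R ^ 2)).const_add b)
  have h2 := (hf.diff (a + R • z.1, b + R ^ 2 * z.2)).hasFDerivAt.comp z h1
  have h3 : HasFDerivAt (resc a b R f) _ z := h2
  rw [dX, h3.fderiv]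
  simp only [ContinuousLinearMap.comp_apply, ContinuousLinearMap.prod_apply, smul_apply,
    ContinuousLinearMap.coe_fst', ContinuousLinearMap.coe_snd', smul_zero, dX, resc]
  rw [show (R • ee i, (0 : ℝ)) = R • (ee i, (0 : ℝ)) by simp, map_smul, smul_eq_mul]

theorem dT_resc {f : E3 × ℝ → ℝ} (hf : Sm f) (a : E3) (b R : ℝ) (z : E3 × ℝ) :
    dT (resc a b R f) z = R ^ 2 * resc a b R (dT f) z := by
  have h1 : HasFDerivAt (fun z : E3 × ℝ => (a + R • z.1, b + R ^ 2 * z.2))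
      ((R • ContinuousLinearMap.fst ℝ E3 ℝ).prod (R ^ 2 • ContinuousLinearMap.snd ℝ E3 ℝ)) z :=
    ((hasFDerivAt_fst.const_smul R).const_add a).prodMk
      ((hasFDerivAt_snd.const_mul (R ^ 2)).const_add b)
  have h2 := (hf.diff (a + R • z.1, b + R ^ 2 * z.2)).hasFDerivAt.comp z h1
  have h3 : HasFDerivAt (resc a b R f) _ z := h2
  rw [dT, h3.fderiv]
  simp only [ContinuousLinearMap.comp_apply, ContinuousLinearMap.prod_apply, smul_apply,
    ContinuousLinearMap.coe_fst', ContinuousLinearMap.coe_snd', smul_zero, dT, resc]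
  rw [show ((0 : E3), R ^ 2 • (1 : ℝ)) = R ^ 2 • ((0 : E3), (1 : ℝ)) by simp, map_smul,
    smul_eq_mul]

/-- The parabolic rescaling of a velocity field. -/
def rescV (a : E3) (b R : ℝ) (v : Fin 3 → E3 × ℝ → ℝ) (j : Fin 3) (z : E3 × ℝ) : ℝ :=
  R * resc a b R (v j) z

/-- The parabolic rescaling of a pressure. -/
def rescP (a : E3) (b R : ℝ) (P : E3 × ℝ → ℝ) (z : E3 × ℝ) : ℝ := R ^ 2 * resc a b R P z

theorem dX_const_mul (c : ℝ) {f : E3 × ℝ → ℝ} (hf : Sm f) (i : Fin 3) :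
    dX i (fun z => c * f z) = fun z => c * dX i f z := by
  funext z
  simp only [dX]
  rw [fderiv_const_mul (hf.diff z)]; rfl

theorem dX_rescV {v : Fin 3 → E3 × ℝ → ℝ} (hv : ∀ j, Sm (v j)) (a : E3) (b R : ℝ) (i j : Fin 3) :
    dX i (rescV a b R v j) = fun z => R ^ 2 * resc a b R (dX i (v j)) z := by
  rw [show rescV a b R v j = fun z => R * resc a b R (v j) z from rfl,
    dX_const_mul R (sm_resc (hv j) a b R)]
  funext z
  rw [dX_resc (hv j)]; ring

theorem affine_mem {a : E3} {b R : ℝ} (hR : 0 < R) (ha : ‖a‖ + R ≤ 1) (hb : -1 ≤ b - R ^ 2)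
    (hb' : b ≤ 0) {z : E3 × ℝ} (h1 : ‖z.1‖ < 1) (h2 : -1 < z.2) (h3 : z.2 < 0) :
    ‖a + R • z.1‖ < 1 ∧ -1 < b + R ^ 2 * z.2 ∧ b + R ^ 2 * z.2 < 0 := by
  have hR2 : 0 < R ^ 2 := by positivity
  have h := norm_add_le a (R • z.1)
  rw [norm_smul, norm_eq_abs, abs_of_pos hR] at h
  exact ⟨by nlinarith, by nlinarith, by nlinarith⟩

theorem sol_resc {v : Fin 3 → E3 × ℝ → ℝ} {P : E3 × ℝ → ℝ} (hs : Sol v P) {a : E3} {b R : ℝ}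
    (hR : 0 < R) (ha : ‖a‖ + R ≤ 1) (hb : -1 ≤ b - R ^ 2) (hb' : b ≤ 0) (a0 : a 0 = 0)
    (a1 : a 1 = 0) : Sol (rescV a b R v) (rescP a b R P) := by
  have hv := hs.smv
  have hP := hs.smP
  have eP : ∀ i, dX i (rescP a b R P) = fun z => R ^ 3 * resc a b R (dX i P) z := fun i => by
    rw [show rescP a b R P = fun z => R ^ 2 * resc a b R P z from rfl,
      dX_const_mul _ (sm_resc hP a b R)]
    funext z
    rw [dX_resc hP]; ring
  have eT : ∀ j z, dT (rescV a b R v j) z = R ^ 3 * resc a b R (dT (v j)) z := fun j z => by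
    have : dT (rescV a b R v j) z = R * dT (resc a b R (v j)) z := by
      simp only [dT]
      rw [show rescV a b R v j = fun z => R * resc a b R (v j) z from rfl,
        fderiv_const_mul ((sm_resc (hv j) a b R).diff z)]
      rfl
    rw [this, dT_resc (hv j)]; ring
  have e2 : ∀ i j z, dX i (dX i (rescV a b R v j)) z =
      R ^ 3 * resc a b R (dX i (dX i (v j))) z := fun i j z => by
    rw [dX_rescV hv, dX_const_mul _ (sm_resc ((hv j).dX i) a b R)]
    simp only [dX_resc ((hv j).dX i)]; ring
  have eV := dX_rescV hv a b R
  have m0 : ∀ z : E3 × ℝ, (a + R • z.1) 0 = R * z.1 0 := fun z => by simp [a0]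
  have m1 : ∀ z : E3 × ℝ, (a + R • z.1) 1 = R * z.1 1 := fun z => by simp [a1]
  refine ⟨fun j => contDiff_const.mul (sm_resc (hv j) a b R),
    contDiff_const.mul (sm_resc hP a b R), fun z z1 z2 z3 j => ?_, fun z z1 z2 z3 => ?_,
    fun z z1 z2 z3 => ?_, fun z z1 z2 z3 => ?_, fun z z1 z2 z3 => ?_⟩ <;>
    obtain ⟨w1, w2, w3⟩ := affine_mem hR ha hb hb' z1 z2 z3
  · have h := hs.mom (a + R • z.1, b + R ^ 2 * z.2) w1 w2 w3 j
    simp only [eT, e2, eP]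
    simp only [eV, rescV, resc, Fin.sum_univ_three] at h ⊢
    linear_combination R ^ 3 * h
  · have h := hs.div (a + R • z.1, b + R ^ 2 * z.2) w1 w2 w3
    simp only [eV, resc, Fin.sum_univ_three] at h ⊢
    linear_combination R ^ 2 * h
  · have h := hs.rot0 (a + R • z.1, b + R ^ 2 * z.2) w1 w2 w3
    simp only [m0, m1] at h
    simp only [eV, resc, rescV]
    linear_combination R * h
  · have h := hs.rot1 (a + R • z.1, b + R ^ 2 * z.2) w1 w2 w3
    simp only [m0, m1] at h
    simp only [eV, resc, rescV]
    linear_combination R * h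
  · have h := hs.rotP (a + R • z.1, b + R ^ 2 * z.2) w1 w2 w3
    simp only [m0, m1] at h
    simp only [eP, resc]
    linear_combination R ^ 2 * h

theorem usq_rescV (v : Fin 3 → E3 × ℝ → ℝ) (a : E3) (b R : ℝ) (z : E3 × ℝ) :
    usq (rescV a b R v) z = R ^ 2 * usq v (a + R • z.1, b + R ^ 2 * z.2) := by
  simp only [usq, rescV, resc, mul_pow, Finset.mul_sum]

theorem gsq_rescV {v : Fin 3 → E3 × ℝ → ℝ} (hv : ∀ j, Sm (v j)) (a : E3) (b R : ℝ) (z : E3 × ℝ) :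
    gsq (rescV a b R v) z = R ^ 4 * gsq v (a + R • z.1, b + R ^ 2 * z.2) := by
  simp only [gsq, dX_rescV hv, resc, mul_pow, Finset.mul_sum, ← pow_mul]

theorem gam_rescV (v : Fin 3 → E3 × ℝ → ℝ) {a : E3} (a0 : a 0 = 0) (a1 : a 1 = 0) (b R : ℝ)
    (z : E3 × ℝ) : gam (rescV a b R v) z = gam v (a + R • z.1, b + R ^ 2 * z.2) := by
  simp [gam, rescV, resc, a0, a1]
  ring

theorem bn_rescV (v : Fin 3 → E3 × ℝ → ℝ) {a : E3} (a0 : a 0 = 0) (a1 : a 1 = 0) (b : ℝ) {R : ℝ}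
    (hR : 0 < R) (z : E3 × ℝ) :
    bn (rescV a b R v) z = R * bn v (a + R • z.1, b + R ^ 2 * z.2) := by
  rw [bn, bn, usq_rescV, gam_rescV v a0 a1, ← Real.sqrt_sq hR.le, ← Real.sqrt_mul (sq_nonneg R),
    Real.sqrt_sq hR.le]
  congr 1
  have m0 : (a + R • z.1) 0 = R * z.1 0 := by simp [a0]
  have m1 : (a + R • z.1) 1 = R * z.1 1 := by simp [a1]
  simp only [m0, m1]
  have hR0 := hR.ne'
  rw [mul_sub]
  congr 1
  rw [← mul_div_assoc, mul_pow, mul_pow, ← mul_add, mul_div_mul_left _ _ (pow_ne_zero 2 hR0)]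

theorem le_biSup_of_le {I : Set ℝ} {g : ℝ → ℝ} {M : ℝ} (hM : ∀ t ∈ I, g t ≤ M) {t : ℝ}
    (ht : t ∈ I) : g t ≤ ⨆ t ∈ I, g t := by
  have hb : BddAbove (range fun t => ⨆ _ : t ∈ I, g t) := by
    refine ⟨max M 0, ?_⟩
    rintro _ ⟨s, rfl⟩
    exact Real.iSup_le (fun hs => (hM s hs).trans (le_max_left _ _)) (le_max_right _ _)
  have h := le_ciSup hb t
  simpa only [ciSup_pos ht] using h

/-- The pair `(u, P)` agrees with the smooth pair `(v, p)` on the unit cylinder. -/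
def AgreeOn (u : E3 → ℝ → E3) (P : E3 → ℝ → ℝ) (v : Fin 3 → E3 × ℝ → ℝ) (p : E3 × ℝ → ℝ) : Prop :=
  ∀ z ∈ cy 1, (∀ j, u z.1 z.2 j = v j z) ∧ P z.1 z.2 = p z

section Agree

variable {u : E3 → ℝ → E3} {P : E3 → ℝ → ℝ} {v : Fin 3 → E3 × ℝ → ℝ} {p : E3 × ℝ → ℝ}

theorem AgreeOn.norm_sq (h : AgreeOn u P v p) {z : E3 × ℝ} (hz : z ∈ cy 1) :
    ‖u z.1 z.2‖ ^ 2 = usq v z := by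
  rw [EuclideanSpace.real_norm_sq_eq, usq]
  exact Finset.sum_congr rfl fun j _ => by rw [(h z hz).1 j]

theorem AgreeOn.sum_pd_sq (h : AgreeOn u P v p) (hv : ∀ j, Sm (v j)) {z : E3 × ℝ}
    (hz : z ∈ cy 1) : ∑ j, ∑ i, (pd (fun y => u y z.2 j) i z.1) ^ 2 = gsq v z := by
  have nx : ∀ᶠ y in nhds z.1, ((y, z.2) : E3 × ℝ) ∈ cy 1 :=
    (by fun_prop : Continuous fun y : E3 => (y, z.2)).continuousAt.eventually
      ((isOpen_cy 1).mem_nhds hz)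
  have ex : ∀ j, (fun y => u y z.2 j) =ᶠ[nhds z.1] fun y => v j (y, z.2) := fun j =>
    nx.mono fun y hy => (h _ hy).1 j
  simp only [pd_congr (ex _), pd_eq (hv _), gsq]

theorem AgreeOn.bnorm_eq (h : AgreeOn u P v p) {z : E3 × ℝ} (hz : z ∈ cy 1) :
    bnorm u z.1 z.2 = bn v z := by
  have e := (h z hz).1
  have eG : Gam u z.1 z.2 = gam v z := by simp only [Gam, gam, e]
  rw [bnorm, bn]
  congr 1
  simp only [bcomp, Fin.sum_univ_three, Matrix.cons_val_zero, Matrix.cons_val_one,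
    Matrix.cons_val, usq, e, eG]
  rcases eq_or_ne (z.1 0 ^ 2 + z.1 1 ^ 2) 0 with h0 | h0
  · simp [h0]
  · field_simp
    simp only [gam]
    ring

variable {a : E3} {b R : ℝ}

theorem affine_mem_cy_one (hR : 0 < R) (ha : ‖a‖ + R ≤ 1) (hb : -1 ≤ b - R ^ 2) (hb' : b ≤ 0)
    {y : E3} (hy : y ∈ Metric.ball (0 : E3) 1) {s : ℝ} (h1 : -1 < s) (h2 : s < 0) :
    ((a + R • y, b + R ^ 2 * s) : E3 × ℝ) ∈ cy 1 :=
  mem_cy_one.2 (affine_mem hR ha hb hb' (z := (y, s)) (by simpa using hy) h1 h2)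

theorem neg_one_lt_of_neg_sq_lt {ρ s : ℝ} (hρ : 0 < ρ) (hρ1 : ρ ≤ 1) (h : -ρ ^ 2 < s) :
    -1 < s := by
  nlinarith

theorem slice_rescV (h : AgreeOn u P v p) (hR : 0 < R) (ha : ‖a‖ + R ≤ 1) (hb : -1 ≤ b - R ^ 2)
    (hb' : b ≤ 0) {ρ : ℝ} (hρ : 0 < ρ) (hρ1 : ρ ≤ 1) {s : ℝ} (h1 : -ρ ^ 2 < s) (h2 : s < 0) :
    ρ⁻¹ * ∫ y in Metric.ball 0 ρ, usq (rescV a b R v) (y, s) =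
      (R * ρ)⁻¹ * ∫ x in Metric.ball a (R * ρ), ‖u x (b + R ^ 2 * s)‖ ^ 2 := by
  have e : ∫ y in Metric.ball 0 ρ, usq (rescV a b R v) (y, s) =
      ∫ y in Metric.ball 0 ρ, R ^ 2 * ‖u (a + R • y) (b + R ^ 2 * s)‖ ^ 2 := by
    refine setIntegral_congr_fun measurableSet_ball fun y hy => ?_
    have hz := affine_mem_cy_one hR ha hb hb' (Metric.ball_subset_ball hρ1 hy)
      (neg_one_lt_of_neg_sq_lt hρ hρ1 h1) h2
    simp only [usq_rescV]
    rw [← h.norm_sq hz]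
  rw [e, integral_const_mul, ball_integral_affine a hR ρ fun x => ‖u x (b + R ^ 2 * s)‖ ^ 2]
  field_simp

theorem EE_resc (h : AgreeOn u P v p) (hv : ∀ j, Sm (v j)) (hR : 0 < R) (ha : ‖a‖ + R ≤ 1)
    (hb : -1 ≤ b - R ^ 2) (hb' : b ≤ 0) {ρ : ℝ} (hρ : 0 < ρ) (hρ1 : ρ ≤ 1) :
    EE u (a, b) (R * ρ) = ρ⁻¹ * ∫ z in cy (ρ ^ 2), gsq (rescV a b R v) z := by
  have sv : ∀ j, Sm (rescV a b R v j) := fun j => contDiff_const.mul (sm_resc (hv j) a b R)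
  have e : ∫ z in cy (ρ ^ 2), gsq (rescV a b R v) z =
      ∫ s in Ioo (-ρ ^ 2) 0, ∫ y in Metric.ball 0 ρ,
        R ^ 4 * ∑ j, ∑ i, (pd (fun y => u y (b + R ^ 2 * s) j) i (a + R • y)) ^ 2 := by
    rw [cy_sq hρ.le, setInt_prod_symm (sm_gsq sv).cont]
    refine setIntegral_congr_fun measurableSet_Ioo fun s hs => ?_
    refine setIntegral_congr_fun measurableSet_ball fun y hy => ?_
    have hz := affine_mem_cy_one hR ha hb hb' (Metric.ball_subset_ball hρ1 hy)
      (neg_one_lt_of_neg_sq_lt hρ hρ1 hs.1) hs.2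
    simp only [gsq_rescV hv]
    rw [← h.sum_pd_sq hv hz]
  rw [e, cylinder_integral_affine a b hR ρ
    fun x t => R ^ 4 * ∑ j, ∑ i, (pd (fun y => u y t j) i x) ^ 2, EE]
  simp only [integral_const_mul]
  field_simp

theorem DD_resc (h : AgreeOn u P v p) (hp : Sm p) (hR : 0 < R) (ha : ‖a‖ + R ≤ 1)
    (hb : -1 ≤ b - R ^ 2) (hb' : b ≤ 0) {ρ : ℝ} (hρ : 0 < ρ) (hρ1 : ρ ≤ 1) :
    DD P (a, b) (R * ρ) =
      (ρ ^ 2)⁻¹ * ∫ z in cy (ρ ^ 2), |rescP a b R p z| ^ (3 / 2 : ℝ) := by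
  have sp : Sm (rescP a b R p) := contDiff_const.mul (sm_resc hp a b R)
  have hc : Continuous fun z => |rescP a b R p z| ^ (3 / 2 : ℝ) :=
    sp.cont.abs.rpow_const fun _ => Or.inr (by norm_num)
  have e : ∫ z in cy (ρ ^ 2), |rescP a b R p z| ^ (3 / 2 : ℝ) =
      ∫ s in Ioo (-ρ ^ 2) 0, ∫ y in Metric.ball 0 ρ,
        R ^ 3 * |P (a + R • y) (b + R ^ 2 * s)| ^ (3 / 2 : ℝ) := by
    rw [cy_sq hρ.le, setInt_prod_symm hc]
    refine setIntegral_congr_fun measurableSet_Ioo fun s hs => ?_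
    refine setIntegral_congr_fun measurableSet_ball fun y hy => ?_
    have hz := affine_mem_cy_one hR ha hb hb' (Metric.ball_subset_ball hρ1 hy)
      (neg_one_lt_of_neg_sq_lt hρ hρ1 hs.1) hs.2
    have e1 := (h _ hz).2
    simp only at e1
    simp only [rescP, resc]
    rw [e1, abs_mul, abs_of_pos (pow_pos hR 2), mul_rpow (by positivity) (abs_nonneg _),
      ← Real.rpow_natCast R 2, ← Real.rpow_mul hR.le, ← Real.rpow_natCast R 3]
    norm_num
  rw [e, cylinder_integral_affine a b hR ρ
    fun x t => R ^ 3 * |P x t| ^ (3 / 2 : ℝ), DD]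
  simp only [integral_const_mul]
  field_simp

theorem Gfun_resc (h : AgreeOn u P v p) (hR : 0 < R) (ha : ‖a‖ + R ≤ 1)
    (hb : -1 ≤ b - R ^ 2) (hb' : b ≤ 0) (a0 : a 0 = 0) (a1 : a 1 = 0) (p' q : ℝ≥0∞) :
    Gfun u p' q (a, b) R = bmix (rescV a b R v) p' q := by
  set F : ℝ → ℝ := fun t =>
    (eLpNorm (fun x => bnorm u x t) p' (volume.restrict (Metric.ball a R))).toReal with hF
  have e : ∀ s ∈ Ioo (-1 : ℝ) 0, bslice (rescV a b R v) p' s =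
      R ^ (1 - 3 / p'.toReal) * F (b + R ^ 2 * s) := by
    intro s hs
    have e1 : eLpNorm (fun y => bn (rescV a b R v) (y, s)) p'
        (volume.restrict (Metric.ball 0 1)) =
        eLpNorm (R • fun y => bnorm u (a + R • y) (b + R ^ 2 * s)) p'
          (volume.restrict (Metric.ball 0 1)) := by
      refine eLpNorm_congr_ae ?_
      filter_upwards [ae_restrict_mem measurableSet_ball] with y hy
      have hz := affine_mem_cy_one hR ha hb hb' hy hs.1 hs.2
      rw [bn_rescV v a0 a1 b hR, Pi.smul_apply, smul_eq_mul, ← h.bnorm_eq hz]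
    rw [bslice, e1, eLpNorm_const_smul, ENNReal.toReal_mul,
      eLpNorm_ball_affine a hR fun x => bnorm u x (b + R ^ 2 * s), hF,
      show (‖R‖ₑ).toReal = R by simp [abs_of_pos hR], ← mul_assoc]
    congr 1
    rw [sub_eq_add_neg, Real.rpow_add hR, Real.rpow_one]
  have e2 : eLpNorm (bslice (rescV a b R v) p') q (volume.restrict (Ioo (-1 : ℝ) 0)) =
      eLpNorm (R ^ (1 - 3 / p'.toReal) • fun s => F (b + R ^ 2 * s)) q
        (volume.restrict (Ioo (-1 : ℝ) 0)) := by
    refine eLpNorm_congr_ae ?_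
    filter_upwards [ae_restrict_mem measurableSet_Ioo] with s hs
    rw [e s hs, Pi.smul_apply, smul_eq_mul]
  rw [bmix, e2, eLpNorm_const_smul, ENNReal.toReal_mul, eLpNorm_Ioo_affine b hR F, Gfun,
    ← mul_assoc]
  congr 1
  rw [toReal_enorm, norm_eq_abs, abs_of_pos (by positivity), ← Real.rpow_add hR]
  congr 1

end Agree

theorem AA_nonneg (u : E3 → ℝ → E3) (z : E3 × ℝ) {R : ℝ} (hR : 0 < R) : 0 ≤ AA u z R :=
  Real.iSup_nonneg fun _ => Real.iSup_nonneg fun _ => by positivity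

theorem EE_nonneg (u : E3 → ℝ → E3) (z : E3 × ℝ) {R : ℝ} (hR : 0 < R) : 0 ≤ EE u z R := by
  refine mul_nonneg (by positivity) (integral_nonneg fun t => integral_nonneg fun x => ?_)
  positivity

theorem DD_nonneg (P : E3 → ℝ → ℝ) (z : E3 × ℝ) {R : ℝ} (hR : 0 < R) : 0 ≤ DD P z R := by
  refine mul_nonneg (by positivity) (integral_nonneg fun t => integral_nonneg fun x => ?_)
  positivity

theorem EEE_nonneg (u : E3 → ℝ → E3) (P : E3 → ℝ → ℝ) (z : E3 × ℝ) {R : ℝ} (hR : 0 < R) :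
    0 ≤ EEE u P z R :=
  add_nonneg (add_nonneg (AA_nonneg u z hR) (EE_nonneg u z hR)) (DD_nonneg P z hR)

theorem Gfun_nonneg (u : E3 → ℝ → E3) (p q : ℝ≥0∞) (z : E3 × ℝ) {R : ℝ} (hR : 0 < R) :
    0 ≤ Gfun u p q z R :=
  mul_nonneg (Real.rpow_nonneg hR.le _) ENNReal.toReal_nonneg

theorem exists_slice_bound {v : Fin 3 → E3 × ℝ → ℝ} (hv : ∀ j, Sm (v j)) :
    ∃ M, ∀ s, -1 < s → s < 0 → ∫ y in Metric.ball (0 : E3) 1, usq v (y, s) ≤ M := by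
  obtain ⟨B, hB⟩ := exists_un_bound hv
  refine ⟨∫ y in Metric.ball (0 : E3) 1, B ^ 2, fun s h1 h2 => ?_⟩
  refine setIntegral_mono_on (ion (slice_cont (sm_usq hv).cont s) Metric.isBounded_ball)
    (ion continuous_const Metric.isBounded_ball) measurableSet_ball fun y hy => ?_
  rw [← un_sq]
  exact pow_le_pow_left₀ (un_nonneg _ _) (hB _ (mk_mem_cy_one hy h1 h2)) 2

section Agree

variable {u : E3 → ℝ → E3} {P : E3 → ℝ → ℝ} {v : Fin 3 → E3 × ℝ → ℝ} {p : E3 × ℝ → ℝ}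
  {a : E3} {b R : ℝ}

theorem exists_affine_time (hR : 0 < R) {ρ t : ℝ} (ht : t ∈ Ioo (b - (R * ρ) ^ 2) b) :
    ∃ s, -ρ ^ 2 < s ∧ s < 0 ∧ b + R ^ 2 * s = t := by
  have h2 : 0 < R ^ 2 := by positivity
  refine ⟨(t - b) / R ^ 2, ?_, div_neg_of_neg_of_pos (by linarith [ht.2]) h2, by field_simp; ring⟩
  rw [lt_div_iff₀ h2]
  have := ht.1
  nlinarith

theorem energyLe_resc (h : AgreeOn u P v p) (hs : Sol v p) (hR : 0 < R) (ha : ‖a‖ + R ≤ 1)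
    (hb : -1 ≤ b - R ^ 2) (hb' : b ≤ 0) :
    (∀ s, -1 < s → s < 0 → ∫ y in Metric.ball (0 : E3) 1, usq (rescV a b R v) (y, s) ≤
      AA u (a, b) R) ∧ EnergyLe (rescV a b R v) (EEE u P (a, b) R) ∧
      ∫ z in cy 1, |rescP a b R p z| ^ (3 / 2 : ℝ) ≤ EEE u P (a, b) R := by
  have hv := hs.smv
  have sv : ∀ j, Sm (rescV a b R v j) := fun j => contDiff_const.mul (sm_resc (hv j) a b R)
  have A0 := AA_nonneg u (a, b) hR
  have E0 := EE_nonneg u (a, b) hR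
  have D0 := DD_nonneg P (a, b) hR
  have eE := EE_resc h hv hR ha hb hb' one_pos le_rfl
  have eD := DD_resc h hs.smP hR ha hb hb' one_pos le_rfl
  simp only [mul_one, one_pow, inv_one, one_mul] at eE eD
  have eA : ∀ s, -1 < s → s < 0 → ∫ y in Metric.ball (0 : E3) 1, usq (rescV a b R v) (y, s) =
      R⁻¹ * ∫ x in Metric.ball a R, ‖u x (b + R ^ 2 * s)‖ ^ 2 := fun s h1 h2 => by
    have := slice_rescV h hR ha hb hb' one_pos le_rfl (s := s) (by linarith) h2
    simpa only [mul_one, inv_one, one_mul] using this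
  have hA : ∀ s, -1 < s → s < 0 → ∫ y in Metric.ball (0 : E3) 1, usq (rescV a b R v) (y, s) ≤
      AA u (a, b) R := fun s h1 h2 => by
    obtain ⟨M, hM⟩ := exists_slice_bound sv
    rw [eA s h1 h2]
    have hR2 : 0 < R ^ 2 := by positivity
    refine le_biSup_of_le (I := Ioo (b - R ^ 2) b)
      (g := fun t => R⁻¹ * ∫ x in Metric.ball a R, ‖u x t‖ ^ 2) (M := M) (fun t ht => ?_)
      ⟨by nlinarith, by nlinarith⟩
    obtain ⟨s', h1', h2', rfl⟩ := exists_affine_time (b := b) hR (ρ := 1) (t := t) (by simpa using ht)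
    rw [← eA s' (by linarith) h2']
    exact hM s' (by linarith) h2'
  have hE : EEE u P (a, b) R = AA u (a, b) R + EE u (a, b) R + DD P (a, b) R := rfl
  refine ⟨hA, ⟨by linarith, fun t t1 t2 => (hA t t1 t2).trans (by linarith), ?_⟩, ?_⟩
  · rw [← eE]; linarith
  · rw [← eD]; linarith

theorem EEE_decay_step {p' q : ℝ≥0∞} {γ θ N K : ℝ}
    (hdec : ∀ v P x K, Sol v P → EnergyLe v x →
      ∫ z in cy 1, |P z| ^ (3 / 2 : ℝ) ≤ x → (∀ z ∈ cy (9 / 16), |gam v z| ≤ K) → 0 ≤ K →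
      ∃ a, 0 ≤ a ∧
        (∀ t, -θ ^ 2 < t → t < 0 →
          θ⁻¹ * ∫ y in Metric.ball (0 : E3) θ, usq v (y, t) ≤ a) ∧
        a + θ⁻¹ * (∫ z in cy (θ ^ 2), gsq v z) +
          (θ ^ 2)⁻¹ * (∫ z in cy (θ ^ 2), |P z| ^ (3 / 2 : ℝ)) ≤
          x / 2 + N * (1 + K ^ 9 + bmix v p' q ^ ((6 + 2 * γ) / γ)))
    (h : AgreeOn u P v p) (hs : Sol v p) (hθ : 0 < θ) (hθ1 : θ ≤ 1) (hR : 0 < R)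
    (ha : ‖a‖ + R ≤ 1 / 2) (hb : -(1 / 4) ≤ b - R ^ 2) (hb' : b ≤ 0) (a0 : a 0 = 0)
    (a1 : a 1 = 0) (hK0 : 0 ≤ K) (hK : ∀ z ∈ cy (1 / 4), |gam v z| ≤ K) :
    EEE u P (a, b) (R * θ) ≤ EEE u P (a, b) R / 2 +
      N * (1 + K ^ 9 + Gfun u p' q (a, b) R ^ ((6 + 2 * γ) / γ)) := by
  have ha' : ‖a‖ + R ≤ 1 := by linarith
  have hbb : -1 ≤ b - R ^ 2 := by linarith
  obtain ⟨-, hE, hp⟩ := energyLe_resc h hs hR ha' hbb hb'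
  obtain ⟨A, A0, hA, hsum⟩ := hdec _ _ _ K (sol_resc hs hR ha' hbb hb' a0 a1) hE hp
    (fun z hz => by
      rw [gam_rescV v a0 a1]
      refine hK _ ?_
      obtain ⟨z1, z2, z3⟩ := cy_sub_one (by norm_num : (9 / 16 : ℝ) ≤ 1) hz
      have hn := norm_add_le a (R • z.1)
      rw [norm_smul, norm_eq_abs, abs_of_pos hR] at hn
      have hR2 : 0 < R ^ 2 := by positivity
      have hlt : ‖a + R • z.1‖ < 1 / 2 := by nlinarith
      exact ⟨by nlinarith [norm_nonneg (a + R • z.1)], by nlinarith, by nlinarith⟩) hK0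
  rw [Gfun_resc h hR ha' hbb hb' a0 a1]
  refine le_trans ?_ hsum
  rw [← DD_resc h hs.smP hR ha' hbb hb' hθ hθ1, ← EE_resc h hs.smv hR ha' hbb hb' hθ hθ1, EEE]
  gcongr
  refine Real.iSup_le (fun t => Real.iSup_le (fun ht => ?_) A0) A0
  obtain ⟨s, h1, h2, rfl⟩ := exists_affine_time hR ht
  rw [← slice_rescV h hR ha' hbb hb' hθ hθ1 h1 h2]
  exact hA s h1 h2

theorem rescV_one (v : Fin 3 → E3 × ℝ → ℝ) : rescV 0 0 1 v = v := by
  funext j z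
  simp [rescV, resc]

theorem rescP_one (p : E3 × ℝ → ℝ) : rescP 0 0 1 p = p := by
  funext z
  simp [rescP, resc]

theorem energyLe_one (h : AgreeOn u P v p) (hs : Sol v p) : EnergyLe v (EEE u P (0, 0) 1) := by
  have := (energyLe_resc (a := 0) (b := 0) h hs one_pos (by simp) (by simp) le_rfl).2.1
  rwa [rescV_one] at this

theorem EEE_le_of_le (h : AgreeOn u P v p) (hs : Sol v p) {c : ℝ} (hc : 0 < c) (hcR : c ≤ R)
    (hR : R ≤ 1) (ha : ‖a‖ + R ≤ 1) (hb : -1 ≤ b - R ^ 2) (hb' : b ≤ 0) :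
    EEE u P (a, b) R ≤ (c ^ 2)⁻¹ * EEE u P (0, 0) 1 := by
  have hR0 : 0 < R := hc.trans_le hcR
  have hv := hs.smv
  have hsub : Metric.ball a R ⊆ Metric.ball 0 1 := by
    refine Metric.ball_subset_ball' ?_
    rw [dist_zero_right]; linarith
  have hQ : (Metric.ball a R) ×ˢ (Ioo (b - R ^ 2) b) ⊆ cy 1 := by
    rw [cy_one]
    exact prod_mono hsub (Ioo_subset_Ioo hb hb')
  have hmem : ∀ x ∈ Metric.ball a R, ∀ t ∈ Ioo (b - R ^ 2) b, ((x, t) : E3 × ℝ) ∈ cy 1 :=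
    fun x hx t ht => hQ ⟨hx, ht⟩
  have A1 : 0 ≤ AA u (0, 0) 1 := AA_nonneg u (0, 0) (zero_lt_one' ℝ)
  have i1 : R⁻¹ ≤ (c ^ 2)⁻¹ := inv_anti₀ (by positivity) (by nlinarith)
  have i2 : (R ^ 2)⁻¹ ≤ (c ^ 2)⁻¹ := inv_anti₀ (by positivity) (by gcongr)
  have hA := (energyLe_resc (a := 0) (b := 0) h hs one_pos (by simp) (by simp) le_rfl).1
  have eE := EE_resc (a := 0) (b := 0) h hv one_pos (by simp) (by simp) le_rfl one_pos le_rfl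
  have eD := DD_resc (a := 0) (b := 0) h hs.smP one_pos (by simp) (by simp) le_rfl one_pos le_rfl
  rw [rescV_one] at hA
  simp only [mul_one, one_pow, inv_one, one_mul, rescV_one, rescP_one] at eE eD
  have kA : AA u (a, b) R ≤ (c ^ 2)⁻¹ * AA u (0, 0) 1 := by
    have n : 0 ≤ (c ^ 2)⁻¹ * AA u (0, 0) 1 := mul_nonneg (by positivity) A1
    refine Real.iSup_le (fun t => Real.iSup_le (fun ht => ?_) n) n
    have e0 : ∀ x ∈ Metric.ball a R, ‖u x t‖ ^ 2 = usq v (x, t) := fun x hx =>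
      h.norm_sq (z := (x, t)) (hmem x hx t ht)
    have e1 : ∫ x in Metric.ball a R, ‖u x t‖ ^ 2 = ∫ x in Metric.ball a R, usq v (x, t) :=
      setIntegral_congr_fun measurableSet_ball e0
    have e2 : ∫ x in Metric.ball a R, usq v (x, t) ≤ ∫ x in Metric.ball 0 1, usq v (x, t) :=
      setIntegral_mono_set (ion (slice_cont (sm_usq hv).cont t) Metric.isBounded_ball)
        (Filter.Eventually.of_forall fun _ => usq_nonneg v _) hsub.eventuallyLE
    have e3 := hA t (hb.trans_lt ht.1) (ht.2.trans_le hb')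
    have e4 : 0 ≤ ∫ x in Metric.ball a R, usq v (x, t) := integral_nonneg fun _ => usq_nonneg v _
    rw [e1]
    exact mul_le_mul i1 (e2.trans e3) e4 (by positivity)
  have kE : EE u (a, b) R ≤ (c ^ 2)⁻¹ * EE u (0, 0) 1 := by
    rw [eE]
    refine mul_le_mul i1 ?_ (integral_nonneg fun _ => integral_nonneg fun _ => by positivity)
      (by positivity)
    refine le_trans (le_of_eq ?_) (setIntegral_mono_set (icy (sm_gsq hv).cont 1)
      (Filter.Eventually.of_forall fun _ => gsq_nonneg v _) hQ.eventuallyLE)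
    rw [setInt_prod_symm (sm_gsq hv).cont]
    have e0 : ∀ t ∈ Ioo (b - R ^ 2) b, ∀ x ∈ Metric.ball a R,
        ∑ j, ∑ i, (pd (fun y => u y t j) i x) ^ 2 = gsq v (x, t) := fun t ht x hx =>
      h.sum_pd_sq hv (z := (x, t)) (hmem x hx t ht)
    exact setIntegral_congr_fun measurableSet_Ioo fun t ht =>
      setIntegral_congr_fun measurableSet_ball (e0 t ht)
  have hc' : Continuous fun z => |p z| ^ (3 / 2 : ℝ) :=
    hs.smP.cont.abs.rpow_const fun _ => Or.inr (by norm_num)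
  have kD : DD P (a, b) R ≤ (c ^ 2)⁻¹ * DD P (0, 0) 1 := by
    rw [eD]
    refine mul_le_mul i2 ?_ (integral_nonneg fun _ => integral_nonneg fun _ => by positivity)
      (by positivity)
    refine le_trans (le_of_eq ?_) (setIntegral_mono_set (icy hc' 1)
      (Filter.Eventually.of_forall fun _ => by positivity) hQ.eventuallyLE)
    rw [setInt_prod_symm hc']
    refine setIntegral_congr_fun measurableSet_Ioo fun t ht => ?_
    refine setIntegral_congr_fun measurableSet_ball fun x hx => ?_
    have e1 := (h _ (hmem x hx t ht)).2
    simp only at e1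
    simp only [e1]
  simp only [EEE, mul_add]
  linarith

end Agree

theorem one_le_log_log {R : ℝ} (hR : 0 < R) (h : R ≤ 1 / 4) :
    1 ≤ Real.log (Real.log (100 / R)) := by
  have h3 : Real.exp 3 ≤ 100 / R := by
    have e : Real.exp 3 = Real.exp 1 ^ 3 := by rw [← Real.exp_nat_mul]; norm_num
    rw [e, le_div_iff₀ hR]
    have e1 : Real.exp 1 ^ 3 ≤ 3 ^ 3 :=
      pow_le_pow_left₀ (Real.exp_pos 1).le (by linarith [Real.exp_one_lt_d9]) 3
    have e2 : 0 < Real.exp 1 ^ 3 := by positivity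
    nlinarith
  have h1 : 3 ≤ Real.log (100 / R) := (Real.le_log_iff_exp_le (by positivity)).2 h3
  rw [Real.le_log_iff_exp_le (by linarith)]
  linarith [Real.exp_one_lt_d9]

theorem omg_pos {R : ℝ} (hR : 0 < R) (h : R ≤ 1 / 4) : 0 < omg R :=
  inv_pos.2 (zero_lt_one.trans_le (one_le_log_log hR h))

theorem omg_le_one {R : ℝ} (hR : 0 < R) (h : R ≤ 1 / 4) : omg R ≤ 1 :=
  inv_le_one_of_one_le₀ (one_le_log_log hR h)

theorem omg_mono {R R' : ℝ} (hR : 0 < R) (h : R ≤ R') (h' : R' ≤ 1 / 4) : omg R ≤ omg R' := by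
  have hR' : 0 < R' := hR.trans_le h
  refine inv_anti₀ (zero_lt_one.trans_le (one_le_log_log hR' h')) ?_
  have h1 : 0 < Real.log (100 / R') := Real.log_pos (by rw [lt_div_iff₀ hR']; linarith)
  gcongr

/-- A geometric decay estimate with a weight implies a uniform bound down to scale zero. -/
theorem le_of_decay {F w : ℝ → ℝ} {θ M B : ℝ} (hθ : 0 < θ) (hθ1 : θ < 1)
    (hB : ∀ R, θ / 4 ≤ R → R ≤ 1 / 4 → F R * w R ≤ M + 2 * B) (hM : 0 ≤ M)
    (hF : ∀ R, 0 < R → 0 ≤ F R) (hw : ∀ R, 0 < R → R ≤ 1 / 4 → 0 ≤ w R)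
    (hmono : ∀ R R', 0 < R → R ≤ R' → R' ≤ 1 / 4 → w R ≤ w R')
    (step : ∀ R, 0 < R → R ≤ 1 / 4 → ∃ g, F (R * θ) ≤ F R / 2 + g ∧ 0 ≤ g ∧ g * w R ≤ B) :
    ∀ R, 0 < R → R ≤ 1 / 4 → F R * w R ≤ M + 2 * B := by
  have key : ∀ k : ℕ, ∀ R, θ ^ (k + 1) / 4 ≤ R → R ≤ 1 / 4 → F R * w R ≤ M + 2 * B := by
    intro k
    induction k with
    | zero => intro R h1 h2; exact hB R (by simpa using h1) h2
    | succ k ih =>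
      intro R h1 h2
      rcases le_or_gt (θ / 4) R with h | h
      · exact hB R h h2
      have hR : 0 < R := lt_of_lt_of_le (by positivity) h1
      have h3 : R / θ ≤ 1 / 4 := by rw [div_le_iff₀ hθ]; linarith
      have h4 : 0 < R / θ := by positivity
      have h5 : R ≤ R / θ := by rw [le_div_iff₀ hθ]; nlinarith
      have e : R / θ * θ = R := div_mul_cancel₀ R hθ.ne'
      obtain ⟨g, hg, g0, hgB⟩ := step _ h4 h3
      rw [e] at hg
      have i1 := ih (R / θ) (by rw [le_div_iff₀ hθ]; rw [pow_succ] at h1; linarith) h3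
      have i2 := hmono R _ hR h5 h3
      have w0 := hw R hR h2
      have F0 := hF _ h4
      have i3 : F R * w R ≤ (F (R / θ) / 2 + g) * w R := mul_le_mul_of_nonneg_right hg w0
      have i4 : (F (R / θ) / 2 + g) * w R ≤ (F (R / θ) / 2 + g) * w (R / θ) :=
        mul_le_mul_of_nonneg_left i2 (by linarith)
      have i5 : (F (R / θ) / 2 + g) * w (R / θ) = F (R / θ) * w (R / θ) / 2 + g * w (R / θ) := by
        ring
      linarith
  intro R h1 h2
  obtain ⟨n, hn⟩ := exists_pow_lt_of_lt_one (by positivity : 0 < 4 * R) hθ1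
  refine key n R ?_ h2
  have : θ ^ (n + 1) ≤ θ ^ n := pow_le_pow_of_le_one hθ.le hθ1.le (Nat.le_succ n)
  linarith

theorem bound_collect {y g C N c : ℝ} (hy : 0 ≤ y) (hg : 0 ≤ g) (hC : 0 ≤ C) (hN : 0 ≤ N)
    (hc : 0 ≤ c) : c * y + 2 * (N * (1 + (C * (1 + y) ^ 2) ^ 9 + g)) ≤
      (c + 2 * N * (1 + C ^ 9 * 2 ^ 17)) * (1 + y ^ 18 + g) := by
  have h1 : y ≤ 1 + y ^ 18 + g := by
    rcases le_total y 1 with h | h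
    · have : 0 ≤ y ^ 18 := by positivity
      linarith
    · have := le_self_pow₀ h (by norm_num : 18 ≠ 0)
      linarith
  have h2 : (1 + y) ^ 18 ≤ 2 ^ 17 * (1 + y ^ 18 + g) := by
    have := add_pow_le (zero_le_one' ℝ) hy 18
    norm_num at this ⊢
    linarith
  have h3 : 0 ≤ y ^ 18 := by positivity
  have h4 : c * y ≤ c * (1 + y ^ 18 + g) := mul_le_mul_of_nonneg_left h1 hc
  have h5 : (C * (1 + y) ^ 2) ^ 9 ≤ C ^ 9 * (2 ^ 17 * (1 + y ^ 18 + g)) := by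
    rw [mul_pow, ← pow_mul]
    exact mul_le_mul_of_nonneg_left h2 (by positivity)
  have h6 : N * (1 + (C * (1 + y) ^ 2) ^ 9 + g) ≤
      N * ((1 + y ^ 18 + g) + C ^ 9 * (2 ^ 17 * (1 + y ^ 18 + g))) :=
    mul_le_mul_of_nonneg_left (by linarith) hN
  linarith

/-- boundedness of the weighted scaled energy `𝓔_β`. -/
theorem energy_bound (p q : ℝ≥0∞) (γ : ℝ) (hp : 1 < p) (hq : 1 < q)
    (hγ : 0 < γ) (hγ' : γ < 1)
    (hpq : 3 / p.toReal + 2 / q.toReal = 2 - γ) :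
    ∃ N₀ : ℝ, ∀ (u : E3 → ℝ → E3) (P : E3 → ℝ → ℝ) (U : Set (E3 × ℝ)),
      IsNSQ1 u P U → IsAxisym u P U →
      ∀ (x₀ : E3) (t₀ : ℝ), x₀ 0 = 0 → x₀ 1 = 0 → (x₀, t₀) ∈ Qyl (0, 0) (1/8) →
      ∀ β G₀ : ℝ, 0 < β → β < 1/8 →
      (∀ R : ℝ, 0 < R → R ≤ 1/4 →
        Gfun u p q (x₀, t₀) R * omg R ^ (γ * β / (6 + 2*γ)) ≤ G₀) →
      ∀ R : ℝ, 0 < R → R ≤ 1/4 →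
        EEE u P (x₀, t₀) R * omg R ^ β ≤
          N₀ ^ (12/γ) * (1 + EEE u P (0, 0) 1 ^ (18:ℕ) + G₀ ^ ((6 + 2*γ)/γ)) := by
  obtain ⟨θ, hθ, hθ4, N, hN, hdec⟩ := energy_decay hp hq hγ hγ' hpq
  obtain ⟨C, hC, hgam⟩ := gam_bound
  have hC0 : 0 ≤ C := zero_le_one.trans hC
  set N₁ : ℝ := ((θ / 4) ^ 2)⁻¹ + 2 * N * (1 + C ^ 9 * 2 ^ 17) with hN₁
  have hN₁0 : 0 ≤ N₁ := by positivity
  refine ⟨N₁ ^ (γ / 12), fun u P U hns hax x₀ t₀ a0 a1 hz β G₀ hβ _ hG R hR hR4 => ?_⟩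
  have eN : (N₁ ^ (γ / 12)) ^ (12 / γ) = N₁ := by
    rw [← Real.rpow_mul hN₁0, div_mul_div_cancel₀' hγ.ne', div_self (by norm_num), Real.rpow_one]
  rw [eN]
  obtain ⟨v, p₁, hs, hag⟩ := exists_sol hns hax
  have hag : AgreeOn u P v p₁ := hag
  simp only [Qyl, mem_prod, Metric.mem_ball, dist_zero_right, mem_Ioo] at hz
  obtain ⟨hx, ht, ht'⟩ := hz
  norm_num at ht
  have y0 : 0 ≤ EEE u P (0, 0) 1 := EEE_nonneg u P (0, 0) (zero_lt_one' ℝ)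
  have hE := energyLe_one hag hs
  set y := EEE u P (0, 0) 1
  set r := (6 + 2 * γ) / γ with hr
  have hr0 : 0 ≤ r := by positivity
  have hαr : γ * β / (6 + 2 * γ) * r = β := by rw [hr]; field_simp
  set K := C * (1 + y) ^ 2 with hKd
  have hK0 : 0 ≤ K := by positivity
  have hK : ∀ z ∈ cy (1 / 4), |gam v z| ≤ K := fun z hz => by
    refine abs_le_of_sq_le_sq ?_ hK0
    have h1 := hgam v p₁ y hs hE z hz
    have h2 : C * (1 + y) ^ 4 ≤ K ^ 2 := by
      have : C * (1 + y) ^ 4 ≤ C ^ 2 * (1 + y) ^ 4 :=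
        mul_le_mul_of_nonneg_right (by nlinarith) (by positivity)
      rw [hKd]; linarith
    linarith
  have hω : ∀ R, 0 < R → R ≤ 1 / 4 → 0 ≤ omg R ^ β := fun R h h' =>
    Real.rpow_nonneg (omg_pos h h').le _
  have hω1 : ∀ R, 0 < R → R ≤ 1 / 4 → omg R ^ β ≤ 1 := fun R h h' =>
    Real.rpow_le_one (omg_pos h h').le (omg_le_one h h') hβ.le
  have hG0 : 0 ≤ G₀ := (mul_nonneg (Gfun_nonneg u p q _ hR)
    (Real.rpow_nonneg (omg_pos hR hR4).le _)).trans (hG R hR hR4)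
  have hg0 : 0 ≤ G₀ ^ r := Real.rpow_nonneg hG0 _
  have hsq : ∀ R, 0 < R → R ≤ 1 / 4 → -(1 / 4) ≤ t₀ - R ^ 2 := fun R h h' => by nlinarith
  refine le_trans (le_of_decay (F := fun R => EEE u P (x₀, t₀) R) (w := fun R => omg R ^ β)
    (M := ((θ / 4) ^ 2)⁻¹ * y) (B := N * (1 + K ^ 9 + G₀ ^ r)) hθ (by linarith)
    (fun R h1 h2 => ?_) (by positivity) (fun R h => EEE_nonneg u P _ h) hω
    (fun R R' h1 h2 h3 => Real.rpow_le_rpow (omg_pos h1 (h2.trans h3)).le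
      (omg_mono h1 h2 h3) hβ.le)
    (fun R h1 h2 => ?_) R hR hR4) (bound_collect y0 hg0 hC0 hN (by positivity))
  · have hRp : 0 < R := lt_of_lt_of_le (by positivity) h1
    have e1 : EEE u P (x₀, t₀) R ≤ ((θ / 4) ^ 2)⁻¹ * y :=
      EEE_le_of_le hag hs (by positivity) h1 (by linarith) (by linarith)
        (by linarith [hsq R hRp h2]) ht'.le
    have e2 := mul_le_of_le_one_right (EEE_nonneg u P (x₀, t₀) hRp) (hω1 R hRp h2)
    have e3 : 0 ≤ N * (1 + K ^ 9 + G₀ ^ r) := by positivity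
    linarith
  · have g0 := Gfun_nonneg u p q (x₀, t₀) h1
    have gr0 : 0 ≤ Gfun u p q (x₀, t₀) R ^ r := Real.rpow_nonneg g0 _
    have hd := EEE_decay_step hdec hag hs hθ (by linarith) h1 (by linarith) (hsq R h1 h2) ht'.le
      a0 a1 hK0 hK
    refine ⟨_, hd, by positivity, ?_⟩
    have e1 : Gfun u p q (x₀, t₀) R ^ r * omg R ^ β ≤ G₀ ^ r := by
      rw [← hαr, Real.rpow_mul (omg_pos h1 h2).le, ← Real.mul_rpow g0
        (Real.rpow_nonneg (omg_pos h1 h2).le _)]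
      exact Real.rpow_le_rpow (mul_nonneg g0 (Real.rpow_nonneg (omg_pos h1 h2).le _))
        (hG R h1 h2) hr0
    have e2 : (1 + K ^ 9) * omg R ^ β ≤ 1 + K ^ 9 :=
      mul_le_of_le_one_right (by positivity) (hω1 R h1 h2)
    rw [mul_assoc]
    refine mul_le_mul_of_nonneg_left ?_ hN
    rw [add_mul]
    linarith
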